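/- Let p > 1, β = 1/(p−1), and let D be either ℝ^N or an open half-space of ℝ^N. Let v be a classical solution of v_t = Δv + |v|^{p−1}v on (−1,0)×D, with v = 0 on (−1,0)×∂D when D is a half-space, satisfying |v(s,y)| ≤ M|s|^{−β} on (−1,0)×D for some M > 0. Suppose there exists R > 0 such that sup over (−1,0)×(closure(D) ∩ {|y| ≥ R}) of |v| is finite and v extends to a C^{1,2} function on [−1,0] × (closure(D) ∩ {|y| > R}), and suppose there exists K ≥ R+1 such that the extension satisfies v(0,y) = 0 for all y ∈ closure(D) with |y| ≥ K. Then v ≡ 0 on (−1,0)×D. -/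

import Mathlib

open MeasureTheory Filter Set Metric
open scoped ENNReal Topology RealInnerProductSpace

noncomputable section

/-- The Laplacian of `f : ℝ^N → ℝ`, as the sum of second partial derivatives. -/
def lap {N : ℕ} (f : EuclideanSpace ℝ (Fin N) → ℝ) (x : EuclideanSpace ℝ (Fin N)) : ℝ :=
  ∑ i, fderiv ℝ (fun y => fderiv ℝ f y (EuclideanSpace.single i 1)) x (EuclideanSpace.single i 1)

section Aux
open scoped ContDiff

/-- partial derivative -/
def pd {N : ℕ} (i : Fin N) (f : EuclideanSpace ℝ (Fin N) → ℝ) (x : EuclideanSpace ℝ (Fin N)) : ℝ :=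
  fderiv ℝ f x (EuclideanSpace.single i 1)

lemma lap_eq {N : ℕ} (f : EuclideanSpace ℝ (Fin N) → ℝ) (x : EuclideanSpace ℝ (Fin N)) :
    lap f x = ∑ i, pd i (pd i f) x := rfl

lemma pd_mul {N : ℕ} (i : Fin N) {f g : EuclideanSpace ℝ (Fin N) → ℝ}
    {x : EuclideanSpace ℝ (Fin N)} (hf : DifferentiableAt ℝ f x) (hg : DifferentiableAt ℝ g x) :
    pd i (fun y => f y * g y) x = pd i f x * g x + f x * pd i g x := by
  unfold pd
  rw [fderiv_fun_mul hf hg]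
  simp; ring

lemma pd_add {N : ℕ} (i : Fin N) {f g : EuclideanSpace ℝ (Fin N) → ℝ}
    {x : EuclideanSpace ℝ (Fin N)} (hf : DifferentiableAt ℝ f x) (hg : DifferentiableAt ℝ g x) :
    pd i (fun y => f y + g y) x = pd i f x + pd i g x := by
  unfold pd
  rw [fderiv_fun_add hf hg]; rfl

lemma pd_sub {N : ℕ} (i : Fin N) {f g : EuclideanSpace ℝ (Fin N) → ℝ}
    {x : EuclideanSpace ℝ (Fin N)} (hf : DifferentiableAt ℝ f x) (hg : DifferentiableAt ℝ g x) :
    pd i (fun y => f y - g y) x = pd i f x - pd i g x := by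
  unfold pd
  rw [fderiv_fun_sub hf hg]; rfl

lemma pd_sum {N : ℕ} (i : Fin N) {f : Fin N → EuclideanSpace ℝ (Fin N) → ℝ}
    {x : EuclideanSpace ℝ (Fin N)} (hf : ∀ j, DifferentiableAt ℝ (f j) x) :
    pd i (fun y => ∑ j, f j y) x = ∑ j, pd i (f j) x := by
  unfold pd
  rw [fderiv_fun_sum (fun j _ => hf j)]
  simp

lemma pd_const {N : ℕ} (i : Fin N) (c : ℝ) (x : EuclideanSpace ℝ (Fin N)) :
    pd i (fun _ => c) x = 0 := by
  simp [pd]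

lemma pd_const_mul {N : ℕ} (i : Fin N) (c : ℝ) {f : EuclideanSpace ℝ (Fin N) → ℝ}
    {x : EuclideanSpace ℝ (Fin N)} (hf : DifferentiableAt ℝ f x) :
    pd i (fun y => c * f y) x = c * pd i f x := by
  unfold pd
  rw [fderiv_const_mul hf]; simp

lemma pd_comp {N : ℕ} (i : Fin N) {h : ℝ → ℝ} {f : EuclideanSpace ℝ (Fin N) → ℝ}
    {x : EuclideanSpace ℝ (Fin N)} (hh : DifferentiableAt ℝ h (f x)) (hf : DifferentiableAt ℝ f x) :
    pd i (fun y => h (f y)) x = deriv h (f x) * pd i f x := by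
  unfold pd
  have := (hh.hasDerivAt.comp_hasFDerivAt x hf.hasFDerivAt)
  have h2 := this.fderiv
  rw [show (fun y => h (f y)) = h ∘ f from rfl, h2]; simp

lemma pd_congr {N : ℕ} (i : Fin N) {f g : EuclideanSpace ℝ (Fin N) → ℝ}
    {x : EuclideanSpace ℝ (Fin N)} (h : f =ᶠ[𝓝 x] g) : pd i f x = pd i g x := by
  unfold pd
  rw [h.fderiv_eq]

lemma pd_congr' {N : ℕ} (i : Fin N) {f g : EuclideanSpace ℝ (Fin N) → ℝ}
    {x : EuclideanSpace ℝ (Fin N)} (h : f =ᶠ[𝓝 x] g) : pd i f =ᶠ[𝓝 x] pd i g := by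
  filter_upwards [h.eventuallyEq_nhds] with y hy using pd_congr i hy

lemma lap_congr {N : ℕ} {f g : EuclideanSpace ℝ (Fin N) → ℝ}
    {x : EuclideanSpace ℝ (Fin N)} (h : f =ᶠ[𝓝 x] g) : lap f x = lap g x := by
  simp only [lap_eq]
  exact Finset.sum_congr rfl fun i _ => pd_congr i (pd_congr' i h)

lemma pd_coord {N : ℕ} (i j : Fin N) (c x : EuclideanSpace ℝ (Fin N)) :
    pd i (fun y => (y - c) j) x = if i = j then 1 else 0 := by
  unfold pd
  have h : HasFDerivAt (fun y : EuclideanSpace ℝ (Fin N) => (y - c) j)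
      (EuclideanSpace.proj j : EuclideanSpace ℝ (Fin N) →L[ℝ] ℝ) x := by
    have := ((EuclideanSpace.proj j : EuclideanSpace ℝ (Fin N) →L[ℝ] ℝ).hasFDerivAt
      (x := x - c)).comp x ((hasFDerivAt_id x).sub_const c)
    exact this
  rw [h.fderiv]
  simp [eq_comm]

lemma contDiff_coord {N : ℕ} {n : WithTop ℕ∞} (j : Fin N) (c : EuclideanSpace ℝ (Fin N)) :
    ContDiff ℝ n (fun y : EuclideanSpace ℝ (Fin N) => (y - c) j) := by
  have : ContDiff ℝ n (fun y : EuclideanSpace ℝ (Fin N) =>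
    (EuclideanSpace.proj j : EuclideanSpace ℝ (Fin N) →L[ℝ] ℝ) (y - c)) := by fun_prop
  simpa using this

lemma contDiff_pd {N : ℕ} {n m : WithTop ℕ∞} (hnm : m + 1 ≤ n) (i : Fin N)
    {f : EuclideanSpace ℝ (Fin N) → ℝ} (hf : ContDiff ℝ n f) : ContDiff ℝ m (pd i f) := by
  unfold pd
  exact (hf.fderiv_right hnm).clm_apply contDiff_const

lemma contDiff_pd_top {N : ℕ} (i : Fin N)
    {f : EuclideanSpace ℝ (Fin N) → ℝ} (hf : ContDiff ℝ ∞ f) : ContDiff ℝ ∞ (pd i f) :=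
  contDiff_pd (by simp) i hf

lemma contDiff_lap_top {N : ℕ} 
    {f : EuclideanSpace ℝ (Fin N) → ℝ} (hf : ContDiff ℝ ∞ f) : ContDiff ℝ ∞ (lap f) := by
  have : lap f = fun x => ∑ i, pd i (pd i f) x := rfl
  rw [this]
  exact ContDiff.sum fun i _ => contDiff_pd_top i (contDiff_pd_top i hf)

lemma contDiffOn_pd {N : ℕ} {n m : WithTop ℕ∞} (hnm : m + 1 ≤ n) (i : Fin N)
    {Ω : Set (EuclideanSpace ℝ (Fin N))} (hΩ : IsOpen Ω)
    {f : EuclideanSpace ℝ (Fin N) → ℝ} (hf : ContDiffOn ℝ n f Ω) : ContDiffOn ℝ m (pd i f) Ω := by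
  unfold pd
  exact (hf.fderiv_of_isOpen hΩ hnm).clm_apply contDiffOn_const

lemma pd_symm {N : ℕ} (i j : Fin N) {f : EuclideanSpace ℝ (Fin N) → ℝ} (hf : ContDiff ℝ 2 f)
    (x : EuclideanSpace ℝ (Fin N)) : pd i (pd j f) x = pd j (pd i f) x := by
  have hd : DifferentiableAt ℝ (fderiv ℝ f) x :=
    (hf.fderiv_right (m := 1) (by norm_num)).differentiable (by norm_num) x
  have hs : IsSymmSndFDerivAt ℝ f x := (hf.contDiffAt).isSymmSndFDerivAt (by simp)
  unfold pd
  rw [fderiv_clm_apply hd (differentiableAt_const _), fderiv_clm_apply hd (differentiableAt_const _)]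
  simp
  exact hs _ _

lemma hasCompactSupport_pd {N : ℕ} (i : Fin N) {f : EuclideanSpace ℝ (Fin N) → ℝ}
    (hf : HasCompactSupport f) : HasCompactSupport (pd i f) := hf.fderiv_apply ℝ _

lemma tsupport_pd {N : ℕ} (i : Fin N) (f : EuclideanSpace ℝ (Fin N) → ℝ) :
    tsupport (pd i f) ⊆ tsupport f := tsupport_fderiv_apply_subset ℝ _

lemma pd_zero_of_notMem {N : ℕ} (i : Fin N) {f : EuclideanSpace ℝ (Fin N) → ℝ}
    {x : EuclideanSpace ℝ (Fin N)} (hx : x ∉ tsupport f) : pd i f x = 0 :=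
  image_eq_zero_of_notMem_tsupport (fun h => hx (tsupport_pd i f h))

lemma lap_zero_of_notMem {N : ℕ} {f : EuclideanSpace ℝ (Fin N) → ℝ}
    {x : EuclideanSpace ℝ (Fin N)} (hx : x ∉ tsupport f) : lap f x = 0 := by
  rw [lap_eq]
  exact Finset.sum_eq_zero fun i _ => pd_zero_of_notMem i (fun h => hx (tsupport_pd i f h))

lemma tsupport_lap {N : ℕ} (f : EuclideanSpace ℝ (Fin N) → ℝ) :
    tsupport (lap f) ⊆ tsupport f := by
  apply closure_minimal _ (isClosed_tsupport f)
  intro x hx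
  by_contra h
  exact hx (lap_zero_of_notMem h)

lemma hasCompactSupport_lap {N : ℕ} {f : EuclideanSpace ℝ (Fin N) → ℝ}
    (hf : HasCompactSupport f) : HasCompactSupport (lap f) :=
  hf.of_isClosed_subset (isClosed_tsupport _) (tsupport_lap f)

lemma integral_pd_eq_zero {N : ℕ} (i : Fin N) {f : EuclideanSpace ℝ (Fin N) → ℝ}
    (hf : ContDiff ℝ 1 f) (hc : HasCompactSupport f) : ∫ x, pd i f x = 0 := by
  have h1 : Integrable (pd i f) :=
    (contDiff_pd (m := 0) (by norm_num) i hf).continuous.integrable_of_hasCompactSupport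
      (hasCompactSupport_pd i hc)
  have h1' : Integrable (fun x => fderiv ℝ f x (EuclideanSpace.single i 1)) := h1
  have h2 : Integrable f := hf.continuous.integrable_of_hasCompactSupport hc
  have := integral_mul_fderiv_eq_neg_fderiv_mul_of_integrable (μ := volume)
    (f := fun _ : EuclideanSpace ℝ (Fin N) => (1:ℝ)) (g := f) (v := EuclideanSpace.single i 1)
    (by simp) (by simpa [pd] using h1') (by simpa using h2) (by simp) (fun x _ => hf.differentiable (by norm_num) x)
  simpa [pd] using this

lemma integral_div_eq_zero {N : ℕ} {f : Fin N → EuclideanSpace ℝ (Fin N) → ℝ}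
    (hf : ∀ i, ContDiff ℝ 1 (f i)) (hc : ∀ i, HasCompactSupport (f i)) :
    ∫ x, ∑ i, pd i (f i) x = 0 := by
  rw [integral_finsetSum]
  · exact Finset.sum_eq_zero fun i _ => integral_pd_eq_zero i (hf i) (hc i)
  · intro i _
    exact (contDiff_pd (m := 0) (by norm_num) i (hf i)).continuous.integrable_of_hasCompactSupport
      (hasCompactSupport_pd i (hc i))

/-- test functions -/
structure TestOn {N : ℕ} (Ω : Set (EuclideanSpace ℝ (Fin N))) (φ : EuclideanSpace ℝ (Fin N) → ℝ) :
    Prop where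
  smooth : ContDiff ℝ ∞ φ
  cpt : HasCompactSupport φ
  supp : tsupport φ ⊆ Ω

lemma TestOn.mono {N : ℕ} {Ω Ω' : Set (EuclideanSpace ℝ (Fin N))}
    {φ : EuclideanSpace ℝ (Fin N) → ℝ} (h : TestOn Ω φ) (hs : Ω ⊆ Ω') : TestOn Ω' φ :=
  ⟨h.smooth, h.cpt, h.supp.trans hs⟩

lemma TestOn.pd {N : ℕ} {Ω : Set (EuclideanSpace ℝ (Fin N))}
    {φ : EuclideanSpace ℝ (Fin N) → ℝ} (h : TestOn Ω φ) (i : Fin N) : TestOn Ω (pd i φ) :=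
  ⟨contDiff_pd_top i h.smooth, hasCompactSupport_pd i h.cpt, (tsupport_pd i φ).trans h.supp⟩

lemma TestOn.lap {N : ℕ} {Ω : Set (EuclideanSpace ℝ (Fin N))}
    {φ : EuclideanSpace ℝ (Fin N) → ℝ} (h : TestOn Ω φ) : TestOn Ω (lap φ) :=
  ⟨contDiff_lap_top h.smooth, hasCompactSupport_lap h.cpt, (tsupport_lap φ).trans h.supp⟩

lemma contDiff_mul_test {N : ℕ} {Ω : Set (EuclideanSpace ℝ (Fin N))} (hΩ : IsOpen Ω)
    {n : WithTop ℕ∞} (hn : n ≤ ((⊤ : ℕ∞) : WithTop ℕ∞))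
    {φ f : EuclideanSpace ℝ (Fin N) → ℝ} (h : TestOn Ω φ) (hf : ContDiffOn ℝ n f Ω) :
    ContDiff ℝ n (fun x => f x * φ x) := by
  rw [contDiff_iff_contDiffAt]
  intro x
  by_cases hx : x ∈ tsupport φ
  · exact (hf.contDiffAt (hΩ.mem_nhds (h.supp hx))).mul ((h.smooth.of_le hn).contDiffAt)
  · have : (fun x => f x * φ x) =ᶠ[𝓝 x] fun _ => 0 := by
      filter_upwards [(isClosed_tsupport φ).isOpen_compl.mem_nhds hx] with y hy
      rw [image_eq_zero_of_notMem_tsupport hy, mul_zero]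
    exact contDiffAt_const.congr_of_eventuallyEq this

/-- Green identity against a test function -/
lemma green_test {N : ℕ} {Ω : Set (EuclideanSpace ℝ (Fin N))} (hΩ : IsOpen Ω)
    {φ f : EuclideanSpace ℝ (Fin N) → ℝ} (h : TestOn Ω φ) (hf : ContDiffOn ℝ 2 f Ω) :
    ∫ x, f x * lap φ x = ∫ x, lap f x * φ x := by
  have c1 : ∀ i, ContDiff ℝ 1 (fun x => f x * pd i φ x) := fun i =>
    contDiff_mul_test hΩ (by simp) (h.pd i) (hf.of_le (by norm_num))
  have c2 : ∀ i, ContDiff ℝ 1 (fun x => pd i f x * φ x) := fun i =>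
    contDiff_mul_test hΩ (by simp) h (contDiffOn_pd (by norm_num) i hΩ hf)
  have key := integral_div_eq_zero (f := fun i x => f x * pd i φ x - pd i f x * φ x)
    (fun i => (c1 i).sub (c2 i))
    (fun i => ((h.pd i).cpt.mul_left (f := f)).sub (h.cpt.mul_left (f := pd i f)))
  have e : ∀ x, ∑ i, pd i (fun x => f x * pd i φ x - pd i f x * φ x) x
      = f x * lap φ x - lap f x * φ x := by
    intro x
    by_cases hx : x ∈ tsupport φ
    · have hxΩ := hΩ.mem_nhds (h.supp hx)
      have d1 : DifferentiableAt ℝ f x := (hf.contDiffAt hxΩ).differentiableAt (by norm_num)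
      have d2 : ∀ i, DifferentiableAt ℝ (pd i f) x := fun i =>
        ((contDiffOn_pd (m := 1) (by norm_num) i hΩ hf).contDiffAt hxΩ).differentiableAt (by norm_num)
      have d3 : DifferentiableAt ℝ φ x := h.smooth.differentiable (by simp) x
      have d4 : ∀ i, DifferentiableAt ℝ (pd i φ) x := fun i =>
        (h.pd i).smooth.differentiable (by simp) x
      rw [lap_eq, lap_eq, Finset.mul_sum, Finset.sum_mul, ← Finset.sum_sub_distrib]
      refine Finset.sum_congr rfl fun i _ => ?_
      rw [pd_sub i (d1.fun_mul (d4 i)) ((d2 i).fun_mul d3), pd_mul i d1 (d4 i), pd_mul i (d2 i) d3]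
      ring
    · rw [lap_zero_of_notMem hx, image_eq_zero_of_notMem_tsupport hx]
      simp only [mul_zero, sub_zero]
      refine Finset.sum_eq_zero fun i _ => ?_
      apply pd_zero_of_notMem
      intro hx'
      apply hx
      refine closure_mono ?_ (hx')|> fun h2 => (isClosed_tsupport φ).closure_eq ▸ h2
      intro y hy
      by_contra hy2
      apply hy
      simp [image_eq_zero_of_notMem_tsupport hy2, pd_zero_of_notMem i hy2]
  simp only [e] at key
  have i1 : Integrable fun x => f x * lap φ x :=
    (contDiff_mul_test hΩ (n := 0) (by simp) h.lap (hf.of_le (by norm_num))).continuous.integrable_of_hasCompactSupport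
      (h.lap.cpt.mul_left)
  have cl : ContDiffOn ℝ 0 (lap f) Ω := by
    have : lap f = fun x => ∑ i, pd i (pd i f) x := rfl
    rw [this]
    exact ContDiffOn.sum fun i _ => contDiffOn_pd (m := 0) (n := 1) (by norm_num) i hΩ
      (contDiffOn_pd (by norm_num) i hΩ hf)
  have i2 : Integrable fun x => lap f x * φ x :=
    (contDiff_mul_test hΩ (n := 0) (by simp) h cl).continuous.integrable_of_hasCompactSupport
      (h.cpt.mul_left)
  rw [integral_sub i1 i2] at key
  linarith

lemma continuousOn_lap {N : ℕ} {Ω : Set (EuclideanSpace ℝ (Fin N))} (hΩ : IsOpen Ω)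
    {f : EuclideanSpace ℝ (Fin N) → ℝ} (hf : ContDiffOn ℝ 2 f Ω) : ContinuousOn (lap f) Ω := by
  have : lap f = fun x => ∑ i, pd i (pd i f) x := rfl
  rw [this]
  exact (ContDiffOn.sum fun i _ => contDiffOn_pd (m := 0) (n := 1) (by norm_num) i hΩ
      (contDiffOn_pd (by norm_num) i hΩ hf)).continuousOn

end Aux

section Aux2
open scoped ContDiff

lemma two_le_top : (2 : WithTop ℕ∞) ≤ ((⊤ : ℕ∞) : WithTop ℕ∞) :=
  WithTop.coe_le_coe.2 (le_top : (2 : ℕ∞) ≤ ⊤)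

/-- Gaussian weight -/
def gs {N : ℕ} (x0 : EuclideanSpace ℝ (Fin N)) (τ : ℝ) (x : EuclideanSpace ℝ (Fin N)) : ℝ :=
  Real.exp (-(‖x - x0‖ ^ 2) / (4 * τ))

lemma norm_sq_coord {N : ℕ} (y : EuclideanSpace ℝ (Fin N)) : ‖y‖ ^ 2 = ∑ i, y i ^ 2 := by
  rw [EuclideanSpace.norm_sq_eq]; simp

lemma contDiff_gs {N : ℕ} (x0 : EuclideanSpace ℝ (Fin N)) (τ : ℝ) : ContDiff ℝ ∞ (gs x0 τ) := by
  unfold gs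
  apply Real.contDiff_exp.comp
  apply ContDiff.div_const
  apply ContDiff.neg
  exact (contDiff_id.sub contDiff_const).norm_sq ℝ

lemma gs_pos {N : ℕ} (x0 : EuclideanSpace ℝ (Fin N)) (τ : ℝ) (x) : 0 < gs x0 τ x := Real.exp_pos _

lemma gs_le_one {N : ℕ} (x0 : EuclideanSpace ℝ (Fin N)) {τ : ℝ} (hτ : 0 < τ) (x) :
    gs x0 τ x ≤ 1 := by
  unfold gs
  rw [Real.exp_le_one_iff]
  apply div_nonpos_of_nonpos_of_nonneg
  · have := sq_nonneg ‖x - x0‖; linarith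
  · positivity

lemma pd_normsq {N : ℕ} (i : Fin N) (x0 x : EuclideanSpace ℝ (Fin N)) :
    pd i (fun x => ‖x - x0‖ ^ 2) x = 2 * (x - x0) i := by
  unfold pd
  have := (((hasFDerivAt_id x).sub_const x0).norm_sq).fderiv
  simp only [id] at this
  rw [this]
  simp [EuclideanSpace.inner_single_right]

lemma pd_gs {N : ℕ} (i : Fin N) (x0 : EuclideanSpace ℝ (Fin N)) (τ : ℝ) (x) :
    pd i (gs x0 τ) x = -((x - x0) i) / (2 * τ) * gs x0 τ x := by
  have h1 : DifferentiableAt ℝ (fun x : EuclideanSpace ℝ (Fin N) => ‖x - x0‖ ^ 2) x :=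
    ((contDiff_id.sub contDiff_const).norm_sq ℝ (n := 1)).differentiable (by norm_num) x
  have := pd_comp i (h := fun r => Real.exp (-r / (4 * τ)))
    (f := fun x => ‖x - x0‖ ^ 2) (x := x) (by fun_prop) h1
  have e : gs x0 τ = fun x => Real.exp (-(‖x - x0‖ ^ 2) / (4 * τ)) := rfl
  rw [e, this, pd_normsq]
  have hd : HasDerivAt (fun r => Real.exp (-r / (4 * τ)))
    (Real.exp (-(‖x - x0‖ ^ 2) / (4 * τ)) * (-1 / (4 * τ))) (‖x - x0‖ ^ 2) := by
    exact (((hasDerivAt_id' _).neg).div_const _).exp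
  rw [hd.deriv]
  simp only []
  generalize Real.exp _ = E
  by_cases h : τ = 0
  · simp [h]
  · field_simp; ring

/-- the radial derivative -/
def rad {N : ℕ} (x0 : EuclideanSpace ℝ (Fin N)) (τ : ℝ) (w : EuclideanSpace ℝ (Fin N) → ℝ)
    (x : EuclideanSpace ℝ (Fin N)) : ℝ := (∑ j, (x - x0) j * pd j w x) * (1 / (2 * τ))

/-- squared gradient -/
def gsq {N : ℕ} (w : EuclideanSpace ℝ (Fin N) → ℝ)
    (x : EuclideanSpace ℝ (Fin N)) : ℝ := ∑ j, pd j w x * pd j w x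

lemma contDiff_rad {N : ℕ} (x0 : EuclideanSpace ℝ (Fin N)) (τ : ℝ)
    {w : EuclideanSpace ℝ (Fin N) → ℝ} (hw : ContDiff ℝ ∞ w) : ContDiff ℝ ∞ (rad x0 τ w) := by
  unfold rad
  apply ContDiff.mul _ contDiff_const
  exact ContDiff.sum fun j _ => (contDiff_coord j x0).mul (contDiff_pd_top j hw)

lemma contDiff_gsq {N : ℕ} 
    {w : EuclideanSpace ℝ (Fin N) → ℝ} (hw : ContDiff ℝ ∞ w) : ContDiff ℝ ∞ (gsq w) := by
  unfold gsq
  exact ContDiff.sum fun j _ => (contDiff_pd_top j hw).mul (contDiff_pd_top j hw)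

lemma diffable {N : ℕ} {w : EuclideanSpace ℝ (Fin N) → ℝ} (hw : ContDiff ℝ ∞ w) (x) :
    DifferentiableAt ℝ w x := hw.differentiable (by simp) x

lemma ident_i {N : ℕ} (x0 : EuclideanSpace ℝ (Fin N)) {τ : ℝ} 
    {w z : EuclideanSpace ℝ (Fin N) → ℝ} (hw : ContDiff ℝ ∞ w) (hz : ContDiff ℝ ∞ z)
    (hc : HasCompactSupport w) :
    ∫ x, gs x0 τ x * (∑ i, pd i w x * pd i z x + (lap w x - rad x0 τ w x) * z x) = 0 := by
  have key := integral_div_eq_zero (f := fun i x => gs x0 τ x * (pd i w x * z x))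
    (fun i => ((contDiff_gs x0 τ).mul ((contDiff_pd_top i hw).mul hz)).of_le (by simp))
    (fun i => ((hasCompactSupport_pd i hc).mul_right (f' := z)).mul_left)
  rw [← key]
  congr 1
  ext x
  have e : ∀ i, pd i (fun x => gs x0 τ x * (pd i w x * z x)) x
      = gs x0 τ x * (-((x - x0) i * pd i w x) * (1 / (2 * τ)) * z x
        + pd i (pd i w) x * z x + pd i w x * pd i z x) := by
    intro i
    rw [pd_mul i (diffable (contDiff_gs x0 τ) x) ((diffable (contDiff_pd_top i hw) x).fun_mul (diffable hz x)),
      pd_mul i (diffable (contDiff_pd_top i hw) x) (diffable hz x), pd_gs]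
    ring
  rw [Finset.sum_congr rfl fun i _ => e i, ← Finset.mul_sum, Finset.sum_add_distrib,
    Finset.sum_add_distrib, ← Finset.sum_mul, ← Finset.sum_mul, ← Finset.sum_mul, lap_eq, rad,
    Finset.sum_neg_distrib]
  ring

lemma ident_iii {N : ℕ} (x0 : EuclideanSpace ℝ (Fin N)) {τ : ℝ} 
    {w : EuclideanSpace ℝ (Fin N) → ℝ} (hw : ContDiff ℝ ∞ w)
    (hc : HasCompactSupport w) :
    ∫ x, gs x0 τ x * (N * (1 / (2 * τ)) * (w x * w x) + 2 * (w x * rad x0 τ w x)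
      - ‖x - x0‖ ^ 2 * (1 / (2 * τ)) ^ 2 * (w x * w x)) = 0 := by
  have key := integral_div_eq_zero (f := fun i x => gs x0 τ x * ((x - x0) i * (w x * w x)))
    (fun i => ((contDiff_gs x0 τ).mul ((contDiff_coord i x0).mul (hw.mul hw))).of_le (by simp))
    (fun i => ((hc.mul_right (f' := w)).mul_left).mul_left)
  have key2 : ∫ x, (1 / (2 * τ)) * ∑ i, pd i (fun x => gs x0 τ x * ((x - x0) i * (w x * w x))) x = 0 := by
    rw [integral_const_mul, key, mul_zero]
  rw [← key2]
  congr 1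
  ext x
  have e : ∀ i, pd i (fun x => gs x0 τ x * ((x - x0) i * (w x * w x))) x
      = gs x0 τ x * (-((x - x0) i ^ 2) * (1 / (2 * τ)) * (w x * w x)
        + (w x * w x) + ((x - x0) i * pd i w x) * (2 * w x)) := by
    intro i
    rw [pd_mul i (diffable (contDiff_gs x0 τ) x) ((diffable (contDiff_coord i x0) x).fun_mul
        ((diffable hw x).fun_mul (diffable hw x))),
      pd_mul i (diffable (contDiff_coord i x0) x) ((diffable hw x).fun_mul (diffable hw x)),
      pd_mul i (diffable hw x) (diffable hw x), pd_gs, pd_coord]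
    simp only [if_true]
    ring
  rw [Finset.sum_congr rfl fun i _ => e i, ← Finset.mul_sum, Finset.sum_add_distrib,
    Finset.sum_add_distrib]
  simp only [← Finset.sum_mul]
  rw [rad, Finset.sum_neg_distrib, norm_sq_coord]
  simp only [Finset.sum_const, Finset.card_univ, Fintype.card_fin, nsmul_eq_mul]
  ring

lemma alg_iv {N : ℕ} (y a : Fin N → ℝ) (H : Fin N → Fin N → ℝ) (hH : ∀ i j, H i j = H j i) (c : ℝ) :
    ∑ i, ((-(y i) * c) * (y i * (∑ j, a j * a j) * c - 2 * (a i * ((∑ j, y j * a j) * c)))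
      + ((∑ j, a j * a j) * c + y i * (∑ j, 2 * (H i j * a j)) * c
        - 2 * (H i i * ((∑ j, y j * a j) * c) + a i * ((a i + ∑ j, y j * H i j) * c))))
    = - ((∑ i, y i ^ 2) * c ^ 2 * ∑ j, a j * a j) + 2 * ((∑ j, y j * a j) * c) ^ 2
      + (N - 2) * c * (∑ j, a j * a j) - 2 * (∑ i, H i i) * ((∑ j, y j * a j) * c) := by
  set P := ∑ j, a j * a j with hP
  set Y := ∑ j, y j * a j with hY
  have sw : ∑ i, y i * ∑ j, 2 * (H i j * a j) = 2 * ∑ i, a i * ∑ j, y j * H i j := by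
    simp only [Finset.mul_sum]
    rw [Finset.sum_comm]
    refine Finset.sum_congr rfl fun i _ => Finset.sum_congr rfl fun j _ => ?_
    rw [hH]; ring
  have e : ∀ i, ((-(y i) * c) * (y i * P * c - 2 * (a i * (Y * c)))
      + (P * c + y i * (∑ j, 2 * (H i j * a j)) * c
        - 2 * (H i i * (Y * c) + a i * ((a i + ∑ j, y j * H i j) * c))))
      = (y i ^ 2) * (-c ^ 2 * P) + (y i * a i) * (2 * c ^ 2 * Y) + P * c
        + (y i * ∑ j, 2 * (H i j * a j)) * c - (H i i) * (2 * Y * c) - (a i * a i) * (2 * c)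
        - (a i * ∑ j, y j * H i j) * (2 * c) := by
    intro i; ring
  rw [Finset.sum_congr rfl fun i _ => e i]
  simp only [Finset.sum_add_distrib, Finset.sum_sub_distrib, ← Finset.sum_mul]
  rw [sw, ← hP, ← hY]
  simp only [Finset.sum_const, Finset.card_univ, Fintype.card_fin, nsmul_eq_mul]
  ring

lemma ident_iv {N : ℕ} (x0 : EuclideanSpace ℝ (Fin N)) {τ : ℝ} 
    {w : EuclideanSpace ℝ (Fin N) → ℝ} (hw : ContDiff ℝ ∞ w)
    (hc : HasCompactSupport w) :
    ∫ x, gs x0 τ x * (- (‖x - x0‖ ^ 2 * (1 / (2 * τ)) ^ 2 * gsq w x) 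
      - 2 * ((lap w x - rad x0 τ w x) * rad x0 τ w x)
      + (N - 2) * (1 / (2 * τ)) * gsq w x) = 0 := by
  have hP := contDiff_gsq hw
  have hY := contDiff_rad x0 τ hw
  have hpd := fun i => contDiff_pd_top i hw
  have hgc : HasCompactSupport (gsq w) := by
    refine hc.of_isClosed_subset (isClosed_tsupport _) (closure_minimal ?_ (isClosed_tsupport w))
    intro x hx
    by_contra h
    exact hx (Finset.sum_eq_zero fun i _ => by rw [pd_zero_of_notMem i h, zero_mul])
  have c1 : ∀ i, ContDiff ℝ ∞ (fun x => (x - x0) i * gsq w x * (1 / (2 * τ))) := fun i =>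
    ((contDiff_coord i x0).mul hP).mul contDiff_const
  have c2 : ∀ i, ContDiff ℝ ∞ (fun x => 2 * (pd i w x * rad x0 τ w x)) := fun i =>
    contDiff_const.mul ((hpd i).mul hY)
  have key := integral_div_eq_zero (f := fun i x => gs x0 τ x *
      ((x - x0) i * gsq w x * (1 / (2 * τ)) - 2 * (pd i w x * rad x0 τ w x)))
    (fun i => ((contDiff_gs x0 τ).mul ((c1 i).sub (c2 i))).of_le (by simp))
    (fun i => (((hgc.mul_left (f := fun x => (x - x0) i)).mul_right
      (f' := fun _ => (1 / (2 * τ)))).sub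
      (((hasCompactSupport_pd i hc).mul_right (f' := rad x0 τ w)).mul_left (f := fun _ => (2:ℝ)))).mul_left)
  rw [← key]
  congr 1
  ext x
  have eP : ∀ i, pd i (gsq w) x = ∑ j, 2 * (pd i (pd j w) x * pd j w x) := by
    intro i
    have : gsq w = fun x => ∑ j, pd j w x * pd j w x := rfl
    rw [this, pd_sum i (fun j => (diffable (hpd j) x).fun_mul (diffable (hpd j) x))]
    refine Finset.sum_congr rfl fun j _ => ?_
    rw [pd_mul i (diffable (hpd j) x) (diffable (hpd j) x)]; ring
  have eY : ∀ i, pd i (rad x0 τ w) x = (pd i w x + ∑ j, (x - x0) j * pd i (pd j w) x) * (1 / (2 * τ)) := by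
    intro i
    have : rad x0 τ w = fun x => (∑ j, (x - x0) j * pd j w x) * (1 / (2 * τ)) := rfl
    have hd : ∀ j, DifferentiableAt ℝ (fun x => (x - x0) j * pd j w x) x := fun j =>
      (diffable (contDiff_coord j x0) x).fun_mul (diffable (hpd j) x)
    rw [this, pd_mul i (by exact DifferentiableAt.fun_sum fun j _ => hd j) (differentiableAt_const _),
      pd_const, mul_zero, add_zero, pd_sum i hd]
    congr 1
    have : ∀ j, pd i (fun x => (x - x0) j * pd j w x) x
       = (if i = j then pd j w x else 0) + (x - x0) j * pd i (pd j w) x := by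
      intro j
      rw [pd_mul i (diffable (contDiff_coord j x0) x) (diffable (hpd j) x), pd_coord]
      split_ifs <;> simp
    rw [Finset.sum_congr rfl fun j _ => this j, Finset.sum_add_distrib]
    simp
  have e : ∀ i, pd i (fun x => gs x0 τ x *
      ((x - x0) i * gsq w x * (1 / (2 * τ)) - 2 * (pd i w x * rad x0 τ w x))) x
      = gs x0 τ x * ((-((x - x0) i) * (1 / (2 * τ))) * ((x - x0) i * gsq w x * (1 / (2 * τ)) - 2 * (pd i w x * rad x0 τ w x))
      + (gsq w x * (1 / (2 * τ)) + (x - x0) i * (∑ j, 2 * (pd i (pd j w) x * pd j w x)) * (1 / (2 * τ))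
        - 2 * (pd i (pd i w) x * rad x0 τ w x + pd i w x * ((pd i w x + ∑ j, (x - x0) j * pd i (pd j w) x) * (1 / (2 * τ)))))) := by
    intro i
    rw [pd_mul i (diffable (contDiff_gs x0 τ) x) (diffable ((c1 i).sub (c2 i)) x),
      pd_sub i (diffable (c1 i) x) (diffable (c2 i) x),
      pd_mul i (diffable ((contDiff_coord i x0).mul hP) x) (differentiableAt_const _),
      pd_mul i (diffable (contDiff_coord i x0) x) (diffable hP x),
      pd_const_mul i 2 (diffable ((hpd i).mul hY) x),
      pd_mul i (diffable (hpd i) x) (diffable hY x), pd_gs, pd_coord, pd_const, eP, eY]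
    simp only [if_true]
    ring
  rw [Finset.sum_congr rfl fun i _ => e i, ← Finset.mul_sum]
  have al := alg_iv (fun i => (x - x0) i) (fun i => pd i w x) (fun i j => pd i (pd j w) x)
    (fun i j => pd_symm i j (hw.of_le two_le_top) x) (1 / (2 * τ))
  simp only [gsq, rad, norm_sq_coord, lap_eq]
  rw [al]
  ring
end Aux2

section Aux3
open scoped ContDiff

lemma contInt {N : ℕ} {I : Set ℝ} {S : Set (EuclideanSpace ℝ (Fin N))} (hS : MeasurableSet S)
    (hSf : volume S < ⊤) {F : ℝ → EuclideanSpace ℝ (Fin N) → ℝ} {C : ℝ}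
    (hm : ∀ t ∈ I, AEStronglyMeasurable (F t) volume)
    (h0 : ∀ t ∈ I, ∀ x, x ∉ S → F t x = 0) (hb : ∀ t ∈ I, ∀ x ∈ S, |F t x| ≤ C)
    (hc : ∀ x ∈ S, ContinuousOn (fun t => F t x) I) : ContinuousOn (fun t => ∫ x, F t x) I := by
  refine continuousOn_of_dominated (bound := S.indicator (fun _ => C)) hm ?_ ?_ ?_
  · intro t ht
    refine Eventually.of_forall fun x => ?_
    by_cases hx : x ∈ S
    · simpa [hx] using hb t ht x hx
    · simp [hx, h0 t ht x hx]
  · rw [integrable_indicator_iff hS]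
    exact integrableOn_const (hs := hSf.ne)
  · refine Eventually.of_forall fun x => ?_
    by_cases hx : x ∈ S
    · exact hc x hx
    · exact continuousOn_const.congr (fun t ht => h0 t ht x hx)

lemma integrable_bdd {N : ℕ} {S : Set (EuclideanSpace ℝ (Fin N))} (hS : MeasurableSet S)
    (hSf : volume S < ⊤) {F : EuclideanSpace ℝ (Fin N) → ℝ} {C : ℝ}
    (hm : AEStronglyMeasurable F volume)
    (h0 : ∀ x, x ∉ S → F x = 0) (hb : ∀ x ∈ S, |F x| ≤ C) : Integrable F := by
  refine Integrable.mono' (g := S.indicator (fun _ => C)) ?_ hm ?_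
  · rw [integrable_indicator_iff hS]
    exact integrableOn_const (hs := hSf.ne)
  · refine Eventually.of_forall fun x => ?_
    by_cases hx : x ∈ S
    · simpa [hx] using hb x hx
    · simp [hx, h0 x hx]

lemma derInt {N : ℕ} {I : Set ℝ} (hI : IsOpen I) {S : Set (EuclideanSpace ℝ (Fin N))}
    (hS : MeasurableSet S)
    (hSf : volume S < ⊤) {F F' : ℝ → EuclideanSpace ℝ (Fin N) → ℝ} {C C' : ℝ}
    (hm : ∀ t ∈ I, AEStronglyMeasurable (F t) volume)
    (hm' : ∀ t ∈ I, AEStronglyMeasurable (F' t) volume)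
    (h0 : ∀ t ∈ I, ∀ x, x ∉ S → F t x = 0) (h0' : ∀ t ∈ I, ∀ x, x ∉ S → F' t x = 0)
    (hb : ∀ t ∈ I, ∀ x ∈ S, |F t x| ≤ C) (hb' : ∀ t ∈ I, ∀ x ∈ S, |F' t x| ≤ C')
    (hd : ∀ x ∈ S, ∀ t ∈ I, HasDerivAt (fun t => F t x) (F' t x) t) {t : ℝ} (ht : t ∈ I) :
    HasDerivAt (fun t => ∫ x, F t x) (∫ x, F' t x) t := by
  refine (hasDerivAt_integral_of_dominated_loc_of_deriv_le (s := I)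
    (bound := S.indicator (fun _ => C')) (hI.mem_nhds ht) ?_ ?_ (hm' t ht) ?_ ?_ ?_).2
  · filter_upwards [hI.mem_nhds ht] with s hs using hm s hs
  · exact integrable_bdd hS hSf (hm t ht) (h0 t ht) (hb t ht)
  · refine Eventually.of_forall fun x s hs => ?_
    by_cases hx : x ∈ S
    · simpa [hx] using hb' s hs x hx
    · simp [hx, h0' s hs x hx]
  · rw [integrable_indicator_iff hS]
    exact integrableOn_const (hs := hSf.ne)
  · refine Eventually.of_forall fun x s hs => ?_
    by_cases hx : x ∈ S
    · exact hd x hx s hs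
    · rw [h0' s hs x hx]
      refine (hasDerivAt_const s (0:ℝ)).congr_of_eventuallyEq ?_
      filter_upwards [hI.mem_nhds hs] with r hr using h0 r hr x hx

/-- regularity package for a mollified function -/
structure SlReg {N : ℕ} (I : Set ℝ) (S : Set (EuclideanSpace ℝ (Fin N)))
    (w wt : ℝ → EuclideanSpace ℝ (Fin N) → ℝ) (C : ℝ) : Prop where
  smooth : ∀ t ∈ I, ContDiff ℝ ∞ (w t)
  smooth' : ∀ t ∈ I, ContDiff ℝ ∞ (wt t)
  supp : ∀ t ∈ I, tsupport (w t) ⊆ S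
  supp' : ∀ t ∈ I, tsupport (wt t) ⊆ S
  der : ∀ x, ∀ t ∈ I, HasDerivAt (fun t => w t x) (wt t x) t
  derpd : ∀ i x, ∀ t ∈ I, HasDerivAt (fun t => pd i (w t) x) (pd i (wt t) x) t
  b0 : ∀ t ∈ I, ∀ x, |w t x| ≤ C
  b1 : ∀ i, ∀ t ∈ I, ∀ x, |pd i (w t) x| ≤ C
  b2 : ∀ t ∈ I, ∀ x, |lap (w t) x| ≤ C
  b3 : ∀ t ∈ I, ∀ x, |wt t x| ≤ C
  b4 : ∀ i, ∀ t ∈ I, ∀ x, |pd i (wt t) x| ≤ C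
  c1 : ∀ x, ContinuousOn (fun t => wt t x) I
  c2 : ∀ x, ContinuousOn (fun t => lap (w t) x) I

lemma contDiff_cont {N : ℕ} {w : EuclideanSpace ℝ (Fin N) → ℝ} (hw : ContDiff ℝ ∞ w) :
    Continuous w := hw.continuous

lemma int_supp {N : ℕ} {S : Set (EuclideanSpace ℝ (Fin N))} (hS : IsCompact S)
    {f : EuclideanSpace ℝ (Fin N) → ℝ} (hf : Continuous f) (h0 : ∀ x, x ∉ S → f x = 0) :
    Integrable f :=
  hf.integrable_of_hasCompactSupport (HasCompactSupport.intro hS (fun x hx => h0 x hx))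

lemma carl_alg {N : ℕ} (x0 : EuclideanSpace ℝ (Fin N)) {τ : ℝ} (hτ : 0 < τ)
    {S : Set (EuclideanSpace ℝ (Fin N))} (hS : IsCompact S)
    {w z : EuclideanSpace ℝ (Fin N) → ℝ} (hw : ContDiff ℝ ∞ w) (hz : ContDiff ℝ ∞ z)
    (hcw : tsupport w ⊆ S) (hcz : tsupport z ⊆ S) (m' m'' : ℝ) :
    -(2 * m' * ((∫ x, gs x0 τ x * gsq w x) + (m' + (N / 2 - 1) * (1 / (2 * τ))) * ∫ x, gs x0 τ x * (w x * w x)))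
    - ((∫ x, gs x0 τ x * (‖x - x0‖ ^ 2 * (1 / (2 * τ)) ^ 2 * gsq w x + 2 * ∑ i, pd i w x * pd i z x))
      + (m'' - (N / 2 - 1) * (2 * (1 / (2 * τ)) ^ 2)) * (∫ x, gs x0 τ x * (w x * w x))
      + (m' + (N / 2 - 1) * (1 / (2 * τ))) * 
        ∫ x, gs x0 τ x * (‖x - x0‖ ^ 2 * (1 / (2 * τ)) ^ 2 * (w x * w x) + 2 * (w x * z x)))
    ≤ (∫ x, gs x0 τ x * (z x + lap w x) ^ 2) - (m'' + m' / τ) * ∫ x, gs x0 τ x * (w x * w x) := by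
  have kw : HasCompactSupport w := hS.of_isClosed_subset (isClosed_tsupport _) hcw
  have i1 := ident_i x0 (τ := τ) hw hz kw
  have i2 := ident_i x0 (τ := τ) hw hw kw
  have i3 := ident_iii x0 (τ := τ) hw kw
  have i4 := ident_iv x0 (τ := τ) hw kw
  have w0 : ∀ x, x ∉ S → w x = 0 := fun x hx => image_eq_zero_of_notMem_tsupport fun h => hx (hcw h)
  have z0 : ∀ x, x ∉ S → z x = 0 := fun x hx => image_eq_zero_of_notMem_tsupport fun h => hx (hcz h)
  have p0 : ∀ x, x ∉ S → ∀ i, pd i w x = 0 := fun x hx i => pd_zero_of_notMem i fun h => hx (hcw h)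
  have l0 : ∀ x, x ∉ S → lap w x = 0 := fun x hx => lap_zero_of_notMem fun h => hx (hcw h)
  have q0 : ∀ x, x ∉ S → gsq w x = 0 := fun x hx => by simp [gsq, p0 x hx]
  have r0 : ∀ x, x ∉ S → rad x0 τ w x = 0 := fun x hx => by simp [rad, p0 x hx]
  have cg := (contDiff_gs x0 τ).continuous
  have cw := hw.continuous
  have cz := hz.continuous
  have cl := (contDiff_lap_top hw).continuous
  have cq := (contDiff_gsq hw).continuous
  have cr := (contDiff_rad x0 τ hw).continuous
  have cp := fun i => (contDiff_pd_top i hw).continuous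
  have cpz := fun i => (contDiff_pd_top i hz).continuous
  have cn : Continuous fun x : EuclideanSpace ℝ (Fin N) => ‖x - x0‖ ^ 2 := by fun_prop
  have J1 : Integrable fun x => gs x0 τ x * ((lap w x - rad x0 τ w x) * z x) :=
    int_supp hS (by fun_prop) (fun x hx => by simp [z0 x hx])
  have J2 : Integrable fun x => gs x0 τ x * ((lap w x - rad x0 τ w x) * rad x0 τ w x) :=
    int_supp hS (by fun_prop) (fun x hx => by simp [r0 x hx])
  have J3 : Integrable fun x => gs x0 τ x * ((lap w x - rad x0 τ w x) * w x) :=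
    int_supp hS (by fun_prop) (fun x hx => by simp [w0 x hx])
  have J4 : Integrable fun x => gs x0 τ x * (w x * z x) :=
    int_supp hS (by fun_prop) (fun x hx => by simp [w0 x hx])
  have J5 : Integrable fun x => gs x0 τ x * (w x * rad x0 τ w x) :=
    int_supp hS (by fun_prop) (fun x hx => by simp [w0 x hx])
  have J6 : Integrable fun x => gs x0 τ x * (w x * w x) :=
    int_supp hS (by fun_prop) (fun x hx => by simp [w0 x hx])
  have J7 : Integrable fun x => gs x0 τ x * (‖x - x0‖ ^ 2 * (1 / (2 * τ)) ^ 2 * (w x * w x)) :=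
    int_supp hS (by fun_prop) (fun x hx => by simp [w0 x hx])
  have J8 : Integrable fun x => gs x0 τ x * (‖x - x0‖ ^ 2 * (1 / (2 * τ)) ^ 2 * gsq w x) :=
    int_supp hS (by fun_prop) (fun x hx => by simp [q0 x hx])
  have J9 : Integrable fun x => gs x0 τ x * (∑ i, pd i w x * pd i z x) :=
    int_supp hS (by fun_prop) (fun x hx => by simp [p0 x hx])
  have J10 : Integrable fun x => gs x0 τ x * gsq w x :=
    int_supp hS (by fun_prop) (fun x hx => by simp [q0 x hx])
  have J11 : Integrable fun x => gs x0 τ x * (z x + lap w x) ^ 2 :=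
    int_supp hS (by fun_prop) (fun x hx => by simp [z0 x hx, l0 x hx])
  set c := 1 / (2 * τ) with hc
  have e1 : (∫ x, gs x0 τ x * (∑ i, pd i w x * pd i z x))
      + ∫ x, gs x0 τ x * ((lap w x - rad x0 τ w x) * z x) = 0 := by
    rw [← integral_add J9 J1, ← i1]; congr 1; ext x; ring
  have e2 : (∫ x, gs x0 τ x * gsq w x)
      + ∫ x, gs x0 τ x * ((lap w x - rad x0 τ w x) * w x) = 0 := by
    rw [← integral_add J10 J3, ← i2]; congr 1; ext x; rw [gsq]; ring
  have e3 : N * c * (∫ x, gs x0 τ x * (w x * w x)) + 2 * (∫ x, gs x0 τ x * (w x * rad x0 τ w x))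
      - (∫ x, gs x0 τ x * (‖x - x0‖ ^ 2 * c ^ 2 * (w x * w x))) = 0 := by
    rw [← integral_const_mul, ← integral_const_mul, ← integral_add (J6.const_mul _) (J5.const_mul _),
      ← integral_sub ((J6.const_mul _).fun_add (J5.const_mul _)) J7, ← i3]; congr 1; ext x; ring
  have J8n : Integrable fun x => -(gs x0 τ x * (‖x - x0‖ ^ 2 * c ^ 2 * gsq w x)) := J8.fun_neg
  have J8m : Integrable fun x => -(gs x0 τ x * (‖x - x0‖ ^ 2 * c ^ 2 * gsq w x))
      - 2 * (gs x0 τ x * ((lap w x - rad x0 τ w x) * rad x0 τ w x)) := J8n.sub (J2.const_mul 2)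
  have e4 : - (∫ x, gs x0 τ x * (‖x - x0‖ ^ 2 * c ^ 2 * gsq w x))
      - 2 * (∫ x, gs x0 τ x * ((lap w x - rad x0 τ w x) * rad x0 τ w x))
      + (N - 2) * c * (∫ x, gs x0 τ x * gsq w x) = 0 := by
    rw [← integral_const_mul, ← integral_const_mul, ← integral_neg, ← integral_sub J8n (J2.const_mul _),
      ← integral_add J8m (J10.const_mul _), ← i4]; congr 1; ext x; ring
  have e5 : ∫ x, gs x0 τ x * (‖x - x0‖ ^ 2 * c ^ 2 * gsq w x + 2 * ∑ i, pd i w x * pd i z x)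
      = (∫ x, gs x0 τ x * (‖x - x0‖ ^ 2 * c ^ 2 * gsq w x))
        + 2 * ∫ x, gs x0 τ x * (∑ i, pd i w x * pd i z x) := by
    rw [← integral_const_mul, ← integral_add J8 (J9.const_mul _)]; congr 1; ext x; ring
  have e6 : ∫ x, gs x0 τ x * (‖x - x0‖ ^ 2 * c ^ 2 * (w x * w x) + 2 * (w x * z x))
      = (∫ x, gs x0 τ x * (‖x - x0‖ ^ 2 * c ^ 2 * (w x * w x)))
        + 2 * ∫ x, gs x0 τ x * (w x * z x) := by
    rw [← integral_const_mul, ← integral_add J7 (J4.const_mul _)]; congr 1; ext x; ring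
  set κ := m' + (N / 2 - 1) * c with hκ
  have e7 : 0 ≤ (∫ x, gs x0 τ x * (z x + lap w x) ^ 2) - (2 * (∫ x, gs x0 τ x * ((lap w x - rad x0 τ w x) * z x))
      + 2 * (∫ x, gs x0 τ x * ((lap w x - rad x0 τ w x) * rad x0 τ w x))
      + (2 * κ) * (∫ x, gs x0 τ x * ((lap w x - rad x0 τ w x) * w x))
      + (-2 * κ) * (∫ x, gs x0 τ x * (w x * z x)) + (-2 * κ) * (∫ x, gs x0 τ x * (w x * rad x0 τ w x))
      + (-2 * κ ^ 2) * (∫ x, gs x0 τ x * (w x * w x))) := by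
    have K1 := J1.const_mul (2:ℝ)
    have K2 := J2.const_mul (2:ℝ)
    have K3 := J3.const_mul (2 * κ)
    have K4 := J4.const_mul (-2 * κ)
    have K5 := J5.const_mul (-2 * κ)
    have K6 := J6.const_mul (-2 * κ ^ 2)
    simp only [← integral_const_mul]
    rw [← integral_add K1 K2, ← integral_add (K1.fun_add K2) K3, ← integral_add ((K1.fun_add K2).fun_add K3) K4,
      ← integral_add (((K1.fun_add K2).fun_add K3).fun_add K4) K5,
      ← integral_add ((((K1.fun_add K2).fun_add K3).fun_add K4).fun_add K5) K6,
      ← integral_sub J11 (((((K1.fun_add K2).fun_add K3).fun_add K4).fun_add K5).fun_add K6)]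
    apply integral_nonneg
    intro x
    have hg := (gs_pos x0 τ x).le
    have : (0:ℝ) ≤ gs x0 τ x * (((z x + rad x0 τ w x + κ * w x) - (lap w x - rad x0 τ w x - κ * w x)) ^ 2
        + 2 * ((z x + rad x0 τ w x + κ * w x) * (lap w x - rad x0 τ w x - κ * w x)) 
        - 2 * ((z x + rad x0 τ w x + κ * w x) * (lap w x - rad x0 τ w x - κ * w x))
        + 2 * ((z x + rad x0 τ w x + κ * w x) * (lap w x - rad x0 τ w x - κ * w x))
        + - 2 * ((z x + rad x0 τ w x + κ * w x) * (lap w x - rad x0 τ w x - κ * w x))) := by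
      apply mul_nonneg hg
      nlinarith [sq_nonneg ((z x + rad x0 τ w x + κ * w x) - (lap w x - rad x0 τ w x - κ * w x))]
    have h2 : (0:ℝ) ≤ gs x0 τ x * ((z x + rad x0 τ w x + κ * w x) ^ 2 + (lap w x - rad x0 τ w x - κ * w x) ^ 2) := by
      positivity
    simp only [Pi.zero_apply]
    nlinarith [h2]
  rw [e5, e6]
  have hmτ : m' / τ = 2 * c * m' := by rw [hc]; field_simp
  rw [hmτ]
  generalize (∫ x, gs x0 τ x * (z x + lap w x) ^ 2) = Z at *
  generalize (∫ x, gs x0 τ x * ((lap w x - rad x0 τ w x) * z x)) = A1 at *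
  generalize (∫ x, gs x0 τ x * ((lap w x - rad x0 τ w x) * rad x0 τ w x)) = A2 at *
  generalize (∫ x, gs x0 τ x * ((lap w x - rad x0 τ w x) * w x)) = A3 at *
  generalize (∫ x, gs x0 τ x * (w x * z x)) = A4 at *
  generalize (∫ x, gs x0 τ x * (w x * rad x0 τ w x)) = A5 at *
  generalize (∫ x, gs x0 τ x * (w x * w x)) = A6 at *
  generalize (∫ x, gs x0 τ x * (‖x - x0‖ ^ 2 * c ^ 2 * (w x * w x))) = B1 at *
  generalize (∫ x, gs x0 τ x * (‖x - x0‖ ^ 2 * c ^ 2 * gsq w x)) = B2 at *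
  generalize (∫ x, gs x0 τ x * (∑ i, pd i w x * pd i z x)) = B3 at *
  generalize (∫ x, gs x0 τ x * gsq w x) = D at *
  have hB1 : B1 = N * c * A6 + 2 * A5 := by linarith
  have hB2 : B2 = - 2 * A2 + (N - 2) * c * D := by linarith
  have hB3 : B3 = - A1 := by linarith
  have hD : A3 = - D := by linarith
  subst hB1 hB2 hB3 hD
  rw [hκ] at *
  ring_nf at e7 ⊢
  linarith
end Aux3

section Aux4
open scoped ContDiff

lemma hasDerivAt_gs {N : ℕ} (x0 x : EuclideanSpace ℝ (Fin N)) {τ : ℝ} (hτ : 0 < τ) :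
    HasDerivAt (fun τ => gs x0 τ x) (gs x0 τ x * (‖x - x0‖ ^ 2 * (1 / (2 * τ)) ^ 2)) τ := by
  unfold gs
  have h : HasDerivAt (fun τ : ℝ => -(‖x - x0‖ ^ 2) / (4 * τ)) (‖x - x0‖ ^ 2 * (1 / (2 * τ)) ^ 2) τ := by
    have := (hasDerivAt_const τ (-(‖x - x0‖ ^ 2))).div ((hasDerivAt_id' τ).const_mul 4) (by positivity)
    refine this.congr_deriv ?_
    field_simp; ring
  exact h.exp

lemma sum_bd {N : ℕ} (f : Fin N → ℝ) {C : ℝ} (h : ∀ i, |f i| ≤ C) : |∑ i, f i| ≤ N * C := by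
  refine (Finset.abs_sum_le_sum_abs _ _).trans ?_
  refine (Finset.sum_le_sum fun i _ => h i).trans ?_
  simp

lemma mul_bd {a b A B : ℝ} (ha : |a| ≤ A) (hb : |b| ≤ B) : |a * b| ≤ A * B := by
  rw [abs_mul]
  exact mul_le_mul ha hb (abs_nonneg _) ((abs_nonneg _).trans ha)

lemma add_bd {a b A B : ℝ} (ha : |a| ≤ A) (hb : |b| ≤ B) : |a + b| ≤ A + B :=
  (abs_add_le a b).trans (add_le_add ha hb)

lemma carleman {N : ℕ} (x0 : EuclideanSpace ℝ (Fin N)) {a b τ1 τ2 : ℝ} (ha : 0 < a) (h1 : a < τ1)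
    (h12 : τ1 ≤ τ2) (h2 : τ2 < b) {S : Set (EuclideanSpace ℝ (Fin N))} (hS : IsCompact S)
    {w wt : ℝ → EuclideanSpace ℝ (Fin N) → ℝ} {C : ℝ} (hw : SlReg (Ioo a b) S w wt C)
    (hw1 : ∀ x, w τ1 x = 0) (hw2 : ∀ x, w τ2 x = 0) {m m' m'' : ℝ → ℝ}
    (hm : ∀ τ ∈ Ioo a b, HasDerivAt m (m' τ) τ) (hm' : ∀ τ ∈ Ioo a b, HasDerivAt m' (m'' τ) τ)
    (hm'' : ContinuousOn m'' (Ioo a b)) :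
    ∫ τ in τ1..τ2, Real.exp (2 * m τ) * ((m'' τ + m' τ / τ) * ∫ x, gs x0 τ x * (w τ x * w τ x))
    ≤ ∫ τ in τ1..τ2, Real.exp (2 * m τ) * ∫ x, gs x0 τ x * (wt τ x + lap (w τ) x) ^ 2 := by
  have hI : IsOpen (Ioo a b) := isOpen_Ioo
  obtain ⟨R1, hR1⟩ : ∃ R1, ∀ x ∈ S, ‖x - x0‖ ^ 2 ≤ R1 :=
    hS.exists_bound_of_continuousOn (f := fun x => ‖x - x0‖ ^ 2) (by fun_prop) |>.imp
      fun R hR x hx => (le_abs_self _).trans (hR x hx)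
  have w0 : ∀ t ∈ Ioo a b, ∀ x, x ∉ S → w t x = 0 := fun t ht x hx =>
    image_eq_zero_of_notMem_tsupport fun h => hx (hw.supp t ht h)
  have z0 : ∀ t ∈ Ioo a b, ∀ x, x ∉ S → wt t x = 0 := fun t ht x hx =>
    image_eq_zero_of_notMem_tsupport fun h => hx (hw.supp' t ht h)
  have p0 : ∀ t ∈ Ioo a b, ∀ x, x ∉ S → ∀ i, pd i (w t) x = 0 := fun t ht x hx i =>
    pd_zero_of_notMem i fun h => hx (hw.supp t ht h)
  have l0 : ∀ t ∈ Ioo a b, ∀ x, x ∉ S → lap (w t) x = 0 := fun t ht x hx =>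
    lap_zero_of_notMem fun h => hx (hw.supp t ht h)
  have q0 : ∀ t ∈ Ioo a b, ∀ x, x ∉ S → gsq (w t) x = 0 := fun t ht x hx => by
    simp [gsq, p0 t ht x hx]
  have cg := fun t => (contDiff_gs x0 t).continuous
  have cw := fun t ht => (hw.smooth t ht).continuous
  have cz := fun t ht => (hw.smooth' t ht).continuous
  have cl := fun t ht => (contDiff_lap_top (hw.smooth t ht)).continuous
  have cq := fun t ht => (contDiff_gsq (hw.smooth t ht)).continuous
  have cp := fun i t ht => (contDiff_pd_top i (hw.smooth t ht)).continuous
  have cpz := fun i t ht => (contDiff_pd_top i (hw.smooth' t ht)).continuous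
  have bg : ∀ t ∈ Ioo a b, ∀ x, |gs x0 t x| ≤ 1 := fun t ht x => by
    rw [abs_of_pos (gs_pos x0 t x)]; exact gs_le_one x0 (ha.trans ht.1) x
  have bR : ∀ t ∈ Ioo a b, ∀ x ∈ S, |‖x - x0‖ ^ 2 * (1 / (2 * t)) ^ 2| ≤ R1 * (1 / (2 * a)) ^ 2 := by
    intro t ht x hx
    have : 0 < t := ha.trans ht.1
    rw [abs_of_nonneg (by positivity)]
    have h3 : (1 / (2 * t)) ^ 2 ≤ (1 / (2 * a)) ^ 2 := by
      have := ht.1.le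
      gcongr
    exact mul_le_mul (hR1 x hx) h3 (by positivity) ((sq_nonneg _).trans (hR1 x hx))
  have b2 : |(2:ℝ)| ≤ 2 := by norm_num
  have bq : ∀ t ∈ Ioo a b, ∀ x, |gsq (w t) x| ≤ N * (C * C) := fun t ht x =>
    sum_bd _ fun i => mul_bd (hw.b1 i t ht x) (hw.b1 i t ht x)
  have bqq : ∀ t ∈ Ioo a b, ∀ x, |∑ i, pd i (w t) x * pd i (wt t) x| ≤ N * (C * C) := fun t ht x =>
    sum_bd _ fun i => mul_bd (hw.b1 i t ht x) (hw.b4 i t ht x)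
  have dE : ∀ t ∈ Ioo a b, HasDerivAt (fun t => ∫ x, gs x0 t x * (w t x * w t x))
      (∫ x, gs x0 t x * (‖x - x0‖ ^ 2 * (1 / (2 * t)) ^ 2 * (w t x * w t x) + 2 * (w t x * wt t x))) t := by
    intro t ht
    refine derInt hI hS.measurableSet hS.measure_lt_top (F := fun t x => gs x0 t x * (w t x * w t x))
      (F' := fun t x => gs x0 t x * (‖x - x0‖ ^ 2 * (1 / (2 * t)) ^ 2 * (w t x * w t x) + 2 * (w t x * wt t x)))
      (fun t ht => Continuous.aestronglyMeasurable ?_) (fun t ht => Continuous.aestronglyMeasurable ?_)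
      ?_ ?_ (fun t ht x hx => mul_bd (bg t ht x) (mul_bd (hw.b0 t ht x) (hw.b0 t ht x))) 
      (fun t ht x hx => mul_bd (bg t ht x) (add_bd (mul_bd (bR t ht x hx) (mul_bd (hw.b0 t ht x) (hw.b0 t ht x)))
        (mul_bd b2 (mul_bd (hw.b0 t ht x) (hw.b3 t ht x))))) ?_ ht
    · have := cw t ht; have := cg t; fun_prop
    · have := cw t ht; have := cz t ht; have := cg t; fun_prop
    · intro t ht x hx; simp [w0 t ht x hx]
    · intro t ht x hx; simp [w0 t ht x hx]
    · intro x hx t ht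
      have := (hasDerivAt_gs x0 x (ha.trans ht.1)).mul ((hw.der x t ht).mul (hw.der x t ht))
      refine this.congr_deriv ?_
      simp only [Pi.mul_apply]
      ring
  have dD : ∀ t ∈ Ioo a b, HasDerivAt (fun t => ∫ x, gs x0 t x * gsq (w t) x)
      (∫ x, gs x0 t x * (‖x - x0‖ ^ 2 * (1 / (2 * t)) ^ 2 * gsq (w t) x + 2 * ∑ i, pd i (w t) x * pd i (wt t) x)) t := by
    intro t ht
    refine derInt hI hS.measurableSet hS.measure_lt_top (F := fun t x => gs x0 t x * gsq (w t) x)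
      (F' := fun t x => gs x0 t x * (‖x - x0‖ ^ 2 * (1 / (2 * t)) ^ 2 * gsq (w t) x + 2 * ∑ i, pd i (w t) x * pd i (wt t) x))
      (fun t ht => Continuous.aestronglyMeasurable ?_) (fun t ht => Continuous.aestronglyMeasurable ?_)
      ?_ ?_ (fun t ht x hx => mul_bd (bg t ht x) (bq t ht x)) 
      (fun t ht x hx => mul_bd (bg t ht x) (add_bd (mul_bd (bR t ht x hx) (bq t ht x))
        (mul_bd b2 (bqq t ht x)))) ?_ ht
    · have := cq t ht; have := cg t; fun_prop
    · have := cq t ht; have := cg t; have := fun i => cp i t ht; have := fun i => cpz i t ht; fun_prop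
    · intro t ht x hx; simp [q0 t ht x hx]
    · intro t ht x hx; simp [q0 t ht x hx, p0 t ht x hx]
    · intro x hx t ht
      have hs : HasDerivAt (fun t => gsq (w t) x) (∑ i, (pd i (wt t) x * pd i (w t) x + pd i (w t) x * pd i (wt t) x)) t := by
        unfold gsq
        exact HasDerivAt.fun_sum fun i _ => (hw.derpd i x t ht).mul (hw.derpd i x t ht)
      refine ((hasDerivAt_gs x0 x (ha.trans ht.1)).mul hs).congr_deriv ?_
      have : ∑ i, (pd i (wt t) x * pd i (w t) x + pd i (w t) x * pd i (wt t) x)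
        = 2 * ∑ i, pd i (w t) x * pd i (wt t) x := by
        rw [Finset.mul_sum]
        exact Finset.sum_congr rfl fun i _ => by ring
      rw [this]; ring
  have cZ : ContinuousOn (fun t => ∫ x, gs x0 t x * (wt t x + lap (w t) x) ^ 2) (Ioo a b) := by
    refine contInt (F := fun t x => gs x0 t x * (wt t x + lap (w t) x) ^ 2) hS.measurableSet hS.measure_lt_top (C := 1 * (C + C) ^ 2)
      (fun t ht => Continuous.aestronglyMeasurable ?_) ?_ ?_ ?_
    · have := cz t ht; have := cg t; have := cl t ht; fun_prop
    · intro t ht x hx; simp [z0 t ht x hx, l0 t ht x hx]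
    · intro t ht x hx
      refine mul_bd (bg t ht x) ?_
      rw [abs_pow]
      exact pow_le_pow_left₀ (abs_nonneg _) (add_bd (hw.b3 t ht x) (hw.b2 t ht x)) 2
    · intro x hx
      refine ContinuousOn.mul (fun t ht => (hasDerivAt_gs x0 x (ha.trans ht.1)).continuousAt.continuousWithinAt) ?_
      exact ((hw.c1 x).add (hw.c2 x)).pow 2
  have hsub : Icc τ1 τ2 ⊆ Ioo a b := fun t ht => ⟨h1.trans_le ht.1, ht.2.trans_lt h2⟩
  have cE : ContinuousOn (fun t => ∫ x, gs x0 t x * (w t x * w t x)) (Ioo a b) := fun t ht =>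
    (dE t ht).continuousAt.continuousWithinAt
  have cD : ContinuousOn (fun t => ∫ x, gs x0 t x * gsq (w t) x) (Ioo a b) := fun t ht =>
    (dD t ht).continuousAt.continuousWithinAt
  have cm : ContinuousOn m (Ioo a b) := fun t ht => (hm t ht).continuousAt.continuousWithinAt
  have cm' : ContinuousOn m' (Ioo a b) := fun t ht => (hm' t ht).continuousAt.continuousWithinAt
  have cexp : ContinuousOn (fun t => Real.exp (2 * m t)) (Ioo a b) := 
    Real.continuous_exp.comp_continuousOn (continuousOn_const.mul cm)
  have cR1 : ContinuousOn (fun t => Real.exp (2 * m t) * ∫ x, gs x0 t x * (wt t x + lap (w t) x) ^ 2) (Ioo a b) :=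
    cexp.mul cZ
  have cL1 : ContinuousOn (fun t => Real.exp (2 * m t) * ((m'' t + m' t / t) * ∫ x, gs x0 t x * (w t x * w t x))) (Ioo a b) :=
    cexp.mul ((hm''.add (cm'.div continuousOn_id (fun t ht => (ha.trans ht.1).ne'))).mul cE)
  have iR : IntervalIntegrable (fun t => Real.exp (2 * m t) * ∫ x, gs x0 t x * (wt t x + lap (w t) x) ^ 2) volume τ1 τ2 := by
    apply ContinuousOn.intervalIntegrable
    rw [uIcc_of_le h12]; exact cR1.mono hsub
  have iL : IntervalIntegrable (fun t => Real.exp (2 * m t) * ((m'' t + m' t / t) * ∫ x, gs x0 t x * (w t x * w t x))) volume τ1 τ2 := by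
    apply ContinuousOn.intervalIntegrable
    rw [uIcc_of_le h12]; exact cL1.mono hsub
  have dκ : ∀ t ∈ Ioo a b, HasDerivAt (fun t => m' t + (N / 2 - 1) * (1 / (2 * t)))
      (m'' t - (N / 2 - 1) * (2 * (1 / (2 * t)) ^ 2)) t := by
    intro t ht
    have ht0 : 0 < t := ha.trans ht.1
    have h3 : HasDerivAt (fun t : ℝ => 1 / (2 * t)) (-(2 * (1 / (2 * t)) ^ 2)) t := by
      have := (hasDerivAt_const t (1:ℝ)).div ((hasDerivAt_id' t).const_mul 2) (by positivity)
      refine this.congr_deriv ?_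
      field_simp; ring
    refine ((hm' t ht).add (h3.const_mul _)).congr_deriv ?_
    ring
  have dΦ : ∀ t ∈ Ioo a b, HasDerivAt (fun t => -(Real.exp (2 * m t) * ((∫ x, gs x0 t x * gsq (w t) x)
      + (m' t + (N / 2 - 1) * (1 / (2 * t))) * ∫ x, gs x0 t x * (w t x * w t x)))) 
      (Real.exp (2 * m t) * (-(2 * m' t * ((∫ x, gs x0 t x * gsq (w t) x) + (m' t + (N / 2 - 1) * (1 / (2 * t))) * ∫ x, gs x0 t x * (w t x * w t x)))
    - ((∫ x, gs x0 t x * (‖x - x0‖ ^ 2 * (1 / (2 * t)) ^ 2 * gsq (w t) x + 2 * ∑ i, pd i (w t) x * pd i (wt t) x))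
      + (m'' t - (N / 2 - 1) * (2 * (1 / (2 * t)) ^ 2)) * (∫ x, gs x0 t x * (w t x * w t x))
      + (m' t + (N / 2 - 1) * (1 / (2 * t))) * 
        ∫ x, gs x0 t x * (‖x - x0‖ ^ 2 * (1 / (2 * t)) ^ 2 * (w t x * w t x) + 2 * (w t x * wt t x))))) t := by
    intro t ht
    have h3 : HasDerivAt (fun t => Real.exp (2 * m t)) (Real.exp (2 * m t) * (2 * m' t)) t :=
      ((hm t ht).const_mul 2).exp
    refine ((h3.mul ((dD t ht).add ((dκ t ht).mul (dE t ht)))).neg).congr_deriv ?_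
    simp only [Pi.mul_apply, Pi.add_apply]
    ring
  have key := intervalIntegral.sub_le_integral_of_hasDeriv_right_of_le (a := τ1) (b := τ2) h12
    (φ := fun t => Real.exp (2 * m t) * (∫ x, gs x0 t x * (wt t x + lap (w t) x) ^ 2) -
      Real.exp (2 * m t) * ((m'' t + m' t / t) * ∫ x, gs x0 t x * (w t x * w t x)))
    (fun t ht => (dΦ t (hsub ht)).continuousAt.continuousWithinAt)
    (fun t ht => (dΦ t (hsub (Ioo_subset_Icc_self ht))).hasDerivWithinAt)
    (((cR1.sub cL1).mono hsub).integrableOn_Icc)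
    (by
      intro t ht
      have ht' := hsub (Ioo_subset_Icc_self ht)
      have := carl_alg x0 (ha.trans ht'.1) hS (hw.smooth t ht') (hw.smooth' t ht') (hw.supp t ht') (hw.supp' t ht') (m' t) (m'' t)
      rw [← mul_sub]
      exact mul_le_mul_of_nonneg_left this (Real.exp_pos _).le)
  have z1 : w τ1 = fun _ => 0 := funext hw1
  have z2 : w τ2 = fun _ => 0 := funext hw2
  have zq : ∀ x, gsq (fun _ : EuclideanSpace ℝ (Fin N) => (0:ℝ)) x = 0 := fun x => by simp [gsq, pd_const]
  simp only [z1, z2, zq] at key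
  rw [intervalIntegral.integral_sub iR iL] at key
  simp at key
  exact key
end Aux4

section Aux5
open scoped ContDiff

/-- regularity class: slice-wise continuous, bounded, vanishing off `Ω` -/
structure Cls {N : ℕ} (I : Set ℝ) (Ω : Set (EuclideanSpace ℝ (Fin N)))
    (u : ℝ → EuclideanSpace ℝ (Fin N) → ℝ) (M : ℝ) : Prop where
  cx : ∀ t ∈ I, ContinuousOn (u t) Ω
  ct : ∀ x, ContinuousOn (fun t => u t x) I
  bd : ∀ t ∈ I, ∀ x, |u t x| ≤ M
  off : ∀ t ∈ I, ∀ x, x ∉ Ω → u t x = 0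

/-- weak solutions of `u_t + Δ u = f` -/
def WeakB {N : ℕ} (I : Set ℝ) (Ω : Set (EuclideanSpace ℝ (Fin N)))
    (u f : ℝ → EuclideanSpace ℝ (Fin N) → ℝ) : Prop :=
  ∀ φ, TestOn Ω φ → ∀ t ∈ I, HasDerivAt (fun t => ∫ x, u t x * φ x)
    ((∫ x, f t x * φ x) - ∫ x, u t x * lap φ x) t

lemma Cls.aesm {N : ℕ} {I : Set ℝ} {Ω : Set (EuclideanSpace ℝ (Fin N))} (hΩ : IsOpen Ω)
    {u : ℝ → EuclideanSpace ℝ (Fin N) → ℝ} {M : ℝ} (h : Cls I Ω u M) {t : ℝ} (ht : t ∈ I) :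
    AEStronglyMeasurable (u t) volume := by
  have h1 : AEStronglyMeasurable (u t) (volume.restrict Ω) :=
    (h.cx t ht).aestronglyMeasurable hΩ.measurableSet
  have h2 : u t = Ω.indicator (u t) := by
    ext x
    by_cases hx : x ∈ Ω
    · simp [hx]
    · simp [hx, h.off t ht x hx]
  rw [h2]
  exact (aestronglyMeasurable_indicator_iff hΩ.measurableSet).2 h1

/-- mollification -/
def mol {N : ℕ} (ψ u : EuclideanSpace ℝ (Fin N) → ℝ) (x : EuclideanSpace ℝ (Fin N)) : ℝ :=
  ∫ y, u y * ψ (x - y)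

lemma mol_eq {N : ℕ} (ψ u : EuclideanSpace ℝ (Fin N) → ℝ) :
    mol ψ u = convolution u ψ (ContinuousLinearMap.mul ℝ ℝ) volume := rfl

lemma locInt {N : ℕ} {u : EuclideanSpace ℝ (Fin N) → ℝ} {M : ℝ}
    (hu : AEStronglyMeasurable u volume) (hb : ∀ x, |u x| ≤ M) : LocallyIntegrable u := by
  have hc : LocallyIntegrable (fun _ : EuclideanSpace ℝ (Fin N) => M) volume := locallyIntegrable_const M
  exact hc.mono hu (Eventually.of_forall fun x => by
    simpa using (hb x).trans (le_abs_self M))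

lemma contDiff_mol {N : ℕ} {ψ u : EuclideanSpace ℝ (Fin N) → ℝ} {M : ℝ}
    (hψ : ContDiff ℝ ∞ ψ) (hc : HasCompactSupport ψ)
    (hu : AEStronglyMeasurable u volume) (hb : ∀ x, |u x| ≤ M) : ContDiff ℝ ∞ (mol ψ u) := by
  rw [mol_eq]
  exact hc.contDiff_convolution_right _ (locInt hu hb) hψ

lemma pd_mol {N : ℕ} (i : Fin N) {ψ u : EuclideanSpace ℝ (Fin N) → ℝ} {M : ℝ}
    (hψ : ContDiff ℝ ∞ ψ) (hc : HasCompactSupport ψ)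
    (hu : AEStronglyMeasurable u volume) (hb : ∀ x, |u x| ≤ M) (x) :
    pd i (mol ψ u) x = mol (pd i ψ) u x := by
  unfold pd
  rw [mol_eq]
  have h := hc.hasFDerivAt_convolution_right (ContinuousLinearMap.mul ℝ ℝ) (locInt hu hb)
    (hψ.of_le (by simp)) x
  rw [h.fderiv, convolution_precompR_apply _ (locInt hu hb) (hc.fderiv ℝ)
    (hψ.continuous_fderiv (by simp))]
  rfl

lemma mol_sum {N : ℕ} {ψ : Fin N → EuclideanSpace ℝ (Fin N) → ℝ}
    {u : EuclideanSpace ℝ (Fin N) → ℝ} {M : ℝ}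
    (hψ : ∀ i, Continuous (ψ i)) (hc : ∀ i, HasCompactSupport (ψ i))
    (hu : AEStronglyMeasurable u volume) (hb : ∀ x, |u x| ≤ M) (x) :
    mol (fun z => ∑ i, ψ i z) u x = ∑ i, mol (ψ i) u x := by
  unfold mol
  simp only [Finset.mul_sum]
  rw [integral_finsetSum]
  intro i _
  exact (hc i).convolutionExists_right (ContinuousLinearMap.mul ℝ ℝ) (locInt hu hb) (hψ i) x

lemma lap_mol {N : ℕ} {ψ u : EuclideanSpace ℝ (Fin N) → ℝ} {M : ℝ}
    (hψ : ContDiff ℝ ∞ ψ) (hc : HasCompactSupport ψ)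
    (hu : AEStronglyMeasurable u volume) (hb : ∀ x, |u x| ≤ M) (x) :
    lap (mol ψ u) x = mol (lap ψ) u x := by
  have h1 : ∀ i, pd i (mol ψ u) = mol (pd i ψ) u := fun i => funext (pd_mol i hψ hc hu hb)
  rw [lap_eq]
  have h2 : lap ψ = fun z => ∑ i, pd i (pd i ψ) z := rfl
  rw [h2, mol_sum (fun i => (contDiff_pd_top i (contDiff_pd_top i hψ)).continuous)
    (fun i => hasCompactSupport_pd i (hasCompactSupport_pd i hc)) hu hb]
  refine Finset.sum_congr rfl fun i _ => ?_
  rw [h1, pd_mol i (contDiff_pd_top i hψ) (hasCompactSupport_pd i hc) hu hb]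

lemma mol_bd {N : ℕ} {ψ u : EuclideanSpace ℝ (Fin N) → ℝ} {M : ℝ}
    (hψ : Continuous ψ) (hc : HasCompactSupport ψ)
    (hb : ∀ x, |u x| ≤ M) (x) :
    |mol ψ u x| ≤ M * ∫ y, |ψ y| := by
  unfold mol
  have h1 : Integrable fun y => |ψ (x - y)| := by
    have : Integrable fun y => ψ (x - y) :=
      (hψ.integrable_of_hasCompactSupport hc).comp_sub_left x
    exact this.abs
  calc |∫ y, u y * ψ (x - y)| ≤ ∫ y, M * |ψ (x - y)| := by
        rw [← Real.norm_eq_abs]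
        refine norm_integral_le_of_norm_le (h1.const_mul M) (Eventually.of_forall fun y => ?_)
        rw [norm_mul]
        exact mul_le_mul_of_nonneg_right (hb y) (abs_nonneg _)
    _ = M * ∫ y, |ψ y| := by
        rw [integral_const_mul, integral_sub_left_eq_self (fun y => |ψ y|)]

lemma pd_refl {N : ℕ} (i : Fin N) {ψ : EuclideanSpace ℝ (Fin N) → ℝ} (hψ : Differentiable ℝ ψ)
    (x y : EuclideanSpace ℝ (Fin N)) : pd i (fun y => ψ (x - y)) y = - pd i ψ (x - y) := by
  unfold pd
  have := (hψ (x - y)).hasFDerivAt.comp y ((hasFDerivAt_id y).const_sub x)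
  rw [show (fun y => ψ (x - y)) = ψ ∘ (fun y => x - y) from rfl]
  erw [this.fderiv]
  simp

lemma lap_refl {N : ℕ} {ψ : EuclideanSpace ℝ (Fin N) → ℝ} (hψ : ContDiff ℝ ∞ ψ)
    (x y : EuclideanSpace ℝ (Fin N)) : lap (fun y => ψ (x - y)) y = lap ψ (x - y) := by
  rw [lap_eq, lap_eq]
  refine Finset.sum_congr rfl fun i _ => ?_
  have h1 : pd i (fun y => ψ (x - y)) = fun y => (-1) * pd i ψ (x - y) := by
    ext y; rw [pd_refl i (hψ.differentiable (by simp))]; ring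
  have hd : Differentiable ℝ (pd i ψ) := (contDiff_pd_top i hψ).differentiable (by simp)
  have hd2 : DifferentiableAt ℝ (fun y => pd i ψ (x - y)) y :=
    hd.comp ((differentiable_const x).sub differentiable_id) y
  rw [h1, pd_const_mul i (-1) hd2, pd_refl i hd]
  ring

lemma testOn_refl {N : ℕ} {Ω : Set (EuclideanSpace ℝ (Fin N))} {ε : ℝ}
    {ψ : EuclideanSpace ℝ (Fin N) → ℝ} (hψ : ContDiff ℝ ∞ ψ)
    (hs : tsupport ψ ⊆ closedBall 0 ε) {x : EuclideanSpace ℝ (Fin N)}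
    (hx : closedBall x ε ⊆ Ω) : TestOn Ω (fun y => ψ (x - y)) := by
  have hsub : tsupport (fun y => ψ (x - y)) ⊆ closedBall x ε := by
    refine closure_minimal ?_ isClosed_closedBall
    intro y hy
    have : x - y ∈ closedBall (0 : EuclideanSpace ℝ (Fin N)) ε := hs (subset_tsupport _ hy)
    simpa [dist_eq_norm, norm_sub_rev] using this
  refine ⟨hψ.comp (contDiff_const.sub contDiff_id), ?_, hsub.trans hx⟩
  exact (isCompact_closedBall x ε).of_isClosed_subset (isClosed_tsupport _) hsub

lemma mol_deriv {N : ℕ} {I : Set ℝ} {Ω : Set (EuclideanSpace ℝ (Fin N))}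
    {u f : ℝ → EuclideanSpace ℝ (Fin N) → ℝ} (hw : WeakB I Ω u f) {ε : ℝ}
    {ψ : EuclideanSpace ℝ (Fin N) → ℝ} (hψ : ContDiff ℝ ∞ ψ)
    (hs : tsupport ψ ⊆ closedBall 0 ε) {x : EuclideanSpace ℝ (Fin N)}
    (hx : closedBall x ε ⊆ Ω) {t : ℝ} (ht : t ∈ I) :
    HasDerivAt (fun t => mol ψ (u t) x) (mol ψ (f t) x - mol (lap ψ) (u t) x) t := by
  have := hw _ (testOn_refl hψ hs hx) t ht
  simp only [lap_refl hψ] at this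
  exact this

lemma mol_cont {N : ℕ} {I : Set ℝ} {Ω : Set (EuclideanSpace ℝ (Fin N))} (hΩ : IsOpen Ω)
    {u : ℝ → EuclideanSpace ℝ (Fin N) → ℝ} {M : ℝ} (hu : Cls I Ω u M)
    {ψ : EuclideanSpace ℝ (Fin N) → ℝ} (hψ : Continuous ψ)
    (hc : HasCompactSupport ψ) (x : EuclideanSpace ℝ (Fin N)) :
    ContinuousOn (fun t => mol ψ (u t) x) I := by
  obtain ⟨C, hC⟩ := hc.exists_bound_of_continuous hψ
  have hcr : HasCompactSupport (fun y => ψ (x - y)) :=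
    hc.comp_homeomorph (Homeomorph.subLeft x)
  have hcψ : Continuous fun y => ψ (x - y) := by fun_prop
  refine contInt (F := fun t y => u t y * ψ (x - y)) (S := tsupport (fun y => ψ (x - y)))
    (C := M * C) hcr.isCompact.measurableSet hcr.isCompact.measure_lt_top ?_ ?_ ?_ ?_
  · intro t ht
    exact (hu.aesm hΩ ht).mul hcψ.aestronglyMeasurable
  · intro t ht y hy
    have : ψ (x - y) = 0 := image_eq_zero_of_notMem_tsupport (f := fun y => ψ (x - y)) hy
    simp only [this, mul_zero]
  · intro t ht y _
    exact mul_bd (hu.bd t ht y) (hC (x - y))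
  · intro y _
    exact (hu.ct y).mul continuousOn_const

/-- a standard mollifier -/
def bump {N : ℕ} (ε : ℝ) (hε : 0 < ε) : ContDiffBump (0 : EuclideanSpace ℝ (Fin N)) :=
  ⟨ε / 2, ε, by positivity, by linarith⟩

lemma exists_moll {N : ℕ} (ε : ℝ) (hε : 0 < ε) : ∃ ρ : EuclideanSpace ℝ (Fin N) → ℝ,
    ContDiff ℝ ∞ ρ ∧ HasCompactSupport ρ ∧ tsupport ρ ⊆ closedBall 0 ε ∧ (∀ x, 0 ≤ ρ x) ∧
    ∫ x, ρ x = 1 := by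
  refine ⟨(bump ε hε).normed volume, (bump ε hε).contDiff_normed, (bump ε hε).hasCompactSupport_normed, ?_,
    (bump ε hε).nonneg_normed, (bump ε hε).integral_normed⟩
  rw [(bump ε hε).tsupport_normed_eq]
  exact le_rfl

lemma mol_bd_one {N : ℕ} {ρ u : EuclideanSpace ℝ (Fin N) → ℝ} {M : ℝ}
    (hψ : Continuous ρ) (hc : HasCompactSupport ρ) (h0 : ∀ x, 0 ≤ ρ x) (h1 : ∫ x, ρ x = 1)
    (hb : ∀ x, |u x| ≤ M) (x) : |mol ρ u x| ≤ M := by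
  have := mol_bd hψ hc hb x
  simp only [abs_of_nonneg (h0 _), h1, mul_one] at this
  exact this

lemma mol_approx {N : ℕ} {ρ u : EuclideanSpace ℝ (Fin N) → ℝ} {M ε δ : ℝ}
    (hψ : Continuous ρ) (hc : HasCompactSupport ρ) (h0 : ∀ x, 0 ≤ ρ x) (h1 : ∫ x, ρ x = 1)
    (hs : tsupport ρ ⊆ closedBall 0 ε)
    (hu : AEStronglyMeasurable u volume) (hb : ∀ x, |u x| ≤ M) (x)
    (hd : ∀ y ∈ closedBall x ε, |u y - u x| ≤ δ) : |mol ρ u x - u x| ≤ δ := by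
  have i1 : Integrable fun y => ρ (x - y) := (hψ.integrable_of_hasCompactSupport hc).comp_sub_left x
  have e1 : ∫ y, ρ (x - y) = 1 := by rw [integral_sub_left_eq_self ρ, h1]
  have i2 : Integrable fun y => u y * ρ (x - y) :=
    hc.convolutionExists_right (ContinuousLinearMap.mul ℝ ℝ) (locInt hu hb) hψ x
  have e2 : mol ρ u x - u x = ∫ y, (u y - u x) * ρ (x - y) := by
    have : ∀ y, (u y - u x) * ρ (x - y) = u y * ρ (x - y) - u x * ρ (x - y) := fun y => by ring
    simp only [this]
    rw [integral_sub i2 (i1.const_mul _), integral_const_mul, e1, mul_one]; rfl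
  rw [e2, ← Real.norm_eq_abs]
  calc _ ≤ ∫ y, δ * ρ (x - y) := by
        refine norm_integral_le_of_norm_le (i1.const_mul δ) (Eventually.of_forall fun y => ?_)
        rw [norm_mul, Real.norm_eq_abs, Real.norm_eq_abs, abs_of_nonneg (h0 _)]
        by_cases hy : y ∈ closedBall x ε
        · exact mul_le_mul_of_nonneg_right (hd y hy) (h0 _)
        · have : ρ (x - y) = 0 := by
            apply image_eq_zero_of_notMem_tsupport
            intro h
            apply hy
            have := hs h
            simpa [dist_eq_norm, norm_sub_rev] using this
          simp [this]
    _ = δ := by rw [integral_const_mul, e1, mul_one]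
end Aux5

section Aux6
open scoped ContDiff

lemma lap_mul {N : ℕ} {f g : EuclideanSpace ℝ (Fin N) → ℝ} (hf : ContDiff ℝ ∞ f)
    (hg : ContDiff ℝ ∞ g) (x) : lap (fun y => f y * g y) x
    = lap f x * g x + 2 * ∑ i, pd i f x * pd i g x + f x * lap g x := by
  have h1 : ∀ i, pd i (fun y => f y * g y) = fun y => pd i f y * g y + f y * pd i g y := fun i =>
    funext fun y => pd_mul i (diffable hf y) (diffable hg y)
  simp only [lap_eq]
  rw [Finset.mul_sum, Finset.sum_mul, Finset.mul_sum, ← Finset.sum_add_distrib, ← Finset.sum_add_distrib]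
  refine Finset.sum_congr rfl fun i _ => ?_
  have a1 := diffable (contDiff_pd_top i hf) x
  have a2 := diffable (contDiff_pd_top i hg) x
  have a3 := diffable hf x
  have a4 := diffable hg x
  rw [h1, pd_add i (a1.fun_mul a4) (a3.fun_mul a2), pd_mul i a1 a4, pd_mul i a3 a2]
  ring

lemma lap_pd {N : ℕ} (i : Fin N) {f : EuclideanSpace ℝ (Fin N) → ℝ} (hf : ContDiff ℝ ∞ f) :
    lap (pd i f) = pd i (lap f) := by
  ext x
  have h : lap f = fun y => ∑ j, pd j (pd j f) y := rfl
  rw [h, pd_sum i (fun j => diffable (contDiff_pd_top j (contDiff_pd_top j hf)) x), lap_eq]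
  refine Finset.sum_congr rfl fun j _ => ?_
  rw [pd_symm i j ((contDiff_pd_top j hf).of_le two_le_top)]
  have : pd i (pd j f) = pd j (pd i f) := funext fun y => pd_symm i j (hf.of_le two_le_top) y
  rw [this]

lemma test_bd {N : ℕ} {ψ : EuclideanSpace ℝ (Fin N) → ℝ} (hψ : Continuous ψ)
    (hc : HasCompactSupport ψ) : ∃ C, 0 ≤ C ∧ ∀ x, |ψ x| ≤ C := by
  obtain ⟨C, hC⟩ := hc.exists_bound_of_continuous hψ
  exact ⟨C, (norm_nonneg _).trans (hC 0), hC⟩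

lemma slreg_moll {N : ℕ} {I : Set ℝ} (hI : IsOpen I) {Ω S : Set (EuclideanSpace ℝ (Fin N))}
    (hΩ : IsOpen Ω) {u f : ℝ → EuclideanSpace ℝ (Fin N) → ℝ} {M M' : ℝ} (hu : Cls I Ω u M)
    (hf : Cls I Ω f M') (hw : WeakB I Ω u f) {ε : ℝ} {ρ θ : EuclideanSpace ℝ (Fin N) → ℝ}
    (hρ : ContDiff ℝ ∞ ρ) (hρc : HasCompactSupport ρ) (hρs : tsupport ρ ⊆ closedBall 0 ε)
    (hθ : ContDiff ℝ ∞ θ) (hθc : HasCompactSupport θ) (hθS : tsupport θ ⊆ S)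
    (hS : ∀ x ∈ S, closedBall x ε ⊆ Ω) :
    ∃ C, SlReg I S (fun t x => θ x * mol ρ (u t) x)
      (fun t x => θ x * (mol ρ (f t) x - mol (lap ρ) (u t) x)) C := by
  have hlρ := contDiff_lap_top hρ
  have hlρc := hasCompactSupport_lap hρc
  have hpρ := fun i => contDiff_pd_top i hρ
  have hpρc := fun i => hasCompactSupport_pd i hρc
  have sU : ∀ {ψ}, ContDiff ℝ ∞ ψ → HasCompactSupport ψ → ∀ t ∈ I, ContDiff ℝ ∞ (mol ψ (u t)) :=
    fun h1 h2 t ht => contDiff_mol h1 h2 (hu.aesm hΩ ht) (hu.bd t ht)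
  have sF : ∀ {ψ}, ContDiff ℝ ∞ ψ → HasCompactSupport ψ → ∀ t ∈ I, ContDiff ℝ ∞ (mol ψ (f t)) :=
    fun h1 h2 t ht => contDiff_mol h1 h2 (hf.aesm hΩ ht) (hf.bd t ht)
  have sW : ∀ t ∈ I, ContDiff ℝ ∞ (fun x => mol ρ (f t) x - mol (lap ρ) (u t) x) := fun t ht =>
    (sF hρ hρc t ht).sub (sU hlρ hlρc t ht)
  have epd : ∀ i, ∀ t ∈ I, ∀ x, pd i (fun x => θ x * mol ρ (u t) x) x
      = pd i θ x * mol ρ (u t) x + θ x * mol (pd i ρ) (u t) x := by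
    intro i t ht x
    rw [pd_mul i (diffable hθ x) (diffable (sU hρ hρc t ht) x), pd_mol i hρ hρc (hu.aesm hΩ ht) (hu.bd t ht)]
  have epd' : ∀ i, ∀ t ∈ I, ∀ x, pd i (fun x => θ x * (mol ρ (f t) x - mol (lap ρ) (u t) x)) x
      = pd i θ x * (mol ρ (f t) x - mol (lap ρ) (u t) x)
        + θ x * (mol (pd i ρ) (f t) x - mol (lap (pd i ρ)) (u t) x) := by
    intro i t ht x
    rw [pd_mul i (diffable hθ x) (diffable (sW t ht) x), 
      pd_sub i (diffable (sF hρ hρc t ht) x) (diffable (sU hlρ hlρc t ht) x),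
      pd_mol i hρ hρc (hf.aesm hΩ ht) (hf.bd t ht), pd_mol i hlρ hlρc (hu.aesm hΩ ht) (hu.bd t ht),
      lap_pd i hρ]
  have elap : ∀ t ∈ I, ∀ x, lap (fun x => θ x * mol ρ (u t) x) x
      = lap θ x * mol ρ (u t) x + 2 * ∑ i, pd i θ x * mol (pd i ρ) (u t) x + θ x * mol (lap ρ) (u t) x := by
    intro t ht x
    rw [lap_mul hθ (sU hρ hρc t ht), lap_mol hρ hρc (hu.aesm hΩ ht) (hu.bd t ht)]
    simp only [pd_mol _ hρ hρc (hu.aesm hΩ ht) (hu.bd t ht)]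
  obtain ⟨Cθ, hCθ0, hCθ⟩ := test_bd hθ.continuous hθc
  obtain ⟨Clθ, hClθ0, hClθ⟩ := test_bd (contDiff_lap_top hθ).continuous (hasCompactSupport_lap hθc)
  obtain ⟨Cpθ, hCpθ⟩ : ∃ C, ∀ i x, |pd i θ x| ≤ C := by
    choose C hC using fun i => test_bd (contDiff_pd_top i hθ).continuous (hasCompactSupport_pd i hθc)
    obtain ⟨B, hB⟩ := Finite.exists_le C
    exact ⟨B, fun i x => ((hC i).2 x).trans (hB i)⟩
  have bU : ∀ {ψ}, ContDiff ℝ ∞ ψ → HasCompactSupport ψ → ∀ t ∈ I, ∀ x, |mol ψ (u t) x| ≤ M * ∫ y, |ψ y| :=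
    fun h1 h2 t ht x => mol_bd h1.continuous h2 (hu.bd t ht) x
  have bF : ∀ {ψ}, ContDiff ℝ ∞ ψ → HasCompactSupport ψ → ∀ t ∈ I, ∀ x, |mol ψ (f t) x| ≤ M' * ∫ y, |ψ y| :=
    fun h1 h2 t ht x => mol_bd h1.continuous h2 (hf.bd t ht) x
  obtain ⟨CpU, hCpU⟩ : ∃ C, ∀ i, ∀ t ∈ I, ∀ x, |mol (pd i ρ) (u t) x| ≤ C := by
    obtain ⟨B, hB⟩ := Finite.exists_le (fun i => M * ∫ y, |pd i ρ y|)
    exact ⟨B, fun i t ht x => (bU (hpρ i) (hpρc i) t ht x).trans (hB i)⟩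
  obtain ⟨CpF, hCpF⟩ : ∃ C, ∀ i, ∀ t ∈ I, ∀ x, |mol (pd i ρ) (f t) x - mol (lap (pd i ρ)) (u t) x| ≤ C := by
    obtain ⟨B, hB⟩ := Finite.exists_le (fun i => M' * (∫ y, |pd i ρ y|) + M * ∫ y, |lap (pd i ρ) y|)
    exact ⟨B, fun i t ht x => ((abs_sub _ _).trans (add_le_add (bF (hpρ i) (hpρc i) t ht x) 
      (bU (contDiff_lap_top (hpρ i)) (hasCompactSupport_lap (hpρc i)) t ht x))).trans (hB i)⟩
  have bW : ∀ t ∈ I, ∀ x, |mol ρ (f t) x - mol (lap ρ) (u t) x| ≤ M' * (∫ y, |ρ y|) + M * ∫ y, |lap ρ y| :=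
    fun t ht x => (abs_sub _ _).trans (add_le_add (bF hρ hρc t ht x) (bU hlρ hlρc t ht x))
  have b2 : |(2:ℝ)| ≤ 2 := by norm_num
  obtain ⟨C0, h0⟩ : ∃ C, ∀ t ∈ I, ∀ x, |θ x * mol ρ (u t) x| ≤ C :=
    ⟨_, fun t ht x => mul_bd (hCθ x) (bU hρ hρc t ht x)⟩
  obtain ⟨C1, h1⟩ : ∃ C, ∀ i, ∀ t ∈ I, ∀ x, |pd i (fun x => θ x * mol ρ (u t) x) x| ≤ C :=
    ⟨_, fun i t ht x => by
      rw [epd i t ht x]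
      exact add_bd (mul_bd (hCpθ i x) (bU hρ hρc t ht x)) (mul_bd (hCθ x) (hCpU i t ht x))⟩
  obtain ⟨C2, h2⟩ : ∃ C, ∀ t ∈ I, ∀ x, |lap (fun x => θ x * mol ρ (u t) x) x| ≤ C :=
    ⟨_, fun t ht x => by
      rw [elap t ht x]
      exact add_bd (add_bd (mul_bd (hClθ x) (bU hρ hρc t ht x)) (mul_bd b2 (sum_bd _ fun i => mul_bd (hCpθ i x) (hCpU i t ht x))))
        (mul_bd (hCθ x) (bU hlρ hlρc t ht x))⟩
  obtain ⟨C3, h3⟩ : ∃ C, ∀ t ∈ I, ∀ x, |θ x * (mol ρ (f t) x - mol (lap ρ) (u t) x)| ≤ C :=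
    ⟨_, fun t ht x => mul_bd (hCθ x) (bW t ht x)⟩
  obtain ⟨C4, h4⟩ : ∃ C, ∀ i, ∀ t ∈ I, ∀ x, |pd i (fun x => θ x * (mol ρ (f t) x - mol (lap ρ) (u t) x)) x| ≤ C :=
    ⟨_, fun i t ht x => by
      rw [epd' i t ht x]
      exact add_bd (mul_bd (hCpθ i x) (bW t ht x)) (mul_bd (hCθ x) (hCpF i t ht x))⟩
  have tθ : ∀ g : EuclideanSpace ℝ (Fin N) → ℝ, tsupport (fun x => θ x * g x) ⊆ S := fun g =>
    (tsupport_mul_subset_left).trans hθS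
  have dW : ∀ x ∈ S, ∀ t ∈ I, HasDerivAt (fun t => mol ρ (u t) x) (mol ρ (f t) x - mol (lap ρ) (u t) x) t :=
    fun x hx t ht => mol_deriv hw hρ hρs (hS x hx) ht
  have dWi : ∀ i, ∀ x ∈ S, ∀ t ∈ I, HasDerivAt (fun t => mol (pd i ρ) (u t) x) (mol (pd i ρ) (f t) x - mol (lap (pd i ρ)) (u t) x) t :=
    fun i x hx t ht => mol_deriv hw (hpρ i) ((tsupport_pd i ρ).trans hρs) (hS x hx) ht
  have cU : ∀ {ψ}, ContDiff ℝ ∞ ψ → HasCompactSupport ψ → ∀ x, ContinuousOn (fun t => mol ψ (u t) x) I :=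
    fun h1 h2 x => mol_cont hΩ hu h1.continuous h2 x
  have cF : ∀ {ψ}, ContDiff ℝ ∞ ψ → HasCompactSupport ψ → ∀ x, ContinuousOn (fun t => mol ψ (f t) x) I :=
    fun h1 h2 x => mol_cont hΩ hf h1.continuous h2 x
  refine ⟨max (max C0 C1) (max C2 (max C3 C4)), ?_⟩
  constructor
  · exact fun t ht => hθ.mul (sU hρ hρc t ht)
  · exact fun t ht => hθ.mul (sW t ht)
  · exact fun t _ => tθ _
  · exact fun t _ => tθ _
  · intro x t ht
    by_cases hx : x ∈ S
    · exact (dW x hx t ht).const_mul _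
    · have : θ x = 0 := image_eq_zero_of_notMem_tsupport fun h => hx (hθS h)
      simp only [this, zero_mul]
      exact hasDerivAt_const _ _
  · intro i x t ht
    have ev : (fun t => pd i (fun x => θ x * mol ρ (u t) x) x) =ᶠ[𝓝 t]
        fun t => pd i θ x * mol ρ (u t) x + θ x * mol (pd i ρ) (u t) x := by
      filter_upwards [hI.mem_nhds ht] with s hs using epd i s hs x
    refine HasDerivAt.congr_of_eventuallyEq ?_ ev
    rw [epd' i t ht x]
    by_cases hx : x ∈ S
    · exact ((dW x hx t ht).const_mul _).add ((dWi i x hx t ht).const_mul _)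
    · have h1 : θ x = 0 := image_eq_zero_of_notMem_tsupport fun h => hx (hθS h)
      have h2 : pd i θ x = 0 := pd_zero_of_notMem i fun h => hx (hθS h)
      simp only [h1, h2, zero_mul, add_zero]
      exact hasDerivAt_const _ _
  · exact fun t ht x => (h0 t ht x).trans (by simp)
  · exact fun i t ht x => (h1 i t ht x).trans (by simp)
  · exact fun t ht x => (h2 t ht x).trans (by simp)
  · exact fun t ht x => (h3 t ht x).trans (by simp)
  · exact fun i t ht x => (h4 i t ht x).trans (by simp)
  · exact fun x => continuousOn_const.mul ((cF hρ hρc x).sub (cU hlρ hlρc x))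
  · intro x
    have : ContinuousOn (fun t => lap θ x * mol ρ (u t) x + 2 * ∑ i, pd i θ x * mol (pd i ρ) (u t) x + θ x * mol (lap ρ) (u t) x) I := by
      refine ((continuousOn_const.mul (cU hρ hρc x)).add (continuousOn_const.mul ?_)).add (continuousOn_const.mul (cU hlρ hlρc x))
      exact continuousOn_finset_sum _ fun i _ => continuousOn_const.mul (cU (hpρ i) (hpρc i) x)
    exact this.congr fun t ht => elap t ht x
end Aux6

section Aux7
open scoped ContDiff

lemma gsq_mol {N : ℕ} {ρ u : EuclideanSpace ℝ (Fin N) → ℝ} {M : ℝ}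
    (hρ : ContDiff ℝ ∞ ρ) (hc : HasCompactSupport ρ)
    (hu : AEStronglyMeasurable u volume) (hb : ∀ x, |u x| ≤ M) (x) :
    gsq (mol ρ u) x = ∑ i, mol (pd i ρ) u x * mol (pd i ρ) u x := by
  unfold gsq
  simp only [pd_mol _ hρ hc hu hb]

lemma gsq_nonneg {N : ℕ} (w : EuclideanSpace ℝ (Fin N) → ℝ) (x) : 0 ≤ gsq w x :=
  Finset.sum_nonneg fun i _ => mul_self_nonneg _

lemma cacc_alg {N : ℕ} {U F β : EuclideanSpace ℝ (Fin N) → ℝ} (hU : ContDiff ℝ ∞ U)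
    (hF : ContDiff ℝ ∞ F) (hβ : ContDiff ℝ ∞ β) (hc : HasCompactSupport β) :
    ∫ x, β x * (2 * U x * (F x - lap U x)) = 2 * (∫ x, β x * gsq U x)
      - ∫ x, (U x * U x * lap β x - 2 * (β x * (U x * F x))) := by
  have hUU : ContDiff ℝ ∞ (fun x => U x * U x) := hU.mul hU
  have g := green_test (Ω := univ) isOpen_univ (φ := β) ⟨hβ, hc, subset_univ _⟩
    (f := fun x => U x * U x) ((hUU.of_le two_le_top).contDiffOn)
  have e : ∀ x, lap (fun x => U x * U x) x * β x = β x * (2 * U x * lap U x) + 2 * (β x * gsq U x) := by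
    intro x
    rw [lap_mul hU hU]
    simp only [gsq]
    ring
  simp only [e] at g
  have hl := (contDiff_lap_top hU).continuous
  have hlb := (contDiff_lap_top hβ).continuous
  have hg := (contDiff_gsq hU).continuous
  have cU := hU.continuous
  have cF := hF.continuous
  have cβ := hβ.continuous
  have z : ∀ x, x ∉ tsupport β → β x = 0 := fun x h => image_eq_zero_of_notMem_tsupport h
  have i1 : Integrable fun x => β x * (2 * U x * lap U x) :=
    int_supp hc (by fun_prop) (fun x hx => by simp [z x hx])
  have i2 : Integrable fun x => β x * gsq U x :=
    int_supp hc (by fun_prop) (fun x hx => by simp [z x hx])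
  have i3 : Integrable fun x => β x * (U x * F x) :=
    int_supp hc (by fun_prop) (fun x hx => by simp [z x hx])
  have i4 : Integrable fun x => U x * U x * lap β x :=
    int_supp hc (by fun_prop) (fun x hx => by simp [lap_zero_of_notMem hx])
  rw [integral_add i1 (i2.const_mul 2), integral_const_mul] at g
  rw [integral_sub i4 (i3.const_mul 2), g, integral_const_mul]
  have : ∀ x, β x * (2 * U x * (F x - lap U x)) = 2 * (β x * (U x * F x)) - β x * (2 * U x * lap U x) := by
    intro x; ring
  simp only [this]
  rw [integral_sub (i3.const_mul 2) i1, integral_const_mul]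
  ring

/-- Caccioppoli -/
lemma caccio {N : ℕ} {a b τ1 τ2 : ℝ} (h1 : a < τ1) (h12 : τ1 ≤ τ2) (h2 : τ2 < b)
    {Ω S : Set (EuclideanSpace ℝ (Fin N))}
    (hΩ : IsOpen Ω) {u f : ℝ → EuclideanSpace ℝ (Fin N) → ℝ} {M M' C2 : ℝ}
    (hu : Cls (Ioo a b) Ω u M)
    (hf : Cls (Ioo a b) Ω f M') (hw : WeakB (Ioo a b) Ω u f)
    (hu1 : ∀ x, u τ1 x = 0) (hu2 : ∀ x, u τ2 x = 0)
    {ε : ℝ} {ρ β : EuclideanSpace ℝ (Fin N) → ℝ}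
    (hρ : ContDiff ℝ ∞ ρ) (hρc : HasCompactSupport ρ) (hρs : tsupport ρ ⊆ closedBall 0 ε)
    (hρ0 : ∀ x, 0 ≤ ρ x) (hρ1 : ∫ x, ρ x = 1)
    (hSc : IsCompact S)
    (hβ : ContDiff ℝ ∞ β) (hβc : HasCompactSupport β) (hβS : tsupport β ⊆ S)
    (hβ1 : ∀ x, |β x| ≤ 1) (hC2 : ∀ x, |lap β x| ≤ C2)
    (hS : ∀ x ∈ S, closedBall x ε ⊆ Ω) :
    ContinuousOn (fun t => ∫ x, β x * gsq (mol ρ (u t)) x) (Ioo a b) ∧ 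
    2 * ∫ t in τ1..τ2, ∫ x, β x * gsq (mol ρ (u t)) x
      ≤ (τ2 - τ1) * (volume.real S * (M ^ 2 * C2 + 2 * M * M')) := by
  have hlρ := contDiff_lap_top hρ
  have hlρc := hasCompactSupport_lap hρc
  have hpρ := fun i => contDiff_pd_top i hρ
  have hpρc := fun i => hasCompactSupport_pd i hρc
  have hSm : MeasurableSet S := hSc.isClosed.measurableSet
  have hSf : volume S < ⊤ := hSc.measure_lt_top
  set I := Ioo a b
  have sU : ∀ {ψ}, ContDiff ℝ ∞ ψ → HasCompactSupport ψ → ∀ t ∈ I, ContDiff ℝ ∞ (mol ψ (u t)) :=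
    fun h1 h2 t ht => contDiff_mol h1 h2 (hu.aesm hΩ ht) (hu.bd t ht)
  have sF : ∀ {ψ}, ContDiff ℝ ∞ ψ → HasCompactSupport ψ → ∀ t ∈ I, ContDiff ℝ ∞ (mol ψ (f t)) :=
    fun h1 h2 t ht => contDiff_mol h1 h2 (hf.aesm hΩ ht) (hf.bd t ht)
  have cU : ∀ {ψ}, ContDiff ℝ ∞ ψ → HasCompactSupport ψ → ∀ x, ContinuousOn (fun t => mol ψ (u t) x) I :=
    fun h1 h2 x => mol_cont hΩ hu h1.continuous h2 x
  have cF : ∀ {ψ}, ContDiff ℝ ∞ ψ → HasCompactSupport ψ → ∀ x, ContinuousOn (fun t => mol ψ (f t) x) I :=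
    fun h1 h2 x => mol_cont hΩ hf h1.continuous h2 x
  have bU : ∀ {ψ}, ContDiff ℝ ∞ ψ → HasCompactSupport ψ → ∀ t ∈ I, ∀ x, |mol ψ (u t) x| ≤ M * ∫ y, |ψ y| :=
    fun h1 h2 t ht x => mol_bd h1.continuous h2 (hu.bd t ht) x
  have bU1 : ∀ t ∈ I, ∀ x, |mol ρ (u t) x| ≤ M := fun t ht x =>
    mol_bd_one hρ.continuous hρc hρ0 hρ1 (hu.bd t ht) x
  have bF1 : ∀ t ∈ I, ∀ x, |mol ρ (f t) x| ≤ M' := fun t ht x =>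
    mol_bd_one hρ.continuous hρc hρ0 hρ1 (hf.bd t ht) x
  have z : ∀ x, x ∉ S → β x = 0 := fun x h => image_eq_zero_of_notMem_tsupport fun h' => h (hβS h')
  have zl : ∀ x, x ∉ S → lap β x = 0 := fun x h => lap_zero_of_notMem fun h' => h (hβS h')
  have b2 : |(2:ℝ)| ≤ 2 := by norm_num
  have eg : ∀ t ∈ I, ∀ x, gsq (mol ρ (u t)) x = ∑ i, mol (pd i ρ) (u t) x * mol (pd i ρ) (u t) x :=
    fun t ht x => gsq_mol hρ hρc (hu.aesm hΩ ht) (hu.bd t ht) x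
  have hcont1 : ContinuousOn (fun t => ∫ x, β x * gsq (mol ρ (u t)) x) I := by
    obtain ⟨B, hB⟩ := Finite.exists_le (fun i => M * ∫ y, |pd i ρ y|)
    refine contInt hSm hSf (C := 1 * (N * (B * B))) ?_ ?_ ?_ ?_
    · intro t ht
      exact (hβ.continuous.mul (contDiff_gsq (sU hρ hρc t ht)).continuous).aestronglyMeasurable
    · intro t ht x hx; simp [z x hx]
    · intro t ht x hx
      rw [eg t ht]
      exact mul_bd (hβ1 x) (sum_bd _ fun i => mul_bd ((bU (hpρ i) (hpρc i) t ht x).trans (hB i)) ((bU (hpρ i) (hpρc i) t ht x).trans (hB i)))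
    · intro x hx
      have : ContinuousOn (fun t => β x * ∑ i, mol (pd i ρ) (u t) x * mol (pd i ρ) (u t) x) I := 
        continuousOn_const.mul (continuousOn_finset_sum _ fun i _ => (cU (hpρ i) (hpρc i) x).mul (cU (hpρ i) (hpρc i) x))
      exact this.congr fun t ht => by simp only [eg t ht]
  have bR : ∀ t ∈ I, ∀ x ∈ S, |mol ρ (u t) x * mol ρ (u t) x * lap β x - 2 * (β x * (mol ρ (u t) x * mol ρ (f t) x))|
      ≤ M * M * C2 + 2 * (1 * (M * M')) := fun t ht x hx =>
    (abs_sub _ _).trans (add_le_add (mul_bd (mul_bd (bU1 t ht x) (bU1 t ht x)) (hC2 x))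
      (mul_bd b2 (mul_bd (hβ1 x) (mul_bd (bU1 t ht x) (bF1 t ht x)))))
  have mR : ∀ t ∈ I, Continuous (fun x => mol ρ (u t) x * mol ρ (u t) x * lap β x - 2 * (β x * (mol ρ (u t) x * mol ρ (f t) x))) := by
    intro t ht
    have a1 := (sU hρ hρc t ht).continuous
    have a2 := (sF hρ hρc t ht).continuous
    have a3 := (contDiff_lap_top hβ).continuous
    have a4 := hβ.continuous
    fun_prop
  have hcont2 : ContinuousOn (fun t => ∫ x, (mol ρ (u t) x * mol ρ (u t) x * lap β x - 2 * (β x * (mol ρ (u t) x * mol ρ (f t) x)))) I := by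
    refine contInt hSm hSf (C := M * M * C2 + 2 * (1 * (M * M'))) ?_ ?_ bR ?_
    · exact fun t ht => (mR t ht).aestronglyMeasurable
    · intro t ht x hx; simp [z x hx, zl x hx]
    · intro x hx
      have a1 := cU hρ hρc x
      have a2 := cF hρ hρc x
      fun_prop
  have hder : ∀ t ∈ I, HasDerivAt (fun t => ∫ x, β x * (mol ρ (u t) x * mol ρ (u t) x))
      (2 * (∫ x, β x * gsq (mol ρ (u t)) x) - ∫ x, (mol ρ (u t) x * mol ρ (u t) x * lap β x - 2 * (β x * (mol ρ (u t) x * mol ρ (f t) x)))) t := by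
    intro t ht
    have := derInt (I := I) isOpen_Ioo hSm hSf (F := fun t x => β x * (mol ρ (u t) x * mol ρ (u t) x))
      (F' := fun t x => β x * (2 * mol ρ (u t) x * (mol ρ (f t) x - lap (mol ρ (u t)) x)))
      (C := 1 * (M * M)) (C' := 1 * (2 * M * (M' + M * ∫ y, |lap ρ y|))) ?_ ?_ ?_ ?_ ?_ ?_ ?_ ht
    · rwa [cacc_alg (sU hρ hρc t ht) (sF hρ hρc t ht) hβ hβc] at this
    · intro t ht
      have a1 := (sU hρ hρc t ht).continuous
      have a4 := hβ.continuous
      exact Continuous.aestronglyMeasurable (by fun_prop)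
    · intro t ht
      have a1 := (sU hρ hρc t ht).continuous
      have a2 := (sF hρ hρc t ht).continuous
      have a3 := (contDiff_lap_top (sU hρ hρc t ht)).continuous
      have a4 := hβ.continuous
      exact Continuous.aestronglyMeasurable (by fun_prop)
    · intro t ht x hx; simp [z x hx]
    · intro t ht x hx; simp [z x hx]
    · intro t ht x hx
      exact mul_bd (hβ1 x) (mul_bd (bU1 t ht x) (bU1 t ht x))
    · intro t ht x hx
      rw [lap_mol hρ hρc (hu.aesm hΩ ht) (hu.bd t ht)]
      exact mul_bd (hβ1 x) (mul_bd (mul_bd b2 (bU1 t ht x)) ((abs_sub _ _).trans (add_le_add (bF1 t ht x) (bU hlρ hlρc t ht x))))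
    · intro x hx t ht
      have d := mol_deriv hw hρ hρs (hS x hx) ht
      refine ((d.mul d).const_mul (β x)).congr_deriv ?_
      rw [lap_mol hρ hρc (hu.aesm hΩ ht) (hu.bd t ht)]
      ring
  have hsub : uIcc τ1 τ2 ⊆ I := by
    rw [uIcc_of_le h12]; exact Icc_subset_Ioo h1 h2
  have i1 : IntervalIntegrable (fun t => ∫ x, β x * gsq (mol ρ (u t)) x) volume τ1 τ2 :=
    (hcont1.mono hsub).intervalIntegrable
  have i2 := (hcont2.mono hsub).intervalIntegrable (μ := volume)
  have ftc := intervalIntegral.integral_eq_sub_of_hasDerivAt (fun t ht => hder t (hsub ht))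
    ((i1.const_mul 2).sub i2)
  have mz : mol ρ (fun _ => (0:ℝ)) = fun _ => 0 := by ext x; simp [mol]
  have e1 : u τ1 = fun _ => 0 := funext hu1
  have e2 : u τ2 = fun _ => 0 := funext hu2
  rw [intervalIntegral.integral_sub (i1.const_mul 2) i2, intervalIntegral.integral_const_mul] at ftc
  simp only [e1, e2, mz, mul_zero, integral_zero, sub_zero] at ftc
  refine ⟨hcont1, ?_⟩
  rw [sub_eq_zero.mp ftc]
  have hb : ∀ t ∈ uIcc τ1 τ2, ∫ x, (mol ρ (u t) x * mol ρ (u t) x * lap β x - 2 * (β x * (mol ρ (u t) x * mol ρ (f t) x)))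
      ≤ volume.real S * (M ^ 2 * C2 + 2 * M * M') := by
    intro t ht
    have ht := hsub ht
    have : ∀ x, mol ρ (u t) x * mol ρ (u t) x * lap β x - 2 * (β x * (mol ρ (u t) x * mol ρ (f t) x))
        ≤ S.indicator (fun _ => M * M * C2 + 2 * (1 * (M * M'))) x := by
      intro x
      by_cases hx : x ∈ S
      · simp only [hx, indicator_of_mem]; exact (le_abs_self _).trans (bR t ht x hx)
      · simp [z x hx, zl x hx, hx]
    refine (integral_mono (int_supp hSc (mR t ht) (fun x hx => by simp [z x hx, zl x hx])) ?_ this).trans ?_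
    · rw [integrable_indicator_iff hSm]; exact integrableOn_const (hs := hSf.ne)
    · rw [integral_indicator hSm, setIntegral_const, smul_eq_mul]
      apply le_of_eq; ring
  refine (intervalIntegral.integral_mono_on h12 i2 intervalIntegrable_const (fun t ht => hb t (by rwa [uIcc_of_le h12]))).trans ?_
  rw [intervalIntegral.integral_const, smul_eq_mul]
end Aux7

section Aux8
open scoped ContDiff

lemma contAtCont_gs {N : ℕ} (x0 x : EuclideanSpace ℝ (Fin N)) {a b : ℝ} (ha : 0 < a) :
    ContinuousOn (fun τ => gs x0 τ x) (Ioo a b) := fun τ hτ =>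
  (hasDerivAt_gs x0 x (ha.trans hτ.1)).continuousAt.continuousWithinAt

lemma sq_split (A B C : ℝ) : (A + 2 * B + C) ^ 2 ≤ 2 * A ^ 2 + 16 * B ^ 2 + 4 * C ^ 2 := by
  nlinarith [sq_nonneg (A - (2 * B + C)), sq_nonneg (2 * B - C)]

lemma master_eps {N : ℕ} (x0 : EuclideanSpace ℝ (Fin N)) {a b τ1 τ2 : ℝ} (ha : 0 < a)
    (h1 : a < τ1) (h12 : τ1 ≤ τ2) (h2 : τ2 < b)
    {Ω S : Set (EuclideanSpace ℝ (Fin N))}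
    (hΩ : IsOpen Ω) {u f : ℝ → EuclideanSpace ℝ (Fin N) → ℝ} {M M' C1 C2 Cθ Kc : ℝ}
    (hu : Cls (Ioo a b) Ω u M)
    (hf : Cls (Ioo a b) Ω f M') (hw : WeakB (Ioo a b) Ω u f)
    (hu1 : ∀ x, u τ1 x = 0) (hu2 : ∀ x, u τ2 x = 0)
    {ε : ℝ} {ρ β θ : EuclideanSpace ℝ (Fin N) → ℝ}
    (hρ : ContDiff ℝ ∞ ρ) (hρc : HasCompactSupport ρ) (hρs : tsupport ρ ⊆ closedBall 0 ε)
    (hρ0 : ∀ x, 0 ≤ ρ x) (hρ1 : ∫ x, ρ x = 1)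
    (hSc : IsCompact S)
    (hβ : ContDiff ℝ ∞ β) (hβc : HasCompactSupport β) (hβS : tsupport β ⊆ S)
    (hβ0 : ∀ x, 0 ≤ β x) (hβ1 : ∀ x, β x ≤ 1) (hC2 : ∀ x, |lap β x| ≤ C2)
    (hθ : ContDiff ℝ ∞ θ) (hθc : HasCompactSupport θ) (hθS : tsupport θ ⊆ S)
    (hCθ0 : 0 ≤ Cθ) (hCθ : ∀ x, gsq θ x ≤ Cθ * β x) (hC1 : ∀ x, |lap θ x| ≤ C1)
    (hS : ∀ x ∈ S, closedBall x ε ⊆ Ω) {m m' m'' : ℝ → ℝ}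
    (hm : ∀ τ ∈ Ioo a b, HasDerivAt m (m' τ) τ) (hm' : ∀ τ ∈ Ioo a b, HasDerivAt m' (m'' τ) τ)
    (hm'' : ContinuousOn m'' (Ioo a b)) (hK0 : 0 ≤ Kc)
    (hK : ∀ τ ∈ Icc τ1 τ2, ∀ x, (gsq θ x ≠ 0 ∨ lap θ x ≠ 0) → Real.exp (2 * m τ) * gs x0 τ x ≤ Kc) :
    ∫ τ in τ1..τ2, Real.exp (2 * m τ) * ((m'' τ + m' τ / τ) *
        ∫ x, gs x0 τ x * (θ x * mol ρ (u τ) x * (θ x * mol ρ (u τ) x)))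
      ≤ 2 * (∫ τ in τ1..τ2, Real.exp (2 * m τ) * ∫ x, gs x0 τ x * (θ x * mol ρ (f τ) x) ^ 2)
       + Kc * ((τ2 - τ1) * volume.real S * (8 * Cθ * (M ^ 2 * C2 + 2 * M * M') + 4 * M ^ 2 * C1 ^ 2)) := by
  obtain ⟨C, hreg⟩ := slreg_moll isOpen_Ioo hΩ hu hf hw hρ hρc hρs hθ hθc hθS hS
  obtain ⟨cc1, cc2⟩ := caccio h1 h12 h2 hΩ hu hf hw hu1 hu2 hρ hρc hρs hρ0 hρ1 hSc hβ hβc hβS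
    (fun x => by rw [abs_of_nonneg (hβ0 x)]; exact hβ1 x) hC2 hS
  have mz : mol ρ (fun _ => (0:ℝ)) = fun _ => 0 := by ext x; simp [mol]
  have e1 : u τ1 = fun _ => 0 := funext hu1
  have e2 : u τ2 = fun _ => 0 := funext hu2
  refine (carleman x0 ha h1 h12 h2 hSc hreg (by simp [e1, mz]) (by simp [e2, mz]) hm hm' hm'').trans ?_
  have hSm : MeasurableSet S := hSc.isClosed.measurableSet
  have hSf : volume S < ⊤ := hSc.measure_lt_top
  have hsub : Icc τ1 τ2 ⊆ Ioo a b := Icc_subset_Ioo h1 h2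
  have sU : ∀ t ∈ Ioo a b, ContDiff ℝ ∞ (mol ρ (u t)) :=
    fun t ht => contDiff_mol hρ hρc (hu.aesm hΩ ht) (hu.bd t ht)
  have sF : ∀ t ∈ Ioo a b, ContDiff ℝ ∞ (mol ρ (f t)) :=
    fun t ht => contDiff_mol hρ hρc (hf.aesm hΩ ht) (hf.bd t ht)
  have bU1 : ∀ t ∈ Ioo a b, ∀ x, |mol ρ (u t) x| ≤ M := fun t ht x =>
    mol_bd_one hρ.continuous hρc hρ0 hρ1 (hu.bd t ht) x
  have bF1 : ∀ t ∈ Ioo a b, ∀ x, |mol ρ (f t) x| ≤ M' := fun t ht x =>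
    mol_bd_one hρ.continuous hρc hρ0 hρ1 (hf.bd t ht) x
  have z : ∀ x, x ∉ S → θ x = 0 := fun x h => image_eq_zero_of_notMem_tsupport fun h' => h (hθS h')
  have zβ : ∀ x, x ∉ S → β x = 0 := fun x h => image_eq_zero_of_notMem_tsupport fun h' => h (hβS h')
  have zp : ∀ i, ∀ x, x ∉ S → pd i θ x = 0 := fun i x h => pd_zero_of_notMem i fun h' => h (hθS h')
  have zl : ∀ x, x ∉ S → lap θ x = 0 := fun x h => lap_zero_of_notMem fun h' => h (hθS h')
  have hmc : ContinuousOn (fun τ => Real.exp (2 * m τ)) (Ioo a b) := by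
    have : ContinuousOn m (Ioo a b) := fun τ hτ => (hm τ hτ).continuousAt.continuousWithinAt
    fun_prop
  have cgs : ∀ τ, Continuous (gs x0 τ) := fun τ => (contDiff_gs x0 τ).continuous
  have eW : ∀ t ∈ Ioo a b, ∀ x, θ x * (mol ρ (f t) x - mol (lap ρ) (u t) x) + lap (fun x => θ x * mol ρ (u t) x) x
      = θ x * mol ρ (f t) x + 2 * (∑ i, pd i θ x * pd i (mol ρ (u t)) x) + lap θ x * mol ρ (u t) x := by
    intro t ht x
    rw [lap_mul hθ (sU t ht), lap_mol hρ hρc (hu.aesm hΩ ht) (hu.bd t ht)]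
    ring
  -- pointwise bound
  have pw : ∀ t ∈ Icc τ1 τ2, ∀ x, Real.exp (2 * m t) * (gs x0 t x * (θ x * (mol ρ (f t) x - mol (lap ρ) (u t) x) + lap (fun x => θ x * mol ρ (u t) x) x) ^ 2)
      ≤ 2 * (Real.exp (2 * m t) * (gs x0 t x * (θ x * mol ρ (f t) x) ^ 2)) + 
       (16 * Kc * Cθ * (β x * gsq (mol ρ (u t)) x) + S.indicator (fun _ => 4 * Kc * M ^ 2 * C1 ^ 2) x) := by
    intro t ht x
    have ht' := hsub ht
    rw [eW t ht']
    have cs : (∑ i, pd i θ x * pd i (mol ρ (u t)) x) ^ 2 ≤ gsq θ x * gsq (mol ρ (u t)) x := by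
      have := Finset.sum_mul_sq_le_sq_mul_sq Finset.univ (fun i => pd i θ x) (fun i => pd i (mol ρ (u t)) x)
      simpa [gsq, sq] using this
    have g0 := gs_pos x0 t x
    have ex := Real.exp_pos (2 * m t)
    have gU := gsq_nonneg (mol ρ (u t)) x
    have gT := gsq_nonneg θ x
    set E := Real.exp (2 * m t) * gs x0 t x with hE
    have E0 : 0 ≤ E := by positivity
    have t1 : E * (16 * (∑ i, pd i θ x * pd i (mol ρ (u t)) x) ^ 2) ≤ 16 * Kc * Cθ * (β x * gsq (mol ρ (u t)) x) := by
      have s1 : E * (16 * (∑ i, pd i θ x * pd i (mol ρ (u t)) x) ^ 2) ≤ 16 * (E * gsq θ x) * gsq (mol ρ (u t)) x := by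
        nlinarith [mul_le_mul_of_nonneg_left cs E0]
      have s2 : E * gsq θ x ≤ Kc * (Cθ * β x) := by
        by_cases h : gsq θ x = 0
        · rw [h, mul_zero]; have := hβ0 x; positivity
        · exact mul_le_mul (hK t ht x (Or.inl h)) (hCθ x) gT hK0
      nlinarith [mul_le_mul_of_nonneg_right s2 gU]
    have t2 : E * (4 * (lap θ x * mol ρ (u t) x) ^ 2) ≤ S.indicator (fun _ => 4 * Kc * M ^ 2 * C1 ^ 2) x := by
      by_cases hx : x ∈ S
      · rw [indicator_of_mem hx]
        by_cases h : lap θ x = 0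
        · rw [h]; simp; positivity
        · have k := hK t ht x (Or.inr h)
          have q : (lap θ x * mol ρ (u t) x) ^ 2 ≤ (C1 * M) ^ 2 := by
            rw [← sq_abs]
            exact pow_le_pow_left₀ (abs_nonneg _) (mul_bd (hC1 x) (bU1 t ht' x)) 2
          calc E * (4 * (lap θ x * mol ρ (u t) x) ^ 2) ≤ Kc * (4 * (C1 * M) ^ 2) := by
                gcongr
            _ = _ := by ring
      · rw [indicator_of_notMem hx, zl x hx]; simp
    have sp := mul_le_mul_of_nonneg_left (sq_split (θ x * mol ρ (f t) x) (∑ i, pd i θ x * pd i (mol ρ (u t)) x) (lap θ x * mol ρ (u t) x)) E0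
    calc _ = E * (θ x * mol ρ (f t) x + 2 * (∑ i, pd i θ x * pd i (mol ρ (u t)) x) + lap θ x * mol ρ (u t) x) ^ 2 := by rw [hE]; ring
      _ ≤ _ := sp
      _ = 2 * (E * (θ x * mol ρ (f t) x) ^ 2) + (E * (16 * (∑ i, pd i θ x * pd i (mol ρ (u t)) x) ^ 2) + E * (4 * (lap θ x * mol ρ (u t) x) ^ 2)) := by ring
      _ ≤ 2 * (E * (θ x * mol ρ (f t) x) ^ 2) + (16 * Kc * Cθ * (β x * gsq (mol ρ (u t)) x) + S.indicator (fun _ => 4 * Kc * M ^ 2 * C1 ^ 2) x) := by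
          gcongr
      _ = _ := by rw [hE]; ring
  have iInd : Integrable (S.indicator (fun _ => 4 * Kc * M ^ 2 * C1 ^ 2)) (volume : Measure (EuclideanSpace ℝ (Fin N))) := by
    rw [integrable_indicator_iff hSm]; exact integrableOn_const (hs := hSf.ne)
  have pt : ∀ t ∈ Icc τ1 τ2, Real.exp (2 * m t) * ∫ x, gs x0 t x * (θ x * (mol ρ (f t) x - mol (lap ρ) (u t) x) + lap (fun x => θ x * mol ρ (u t) x) x) ^ 2
      ≤ 2 * (Real.exp (2 * m t) * ∫ x, gs x0 t x * (θ x * mol ρ (f t) x) ^ 2) + 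
       (16 * Kc * Cθ * (∫ x, β x * gsq (mol ρ (u t)) x) + volume.real S * (4 * Kc * M ^ 2 * C1 ^ 2)) := by
    intro t ht
    have ht' := hsub ht
    have k1 := cgs t
    have k2 := (sU t ht').continuous
    have k3 := (sF t ht').continuous
    have k4 := (hreg.smooth' t ht').continuous
    have k5 := (contDiff_lap_top (hreg.smooth t ht')).continuous
    have k6 := (contDiff_gsq (sU t ht')).continuous
    have k7 := hβ.continuous
    have k8 := hθ.continuous
    have j1 : Integrable fun x => Real.exp (2 * m t) * (gs x0 t x * (θ x * (mol ρ (f t) x - mol (lap ρ) (u t) x) + lap (fun x => θ x * mol ρ (u t) x) x) ^ 2) := by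
      refine int_supp hSc (by fun_prop) fun x hx => ?_
      rw [eW t ht']
      simp [z x hx, zl x hx, zp _ x hx]
    have j2 : Integrable fun x => Real.exp (2 * m t) * (gs x0 t x * (θ x * mol ρ (f t) x) ^ 2) :=
      int_supp hSc (by fun_prop) fun x hx => by simp [z x hx]
    have j3 : Integrable fun x => β x * gsq (mol ρ (u t)) x :=
      int_supp hSc (by fun_prop) fun x hx => by simp [zβ x hx]
    have := integral_mono j1 ((j2.const_mul 2).add ((j3.const_mul (16 * Kc * Cθ)).add iInd)) (pw t ht)
    rw [integral_add' (j2.const_mul 2) ((j3.const_mul (16 * Kc * Cθ)).add iInd),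
      integral_add' (j3.const_mul (16 * Kc * Cθ)) iInd,
      integral_const_mul, integral_const_mul, integral_const_mul, integral_const_mul, integral_indicator hSm, setIntegral_const, smul_eq_mul] at this
    exact this
  have hcF : ContinuousOn (fun t => Real.exp (2 * m t) * ∫ x, gs x0 t x * (θ x * mol ρ (f t) x) ^ 2) (Ioo a b) := by
    refine hmc.mul ?_
    obtain ⟨Ct, hCt0, hCt⟩ := test_bd hθ.continuous hθc
    refine contInt hSm hSf (C := 1 * (Ct * M') ^ 2) ?_ ?_ ?_ ?_
    · intro t ht
      have k1 := cgs t
      have k3 := (sF t ht).continuous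
      have k8 := hθ.continuous
      exact Continuous.aestronglyMeasurable (by fun_prop)
    · intro t ht x hx; simp [z x hx]
    · intro t ht x hx
      refine mul_bd ?_ ?_
      · rw [abs_of_pos (gs_pos _ _ _)]; exact gs_le_one x0 (ha.trans ht.1) x
      · rw [abs_pow]; exact pow_le_pow_left₀ (abs_nonneg _) (mul_bd (hCt x) (bF1 t ht x)) 2
    · intro x hx
      have := mol_cont hΩ hf hρ.continuous hρc x
      have := contAtCont_gs (b := b) x0 x ha
      fun_prop
  have hcL : ContinuousOn (fun t => Real.exp (2 * m t) * ∫ x, gs x0 t x * (θ x * (mol ρ (f t) x - mol (lap ρ) (u t) x) + lap (fun x => θ x * mol ρ (u t) x) x) ^ 2) (Ioo a b) := by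
    refine hmc.mul ?_
    refine contInt hSm hSf (C := 1 * (C + C) ^ 2) ?_ ?_ ?_ ?_
    · intro t ht
      have k1 := cgs t
      have k4 := (hreg.smooth' t ht).continuous
      have k5 := (contDiff_lap_top (hreg.smooth t ht)).continuous
      exact Continuous.aestronglyMeasurable (by fun_prop)
    · intro t ht x hx
      rw [eW t ht]
      simp [z x hx, zl x hx, zp _ x hx]
    · intro t ht x hx
      refine mul_bd ?_ ?_
      · rw [abs_of_pos (gs_pos _ _ _)]; exact gs_le_one x0 (ha.trans ht.1) x
      · rw [abs_pow]; exact pow_le_pow_left₀ (abs_nonneg _) (add_bd (hreg.b3 t ht x) (hreg.b2 t ht x)) 2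
    · intro x hx
      have k1 := hreg.c1 x
      have k2 := hreg.c2 x
      have := contAtCont_gs (b := b) x0 x ha
      fun_prop
  have hsub' : uIcc τ1 τ2 ⊆ Ioo a b := by rwa [uIcc_of_le h12]
  have iL := (hcL.mono hsub').intervalIntegrable (μ := volume)
  have iF := (hcF.mono hsub').intervalIntegrable (μ := volume)
  have iC := (cc1.mono hsub').intervalIntegrable (μ := volume)
  have iK : IntervalIntegrable (fun _ : ℝ => volume.real S * (4 * Kc * M ^ 2 * C1 ^ 2)) volume τ1 τ2 := intervalIntegrable_const
  have fin := intervalIntegral.integral_mono_on h12 iL ((iF.const_mul 2).add ((iC.const_mul (16 * Kc * Cθ)).add iK)) pt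
  rw [intervalIntegral.integral_add (iF.const_mul 2) ((iC.const_mul (16 * Kc * Cθ)).add iK)] at fin
  erw [intervalIntegral.integral_add (iC.const_mul (16 * Kc * Cθ)) iK] at fin
  rw [intervalIntegral.integral_const_mul, intervalIntegral.integral_const_mul, intervalIntegral.integral_const, smul_eq_mul] at fin
  refine fin.trans ?_
  have := mul_le_mul_of_nonneg_left cc2 (by positivity : 0 ≤ 8 * Kc * Cθ)
  linarith
end Aux8

section Aux9
open scoped ContDiff

lemma tendsto_mol {N : ℕ} {Ω : Set (EuclideanSpace ℝ (Fin N))} (hΩ : IsOpen Ω)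
    {h : EuclideanSpace ℝ (Fin N) → ℝ} {M : ℝ} (hc : ContinuousOn h Ω)
    (hm : AEStronglyMeasurable h volume) (hb : ∀ x, |h x| ≤ M)
    {ε : ℕ → ℝ} (hε : Tendsto ε atTop (𝓝 0)) {ρ : ℕ → EuclideanSpace ℝ (Fin N) → ℝ}
    (hρ : ∀ n, ContDiff ℝ ∞ (ρ n)) (hρc : ∀ n, HasCompactSupport (ρ n))
    (hρs : ∀ n, tsupport (ρ n) ⊆ closedBall 0 (ε n))
    (hρ0 : ∀ n x, 0 ≤ ρ n x) (hρ1 : ∀ n, ∫ x, ρ n x = 1) {x} (hx : x ∈ Ω) :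
    Tendsto (fun n => mol (ρ n) h x) atTop (𝓝 (h x)) := by
  rw [Metric.tendsto_atTop]
  intro δ hδ
  have hcx := (hc.continuousAt (hΩ.mem_nhds hx))
  obtain ⟨r, hr, hr'⟩ := Metric.continuousAt_iff.mp hcx (δ / 2) (by positivity)
  obtain ⟨n0, hn0⟩ := (hε.eventually (gt_mem_nhds hr)).exists_forall_of_atTop
  refine ⟨n0, fun n hn => ?_⟩
  have := mol_approx (hρ n).continuous (hρc n) (hρ0 n) (hρ1 n) (hρs n) hm hb x (δ := δ / 2) (by
    intro y hy
    exact (hr' (lt_of_le_of_lt hy (hn0 n hn))).le)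
  rw [Real.dist_eq]; linarith

lemma lim_moll {N : ℕ} (x0 : EuclideanSpace ℝ (Fin N)) {a b τ1 τ2 : ℝ} (ha : 0 < a)
    (h1 : a < τ1) (h12 : τ1 ≤ τ2) (h2 : τ2 < b)
    {Ω S : Set (EuclideanSpace ℝ (Fin N))}
    (hΩ : IsOpen Ω) {h : ℝ → EuclideanSpace ℝ (Fin N) → ℝ} {M : ℝ}
    (hh : Cls (Ioo a b) Ω h M)
    {θ : EuclideanSpace ℝ (Fin N) → ℝ} {ε : ℕ → ℝ} (hε : Tendsto ε atTop (𝓝 0))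
    {ρ : ℕ → EuclideanSpace ℝ (Fin N) → ℝ}
    (hρ : ∀ n, ContDiff ℝ ∞ (ρ n)) (hρc : ∀ n, HasCompactSupport (ρ n))
    (hρs : ∀ n, tsupport (ρ n) ⊆ closedBall 0 (ε n))
    (hρ0 : ∀ n x, 0 ≤ ρ n x) (hρ1 : ∀ n, ∫ x, ρ n x = 1)
    (hSc : IsCompact S) (hSΩ : S ⊆ Ω)
    (hθ : ContDiff ℝ ∞ θ) (hθc : HasCompactSupport θ) (hθS : tsupport θ ⊆ S)
    {k : ℝ → ℝ} (hk : ContinuousOn k (Ioo a b)) :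
    Tendsto (fun n => ∫ τ in τ1..τ2, k τ * ∫ x, gs x0 τ x * (θ x * mol (ρ n) (h τ) x) ^ 2) atTop
      (𝓝 (∫ τ in τ1..τ2, k τ * ∫ x, gs x0 τ x * (θ x * h τ x) ^ 2)) := by
  have hSm : MeasurableSet S := hSc.isClosed.measurableSet
  have hSf : volume S < ⊤ := hSc.measure_lt_top
  have hsub : Icc τ1 τ2 ⊆ Ioo a b := Icc_subset_Ioo h1 h2
  have hsub' : uIcc τ1 τ2 ⊆ Ioo a b := by rwa [uIcc_of_le h12]
  have hsub'' : uIoc τ1 τ2 ⊆ Ioo a b := uIoc_subset_uIcc.trans hsub'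
  have cgs : ∀ τ, Continuous (gs x0 τ) := fun τ => (contDiff_gs x0 τ).continuous
  have z : ∀ x, x ∉ S → θ x = 0 := fun x h => image_eq_zero_of_notMem_tsupport fun h' => h (hθS h')
  obtain ⟨Ct, hCt0, hCt⟩ := test_bd hθ.continuous hθc
  have sF : ∀ n, ∀ t ∈ Ioo a b, ContDiff ℝ ∞ (mol (ρ n) (h t)) :=
    fun n t ht => contDiff_mol (hρ n) (hρc n) (hh.aesm hΩ ht) (hh.bd t ht)
  have bF1 : ∀ n, ∀ t ∈ Ioo a b, ∀ x, |mol (ρ n) (h t) x| ≤ M := fun n t ht x =>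
    mol_bd_one (hρ n).continuous (hρc n) (hρ0 n) (hρ1 n) (hh.bd t ht) x
  have mI : ∀ n, ∀ t ∈ Ioo a b, Continuous fun x => gs x0 t x * (θ x * mol (ρ n) (h t) x) ^ 2 := by
    intro n t ht
    have k1 := cgs t
    have k3 := (sF n t ht).continuous
    have k8 := hθ.continuous
    fun_prop
  have bI : ∀ n, ∀ t ∈ Ioo a b, ∀ x, |gs x0 t x * (θ x * mol (ρ n) (h t) x) ^ 2| ≤ S.indicator (fun _ => 1 * (Ct * M) ^ 2) x := by
    intro n t ht x
    by_cases hx : x ∈ S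
    · rw [indicator_of_mem hx]
      refine mul_bd ?_ ?_
      · rw [abs_of_pos (gs_pos _ _ _)]; exact gs_le_one x0 (ha.trans ht.1) x
      · rw [abs_pow]; exact pow_le_pow_left₀ (abs_nonneg _) (mul_bd (hCt x) (bF1 n t ht x)) 2
    · simp [z x hx, hx]
  have iInd : Integrable (S.indicator (fun _ => 1 * (Ct * M) ^ 2)) (volume : Measure (EuclideanSpace ℝ (Fin N))) := by
    rw [integrable_indicator_iff hSm]; exact integrableOn_const (hs := hSf.ne)
  have hcF : ∀ n, ContinuousOn (fun t => k t * ∫ x, gs x0 t x * (θ x * mol (ρ n) (h t) x) ^ 2) (Ioo a b) := by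
    intro n
    refine hk.mul ?_
    refine contInt hSm hSf (C := 1 * (Ct * M) ^ 2) ?_ ?_ ?_ ?_
    · exact fun t ht => (mI n t ht).aestronglyMeasurable
    · intro t ht x hx; simp [z x hx]
    · intro t ht x hx
      have := bI n t ht x
      rwa [indicator_of_mem hx] at this
    · intro x hx
      have := mol_cont hΩ hh (hρ n).continuous (hρc n) x
      have := contAtCont_gs (b := b) x0 x ha
      fun_prop
  have hkk : ContinuousOn (fun t => |k t| * ((Ct * M) ^ 2 * volume.real S)) (uIcc τ1 τ2) := by
    have := hk.mono hsub'
    fun_prop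
  refine intervalIntegral.tendsto_integral_filter_of_dominated_convergence
    (bound := fun t => |k t| * ((Ct * M) ^ 2 * volume.real S)) ?_ ?_ ?_ ?_
  · refine Eventually.of_forall fun n => ?_
    exact ((hcF n).mono hsub'').aestronglyMeasurable measurableSet_uIoc
  · refine Eventually.of_forall fun n => Eventually.of_forall fun t ht => ?_
    rw [norm_mul, Real.norm_eq_abs]
    refine mul_le_mul_of_nonneg_left ?_ (abs_nonneg _)
    refine (norm_integral_le_of_norm_le iInd (Eventually.of_forall fun x => bI n t (hsub'' ht) x)).trans ?_
    rw [integral_indicator hSm, setIntegral_const, smul_eq_mul]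
    apply le_of_eq; ring
  · exact hkk.intervalIntegrable
  · refine Eventually.of_forall fun t ht => ?_
    have ht := hsub'' ht
    refine Tendsto.const_mul _ ?_
    refine tendsto_integral_of_dominated_convergence _ (fun n => (mI n t ht).aestronglyMeasurable) iInd
      (fun n => Eventually.of_forall fun x => bI n t ht x) ?_
    refine Eventually.of_forall fun x => ?_
    by_cases hx : x ∈ S
    · have := tendsto_mol hΩ (hh.cx t ht) (hh.aesm hΩ ht) (hh.bd t ht) hε hρ hρc hρs hρ0 hρ1 (hSΩ hx)
      exact ((this.const_mul (θ x)).pow 2).const_mul _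
    · simp [z x hx]

lemma master {N : ℕ} (x0 : EuclideanSpace ℝ (Fin N)) {a b τ1 τ2 : ℝ} (ha : 0 < a)
    (h1 : a < τ1) (h12 : τ1 ≤ τ2) (h2 : τ2 < b)
    {Ω S : Set (EuclideanSpace ℝ (Fin N))}
    (hΩ : IsOpen Ω) {u f : ℝ → EuclideanSpace ℝ (Fin N) → ℝ} {M M' C1 C2 Cθ Kc : ℝ}
    (hu : Cls (Ioo a b) Ω u M)
    (hf : Cls (Ioo a b) Ω f M') (hw : WeakB (Ioo a b) Ω u f)
    (hu1 : ∀ x, u τ1 x = 0) (hu2 : ∀ x, u τ2 x = 0)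
    {β θ : EuclideanSpace ℝ (Fin N) → ℝ}
    (hSc : IsCompact S) (hSΩ : S ⊆ Ω)
    (hβ : ContDiff ℝ ∞ β) (hβc : HasCompactSupport β) (hβS : tsupport β ⊆ S)
    (hβ0 : ∀ x, 0 ≤ β x) (hβ1 : ∀ x, β x ≤ 1) (hC2 : ∀ x, |lap β x| ≤ C2)
    (hθ : ContDiff ℝ ∞ θ) (hθc : HasCompactSupport θ) (hθS : tsupport θ ⊆ S)
    (hCθ0 : 0 ≤ Cθ) (hCθ : ∀ x, gsq θ x ≤ Cθ * β x) (hC1 : ∀ x, |lap θ x| ≤ C1)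
    {m m' m'' : ℝ → ℝ}
    (hm : ∀ τ ∈ Ioo a b, HasDerivAt m (m' τ) τ) (hm' : ∀ τ ∈ Ioo a b, HasDerivAt m' (m'' τ) τ)
    (hm'' : ContinuousOn m'' (Ioo a b)) (hK0 : 0 ≤ Kc)
    (hK : ∀ τ ∈ Icc τ1 τ2, ∀ x, (gsq θ x ≠ 0 ∨ lap θ x ≠ 0) → Real.exp (2 * m τ) * gs x0 τ x ≤ Kc) :
    ∫ τ in τ1..τ2, (Real.exp (2 * m τ) * (m'' τ + m' τ / τ)) *
        ∫ x, gs x0 τ x * (θ x * u τ x) ^ 2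
      ≤ 2 * (∫ τ in τ1..τ2, Real.exp (2 * m τ) * ∫ x, gs x0 τ x * (θ x * f τ x) ^ 2)
       + Kc * ((τ2 - τ1) * volume.real S * (8 * Cθ * (M ^ 2 * C2 + 2 * M * M') + 4 * M ^ 2 * C1 ^ 2)) := by
  obtain ⟨d, hd, hd'⟩ := hSc.exists_cthickening_subset_open hΩ hSΩ
  have hsub : ∀ x ∈ S, closedBall x d ⊆ Ω := fun x hx => 
    (closedBall_subset_cthickening hx d).trans hd'
  set ε : ℕ → ℝ := fun n => d * (1 / ((n:ℝ) + 1)) with hεd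
  have hεp : ∀ n, 0 < ε n := fun n => by positivity
  have hεle : ∀ n, ε n ≤ d := fun n => by
    rw [hεd]; simp only
    have : 1 / ((n:ℝ) + 1) ≤ 1 := by
      rw [div_le_one (by positivity)]; have : (0:ℝ) ≤ n := n.cast_nonneg
      linarith
    nlinarith
  have hε : Tendsto ε atTop (𝓝 0) := by
    have := (tendsto_one_div_add_atTop_nhds_zero_nat (𝕜 := ℝ)).const_mul d
    rwa [mul_zero] at this
  choose ρ hρ hρc hρs hρ0 hρ1 using fun n => exists_moll (N := N) (ε n) (hεp n)
  have hmc : ContinuousOn (fun τ => Real.exp (2 * m τ)) (Ioo a b) := by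
    have : ContinuousOn m (Ioo a b) := fun τ hτ => (hm τ hτ).continuousAt.continuousWithinAt
    fun_prop
  have hmc' : ContinuousOn (fun τ => Real.exp (2 * m τ) * (m'' τ + m' τ / τ)) (Ioo a b) := by
    have : ContinuousOn m' (Ioo a b) := fun τ hτ => (hm' τ hτ).continuousAt.continuousWithinAt
    exact hmc.mul (hm''.add (this.div continuousOn_id fun τ hτ => (ha.trans hτ.1).ne'))
  have L1 := lim_moll x0 ha h1 h12 h2 hΩ hu hε hρ hρc hρs hρ0 hρ1 hSc hSΩ hθ hθc hθS hmc'
  have L2 := lim_moll x0 ha h1 h12 h2 hΩ hf hε hρ hρc hρs hρ0 hρ1 hSc hSΩ hθ hθc hθS hmc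
  refine le_of_tendsto_of_tendsto' L1 ((L2.const_mul 2).add_const _) fun n => ?_
  have := master_eps x0 ha h1 h12 h2 hΩ hu hf hw hu1 hu2 (hρ n) (hρc n) (hρs n) (hρ0 n) (hρ1 n) hSc
    hβ hβc hβS hβ0 hβ1 hC2 hθ hθc hθS hCθ0 hCθ hC1 (fun x hx => (closedBall_subset_closedBall (hεle n)).trans (hsub x hx))
    hm hm' hm'' hK0 hK
  simpa only [← sq, mul_assoc] using this
end Aux9

section Aux10
open scoped ContDiff

structure IsCut (χ : ℝ → ℝ) (α γ B : ℝ) : Prop where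
  smooth : ContDiff ℝ ∞ χ
  nonneg : ∀ s, 0 ≤ χ s
  le_one : ∀ s, χ s ≤ 1
  one : ∀ s ≤ α, χ s = 1
  zero : ∀ s, γ ≤ s → χ s = 0
  b1 : ∀ s, |deriv χ s| ≤ B
  b2 : ∀ s, |deriv (deriv χ) s| ≤ B
  z1 : ∀ s, s < α ∨ γ < s → deriv χ s = 0
  z2 : ∀ s, s < α ∨ γ < s → deriv (deriv χ) s = 0
  B0 : 0 ≤ B

lemma exists_cut {α γ : ℝ} (h : α < γ) : ∃ χ B, IsCut χ α γ B := by
  set χ : ℝ → ℝ := fun s => Real.smoothTransition ((γ - s) / (γ - α)) with hχ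
  have hp : 0 < γ - α := by linarith
  have hs : ContDiff ℝ ∞ χ := by
    have : ContDiff ℝ ∞ (fun s : ℝ => (γ - s) / (γ - α)) := by fun_prop
    exact Real.smoothTransition.contDiff.comp this
  have h1 : ∀ s ≤ α, χ s = 1 := fun s hs => by
    apply Real.smoothTransition.one_of_one_le
    rw [le_div_iff₀ hp]; linarith
  have h0 : ∀ s, γ ≤ s → χ s = 0 := fun s hs => by
    apply Real.smoothTransition.zero_of_nonpos
    exact div_nonpos_of_nonpos_of_nonneg (by linarith) hp.le
  have z1 : ∀ s, s < α ∨ γ < s → deriv χ s = 0 := by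
    rintro s (hs | hs)
    · have : χ =ᶠ[𝓝 s] fun _ => 1 := by
        filter_upwards [gt_mem_nhds hs] with y hy using h1 y hy.le
      rw [this.deriv_eq]; simp
    · have : χ =ᶠ[𝓝 s] fun _ => 0 := by
        filter_upwards [lt_mem_nhds hs] with y hy using h0 y hy.le
      rw [this.deriv_eq]; simp
  have z2 : ∀ s, s < α ∨ γ < s → deriv (deriv χ) s = 0 := by
    intro s hs
    have : deriv χ =ᶠ[𝓝 s] fun _ => 0 := by
      rcases hs with hs | hs
      · filter_upwards [gt_mem_nhds hs] with y hy using z1 y (Or.inl hy)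
      · filter_upwards [lt_mem_nhds hs] with y hy using z1 y (Or.inr hy)
    rw [this.deriv_eq]; simp
  have c1 : ContDiff ℝ ∞ (deriv χ) := (contDiff_infty_iff_deriv.mp hs).2
  have c2 : ContDiff ℝ ∞ (deriv (deriv χ)) := (contDiff_infty_iff_deriv.mp c1).2
  obtain ⟨B1, hB1⟩ := isCompact_Icc.exists_bound_of_continuousOn (s := Icc α γ) c1.continuous.continuousOn
  obtain ⟨B2, hB2⟩ := isCompact_Icc.exists_bound_of_continuousOn (s := Icc α γ) c2.continuous.continuousOn
  have key : ∀ s, ¬ (s < α ∨ γ < s) → s ∈ Icc α γ := fun s hs => by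
    rw [not_or, not_lt, not_lt] at hs; exact hs
  refine ⟨χ, max 0 (max B1 B2), hs, fun s => Real.smoothTransition.nonneg _, fun s => Real.smoothTransition.le_one _,
    h1, h0, fun s => ?_, fun s => ?_, z1, z2, le_max_left _ _⟩
  · by_cases hh : s < α ∨ γ < s
    · rw [z1 s hh]; simp
    · exact (hB1 s (key s hh)).trans (by simp)
  · by_cases hh : s < α ∨ γ < s
    · rw [z2 s hh]; simp
    · exact (hB2 s (key s hh)).trans (by simp)

lemma IsCut.c1 {χ : ℝ → ℝ} {α γ B : ℝ} (h : IsCut χ α γ B) : ContDiff ℝ ∞ (deriv χ) :=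
  (contDiff_infty_iff_deriv.mp h.smooth).2

def sf {N : ℕ} (x0 : EuclideanSpace ℝ (Fin N)) (r : ℝ) (x : EuclideanSpace ℝ (Fin N)) : ℝ :=
  (‖x - x0‖ ^ 2 - r ^ 2) * (1 / r)

lemma contDiff_sf {N : ℕ} (x0 : EuclideanSpace ℝ (Fin N)) (r : ℝ) : ContDiff ℝ ∞ (sf x0 r) := by
  unfold sf
  have : ContDiff ℝ ∞ (fun x : EuclideanSpace ℝ (Fin N) => ‖x - x0‖ ^ 2) :=
    (contDiff_id.sub contDiff_const).norm_sq ℝ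
  fun_prop

lemma pd_sf {N : ℕ} (i : Fin N) (x0 : EuclideanSpace ℝ (Fin N)) (r : ℝ) (x) :
    pd i (sf x0 r) x = 2 / r * (x - x0) i := by
  have h : ContDiff ℝ ∞ (fun x : EuclideanSpace ℝ (Fin N) => ‖x - x0‖ ^ 2) :=
    (contDiff_id.sub contDiff_const).norm_sq ℝ
  have e : sf x0 r = fun x => (1 / r) * (‖x - x0‖ ^ 2 - r ^ 2) := by ext x; unfold sf; ring
  have h' : DifferentiableAt ℝ (fun _ : EuclideanSpace ℝ (Fin N) => r ^ 2) x := by fun_prop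
  rw [e, pd_const_mul i _ ((diffable h x).fun_sub h'), pd_sub i (diffable h x) h', pd_normsq, pd_const]
  ring

lemma pd_rad {N : ℕ} (i : Fin N) (x0 : EuclideanSpace ℝ (Fin N)) (r : ℝ) {χ : ℝ → ℝ}
    (hχ : ContDiff ℝ ∞ χ) (x) :
    pd i (fun x => χ (sf x0 r x)) x = deriv χ (sf x0 r x) * (2 / r * (x - x0) i) := by
  rw [pd_comp i ((hχ.differentiable (by simp)) _) (diffable (contDiff_sf x0 r) x), pd_sf]

lemma gsq_rad {N : ℕ} (x0 : EuclideanSpace ℝ (Fin N)) (r : ℝ) {χ : ℝ → ℝ}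
    (hχ : ContDiff ℝ ∞ χ) (x) :
    gsq (fun x => χ (sf x0 r x)) x = deriv χ (sf x0 r x) ^ 2 * (4 / r ^ 2 * ‖x - x0‖ ^ 2) := by
  unfold gsq
  simp only [pd_rad _ x0 r hχ]
  rw [norm_sq_coord, Finset.mul_sum, Finset.mul_sum]
  exact Finset.sum_congr rfl fun i _ => by ring

lemma lap_rad {N : ℕ} (x0 : EuclideanSpace ℝ (Fin N)) (r : ℝ) {χ : ℝ → ℝ}
    (hχ : ContDiff ℝ ∞ χ) (x) :
    lap (fun x => χ (sf x0 r x)) x = deriv (deriv χ) (sf x0 r x) * (4 / r ^ 2 * ‖x - x0‖ ^ 2)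
      + deriv χ (sf x0 r x) * (2 / r * N) := by
  have c1 : ContDiff ℝ ∞ (deriv χ) := (contDiff_infty_iff_deriv.mp hχ).2
  have e : ∀ i, pd i (fun x => χ (sf x0 r x)) = fun x => deriv χ (sf x0 r x) * (2 / r * (x - x0) i) :=
    fun i => funext fun x => pd_rad i x0 r hχ x
  rw [lap_eq]
  have t : ∀ i, pd i (pd i (fun x => χ (sf x0 r x))) x = 
      deriv (deriv χ) (sf x0 r x) * (4 / r ^ 2 * ((x - x0) i * (x - x0) i)) + deriv χ (sf x0 r x) * (2 / r) := by
    intro i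
    rw [e i]
    have d1 : DifferentiableAt ℝ (fun x => deriv χ (sf x0 r x)) x :=
      diffable (c1.comp (contDiff_sf x0 r)) x
    have d2 : DifferentiableAt ℝ (fun y : EuclideanSpace ℝ (Fin N) => (y - x0) i) x :=
      (contDiff_coord (n := 1) i x0).differentiable (by simp) x
    rw [pd_mul i d1 (d2.const_mul _), pd_rad i x0 r c1, pd_const_mul i _ d2, pd_coord]
    simp
    ring
  simp only [t]
  rw [Finset.sum_add_distrib, norm_sq_coord, ← Finset.mul_sum, ← Finset.mul_sum]
  simp [sq]
  ring

lemma norm_of_sf {N : ℕ} {x0 x : EuclideanSpace ℝ (Fin N)} {r d : ℝ} (hr : 1 ≤ r) (hd : 0 < d)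
    (h : sf x0 r x ≤ 4 * d) : ‖x - x0‖ ≤ r + 2 * d := by
  have hr0 : 0 < r := by linarith
  unfold sf at h
  rw [mul_one_div, div_le_iff₀ hr0] at h
  have : ‖x - x0‖ ^ 2 ≤ (r + 2 * d) ^ 2 := by nlinarith
  exact le_of_sq_le_sq this (by positivity)

lemma rad_tsupport {N : ℕ} (x0 : EuclideanSpace ℝ (Fin N)) {r d : ℝ} (hr : 1 ≤ r) (hd : 0 < d)
    {χ : ℝ → ℝ} {α γ B : ℝ} (h : IsCut χ α γ B) (hγ : γ ≤ 4 * d) :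
    tsupport (fun x => χ (sf x0 r x)) ⊆ closedBall x0 (r + 2 * d) := by
  refine closure_minimal ?_ isClosed_closedBall
  intro x hx
  rw [mem_closedBall, dist_eq_norm]
  refine norm_of_sf hr hd ?_
  by_contra hh
  exact hx (h.zero _ (by linarith))

lemma rad_bounds {N : ℕ} (x0 : EuclideanSpace ℝ (Fin N)) {r d : ℝ} (hr : 1 ≤ r) (hd : 0 < d)
    (hd1 : d ≤ 1)
    {χ : ℝ → ℝ} {α γ B : ℝ} (h : IsCut χ α γ B) (hγ : γ ≤ 4 * d) (x) :
    gsq (fun x => χ (sf x0 r x)) x ≤ 36 * B ^ 2 ∧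
    |lap (fun x => χ (sf x0 r x)) x| ≤ (36 + 2 * N) * B ∧
    (gsq (fun x => χ (sf x0 r x)) x ≠ 0 ∨ lap (fun x => χ (sf x0 r x)) x ≠ 0 →
      α ≤ sf x0 r x ∧ sf x0 r x ≤ γ) := by
  rw [gsq_rad x0 r h.smooth, lap_rad x0 r h.smooth]
  have hB := h.B0
  have hr0 : 0 < r := by linarith
  by_cases hh : sf x0 r x < α ∨ γ < sf x0 r x
  · rw [h.z1 _ hh, h.z2 _ hh]
    refine ⟨by simp; positivity, by simp; positivity, by simp⟩
  · have hh' := hh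
    rw [not_or, not_lt, not_lt] at hh
    have hn := norm_of_sf hr hd (hh.2.trans hγ)
    have hn3 : ‖x - x0‖ ≤ 3 * r := by linarith
    have q0 : 0 ≤ 4 / r ^ 2 * ‖x - x0‖ ^ 2 := by positivity
    have q : 4 / r ^ 2 * ‖x - x0‖ ^ 2 ≤ 36 := by
      rw [div_mul_eq_mul_div, div_le_iff₀ (by positivity)]
      nlinarith [norm_nonneg (x - x0)]
    have b1 := h.b1 (sf x0 r x)
    have b2 := h.b2 (sf x0 r x)
    have b1' : deriv χ (sf x0 r x) ^ 2 ≤ B ^ 2 := by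
      rw [← sq_abs]; exact pow_le_pow_left₀ (abs_nonneg _) b1 2
    refine ⟨?_, ?_, fun _ => hh⟩
    · nlinarith [sq_nonneg B, sq_nonneg (deriv χ (sf x0 r x))]
    · have hN : |2 / r * (N:ℝ)| ≤ 2 * N := by
        rw [abs_of_nonneg (by positivity)]
        have : 2 / r ≤ 2 := by rw [div_le_iff₀ hr0]; linarith
        exact mul_le_mul_of_nonneg_right this N.cast_nonneg
      have hq : |4 / r ^ 2 * ‖x - x0‖ ^ 2| ≤ 36 := by rwa [abs_of_nonneg q0]
      refine (add_bd (mul_bd b2 hq) (mul_bd b1 hN)).trans (le_of_eq (by ring))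

end Aux10

section Aux11
open scoped ContDiff

/-- `m` weight -/
def mw (ts B r τ : ℝ) : ℝ := -(r ^ 2 / (8 * ts)) * Real.log (τ / ts) + B * τ ^ 2 + r ^ 2 / (8 * ts)
def mw1 (ts B r τ : ℝ) : ℝ := -(r ^ 2 / (8 * ts)) / τ + 2 * B * τ
def mw2 (ts B r τ : ℝ) : ℝ := (r ^ 2 / (8 * ts)) / τ ^ 2 + 2 * B

def hw0 (ts τ : ℝ) : ℝ := Real.log (τ / ts) / ts + 1 / τ - 1 / ts

lemma mw_deriv {ts B r τ : ℝ} (hts : 0 < ts) (hτ : 0 < τ) : HasDerivAt (mw ts B r) (mw1 ts B r τ) τ := by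
  unfold mw mw1
  have h1 : HasDerivAt (fun τ => τ / ts) (1 / ts) τ := (hasDerivAt_id' τ).div_const ts
  have h2 := h1.log (by positivity)
  have h3 := ((h2.const_mul (-(r ^ 2 / (8 * ts)))).add ((hasDerivAt_pow 2 τ).const_mul B)).add_const (r ^ 2 / (8 * ts))
  refine h3.congr_deriv ?_
  field_simp
  ring

lemma mw1_deriv {ts B r τ : ℝ} (hτ : 0 < τ) : HasDerivAt (mw1 ts B r) (mw2 ts B r τ) τ := by
  unfold mw1 mw2
  have h2 := (hasDerivAt_inv hτ.ne').const_mul (-(r ^ 2 / (8 * ts)))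
  have h3 := h2.add ((hasDerivAt_id' τ).const_mul (2 * B))
  refine (h3.congr_deriv ?_)
  field_simp

lemma mw_comb {ts B r τ : ℝ} (hτ : 0 < τ) : mw2 ts B r τ + mw1 ts B r τ / τ = 4 * B := by
  unfold mw1 mw2; field_simp; ring

lemma wt_eq {N : ℕ} (x0 x : EuclideanSpace ℝ (Fin N)) {ts B r τ : ℝ} (hts : 0 < ts) (hτ : 0 < τ) :
    Real.exp (2 * mw ts B r τ) * gs x0 τ x
      = Real.exp (2 * B * τ ^ 2 + (r ^ 2 - ‖x - x0‖ ^ 2) / (4 * τ) - r ^ 2 / 4 * hw0 ts τ) := by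
  unfold gs mw hw0
  rw [← Real.exp_add]
  congr 1
  field_simp
  ring

lemma hw0_pos {ts τ : ℝ} (hts : 0 < ts) (hτ : 0 < τ) (hne : τ ≠ ts) : 0 < hw0 ts τ := by
  have h := Real.log_lt_sub_one_of_pos (div_pos hts hτ) (by
    intro h; rw [div_eq_one_iff_eq hτ.ne'] at h; exact hne h.symm)
  have e : Real.log (τ / ts) = - Real.log (ts / τ) := by rw [← Real.log_inv, inv_div]
  have : hw0 ts τ = (ts / τ - 1 - Real.log (ts / τ)) / ts := by
    unfold hw0; rw [e]; field_simp; ring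
  rw [this]
  apply div_pos _ hts
  linarith

lemma hw0_nonneg {ts τ : ℝ} (hts : 0 < ts) (hτ : 0 < τ) : 0 ≤ hw0 ts τ := by
  by_cases h : τ = ts
  · rw [h]; unfold hw0; rw [div_self hts.ne']; simp
  · exact (hw0_pos hts hτ h).le

lemma hw0_le {ts τ : ℝ} (hts : 0 < ts) (hτ : ts ≤ τ) : hw0 ts τ ≤ (τ - ts) ^ 2 / ts ^ 3 := by
  have hτ0 : 0 < τ := by linarith
  have h := Real.log_le_sub_one_of_pos (div_pos hτ0 hts)
  have h1 : hw0 ts τ ≤ (τ / ts - 1) / ts + 1 / τ - 1 / ts := by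
    unfold hw0; gcongr
  refine h1.trans ?_
  have : (τ / ts - 1) / ts + 1 / τ - 1 / ts = (τ - ts) ^ 2 / (ts ^ 2 * τ) := by
    field_simp; ring
  rw [this]
  gcongr
  nlinarith [sq_nonneg ts]

/-- The weight is small in the three error regions. -/
lemma wt_small {N : ℕ} {ts B T d δ1 δ2 T1 X : ℝ} (hts : 0 < ts) (hB : 0 ≤ B) (hd : 0 < d)
    (hδ1 : 0 < δ1) (hδ12 : δ1 ≤ δ2) (hδ2 : δ2 < ts) (hT1 : Real.exp 1 * ts < T1) (hX : 0 ≤ X) :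
    ∃ c2 : ℝ, ∀ r : ℝ, 1 ≤ r → X ≤ r → ∀ (x0 x : EuclideanSpace ℝ (Fin N)) (τ : ℝ), 0 < τ → τ ≤ T →
      (2 * d ≤ sf x0 r x ∨ (τ ∈ Icc δ1 δ2 ∧ r - X ≤ ‖x - x0‖) ∨ T1 ≤ τ) →
      Real.exp (2 * mw ts B r τ) * gs x0 τ x ≤ Real.exp (c2 - d * r / (2 * T)) := by
  have hcont : ContinuousOn (hw0 ts) (Icc δ1 δ2) := by
    unfold hw0
    have h0 : ∀ τ ∈ Icc δ1 δ2, τ ≠ 0 := fun τ h => by linarith [h.1] |> fun (h : 0 < τ) => h.ne'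
    refine ((ContinuousOn.div_const (ContinuousOn.log (by fun_prop) ?_) _).add 
      (ContinuousOn.div continuousOn_const continuousOn_id h0)).sub continuousOn_const
    intro τ h
    exact div_ne_zero (h0 τ h) hts.ne'
  obtain ⟨τm, hτm, hmin⟩ := isCompact_Icc.exists_isMinOn (nonempty_Icc.mpr hδ12) hcont
  set h0 := hw0 ts τm with hh0
  have h0pos : 0 < h0 := hw0_pos hts (by linarith [hτm.1]) (by linarith [hτm.2] |> fun (h : τm < ts) => h.ne)
  set h1 := (Real.log (T1 / ts) - 1) / ts with hh1
  have h1pos : 0 < h1 := by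
    apply div_pos _ hts
    have : 1 < Real.log (T1 / ts) := by
      rw [Real.lt_log_iff_exp_lt (div_pos ((by positivity : 0 < Real.exp 1 * ts).trans hT1) hts)]
      rwa [lt_div_iff₀ hts]
    linarith
  set k := X / (2 * δ1) + |d / (2 * T)| with hk
  have hk0 : 0 ≤ k := by positivity
  -- quadratic bound
  have quad : ∀ h r : ℝ, 0 < h → k * r - r ^ 2 / 4 * h ≤ k ^ 2 / h := by
    intro h r hh
    rw [le_div_iff₀ hh]
    nlinarith [sq_nonneg (r * h / 2 - k)]
  refine ⟨2 * B * T ^ 2 + k ^ 2 / h0 + k ^ 2 / h1, fun r hr hXr x0 x τ hτ hτT hreg => ?_⟩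
  rw [wt_eq x0 x hts hτ, Real.exp_le_exp]
  have hT : 0 < T := by linarith
  have hBT : 2 * B * τ ^ 2 ≤ 2 * B * T ^ 2 := by gcongr
  have q0 : 0 ≤ k ^ 2 / h0 := by positivity
  have q1 : 0 ≤ k ^ 2 / h1 := by positivity
  have hr0 : 0 < r := by linarith
  have hdT : d * r / (2 * T) = |d / (2 * T)| * r := by
    rw [abs_of_pos (by positivity)]; ring
  have hX1 : 0 ≤ X / (2 * δ1) := by positivity
  rcases hreg with hs | ⟨hI, hn⟩ | hR
  · have hh := hw0_nonneg hts hτ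
    have : 0 ≤ r ^ 2 / 4 * hw0 ts τ := by positivity
    unfold sf at hs
    rw [mul_one_div, le_div_iff₀ hr0] at hs
    have : (r ^ 2 - ‖x - x0‖ ^ 2) / (4 * τ) ≤ - (d * r / (2 * T)) := by
      calc (r ^ 2 - ‖x - x0‖ ^ 2) / (4 * τ) ≤ - (2 * d * r) / (4 * τ) := by gcongr; linarith
        _ = - (2 * d * r / (4 * τ)) := by ring
        _ ≤ - (2 * d * r / (4 * T)) := by
          apply neg_le_neg; gcongr
        _ = _ := by field_simp; ring
    linarith
  · have hh : h0 ≤ hw0 ts τ := hmin hI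
    have e1 : r ^ 2 / 4 * h0 ≤ r ^ 2 / 4 * hw0 ts τ := by gcongr
    have e2 : (r ^ 2 - ‖x - x0‖ ^ 2) / (4 * τ) ≤ X / (2 * δ1) * r := by
      have : (r - X) ^ 2 ≤ ‖x - x0‖ ^ 2 := pow_le_pow_left₀ (by linarith) hn 2
      calc (r ^ 2 - ‖x - x0‖ ^ 2) / (4 * τ) ≤ (2 * X * r) / (4 * τ) := by gcongr; nlinarith
        _ ≤ (2 * X * r) / (4 * δ1) := by have := hI.1; gcongr
        _ = _ := by field_simp; ring
    have := quad h0 r h0pos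
    rw [hk] at this q0 q1 ⊢
    rw [hdT]
    linarith
  · have e1 : h1 ≤ hw0 ts τ - 1 / τ := by
      have : hw0 ts τ - 1 / τ = (Real.log (τ / ts) - 1) / ts := by unfold hw0; ring
      rw [this, hh1]
      have : 0 < T1 := (by positivity : 0 < Real.exp 1 * ts).trans hT1
      gcongr
    have e2 : (r ^ 2 - ‖x - x0‖ ^ 2) / (4 * τ) ≤ r ^ 2 / 4 * (1 / τ) := by
      calc (r ^ 2 - ‖x - x0‖ ^ 2) / (4 * τ) ≤ r ^ 2 / (4 * τ) := by gcongr; nlinarith [sq_nonneg ‖x - x0‖]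
        _ = _ := by field_simp
    have e3 : r ^ 2 / 4 * h1 ≤ r ^ 2 / 4 * (hw0 ts τ - 1 / τ) := by gcongr
    have := quad h1 r h1pos
    have e4 : 0 ≤ X / (2 * δ1) * r := by positivity
    rw [hk] at this q0 q1 ⊢
    rw [hdT]
    linarith

/-- The weight is not small on the target. -/
lemma wt_target {N : ℕ} {ts B r r0 : ℝ} (hts : 0 < ts) (hB : 0 ≤ B) (hr : 1 ≤ r) (hr0 : 0 ≤ r0)
    {x0 x : EuclideanSpace ℝ (Fin N)} {τ : ℝ} (hτ : ts ≤ τ) (hτ2 : τ ≤ ts + 1 / r) 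
    (hx : ‖x - x0‖ ≤ r + r0) :
    Real.exp (-(1 / (4 * ts ^ 3) + r0 ^ 2 / (4 * ts)) - r0 * r / (2 * ts)) ≤
      Real.exp (2 * mw ts B r τ) * gs x0 τ x := by
  have hτ0 : 0 < τ := by linarith
  have hrp : 0 < r := by linarith
  rw [wt_eq x0 x hts hτ0, Real.exp_le_exp]
  have h1 := hw0_le hts hτ
  have h2 : (τ - ts) ^ 2 ≤ (1 / r) ^ 2 := pow_le_pow_left₀ (by linarith) (by linarith) 2
  have h3 : r ^ 2 / 4 * hw0 ts τ ≤ 1 / (4 * ts ^ 3) := by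
    calc r ^ 2 / 4 * hw0 ts τ ≤ r ^ 2 / 4 * ((1 / r) ^ 2 / ts ^ 3) := by
          refine mul_le_mul_of_nonneg_left (h1.trans ?_) (by positivity); gcongr
      _ = _ := by field_simp
  have h4 : -(r0 ^ 2 / (4 * ts) + r0 * r / (2 * ts)) ≤ (r ^ 2 - ‖x - x0‖ ^ 2) / (4 * τ) := by
    have : ‖x - x0‖ ^ 2 ≤ (r + r0) ^ 2 := pow_le_pow_left₀ (norm_nonneg _) hx 2
    calc -(r0 ^ 2 / (4 * ts) + r0 * r / (2 * ts)) = -((r0 ^ 2 + 2 * r0 * r) / (4 * ts)) := by field_simp; ring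
      _ ≤ -((r0 ^ 2 + 2 * r0 * r) / (4 * τ)) := by apply neg_le_neg; gcongr
      _ = (-(r0 ^ 2 + 2 * r0 * r)) / (4 * τ) := by ring
      _ ≤ _ := by gcongr; nlinarith
  have h5 : 0 ≤ 2 * B * τ ^ 2 := by positivity
  linarith
end Aux11

section Aux12
open scoped ContDiff

lemma exists_tcut {δ1 δ2 T1 T2 : ℝ} (h1 : δ1 < δ2) (h2 : δ2 < T1) (h3 : T1 < T2) :
    ∃ (η : ℝ → ℝ) (B : ℝ), 0 ≤ B ∧ ContDiff ℝ ∞ η ∧ (∀ t, |η t| ≤ 1) ∧ (∀ t ≤ δ1, η t = 0) ∧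
      (∀ t, T2 ≤ t → η t = 0) ∧ (∀ t ∈ Icc δ2 T1, η t = 1) ∧ (∀ t, |deriv η t| ≤ B) ∧
      (∀ t, deriv η t ≠ 0 → t ∈ Icc δ1 δ2 ∨ T1 ≤ t) := by
  obtain ⟨κ, B1, hκ⟩ := exists_cut h1
  obtain ⟨χ, B2, hχ⟩ := exists_cut h3
  have dκ : ∀ t, DifferentiableAt ℝ κ t := fun t => hκ.smooth.differentiable (by simp) t
  have dχ : ∀ t, DifferentiableAt ℝ χ t := fun t => hχ.smooth.differentiable (by simp) t
  have e : ∀ t, deriv (fun t => (1 - κ t) * χ t) t = -deriv κ t * χ t + (1 - κ t) * deriv χ t := by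
    intro t
    exact (((dκ t).hasDerivAt.const_sub 1).mul (dχ t).hasDerivAt).deriv
  have a1 : ∀ t, |χ t| ≤ 1 := fun t => by rw [abs_of_nonneg (hχ.nonneg t)]; exact hχ.le_one t
  have a2 : ∀ t, |1 - κ t| ≤ 1 := fun t => by
    rw [abs_of_nonneg (by linarith [hκ.le_one t])]; linarith [hκ.nonneg t]
  refine ⟨fun t => (1 - κ t) * χ t, B1 * 1 + 1 * B2, by linarith [hκ.B0, hχ.B0], ?_, ?_, ?_, ?_, ?_, ?_, ?_⟩
  · exact (contDiff_const.sub hκ.smooth).mul hχ.smooth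
  · intro t
    exact (mul_bd (a2 t) (a1 t)).trans (by norm_num)
  · intro t ht; simp [hκ.one t ht]
  · intro t ht; simp [hχ.zero t ht]
  · intro t ht; simp [hκ.zero t ht.1, hχ.one t ht.2]
  · intro t
    rw [e]
    exact add_bd (mul_bd (by rw [abs_neg]; exact hκ.b1 t) (a1 t)) (mul_bd (a2 t) (hχ.b1 t))
  · intro t ht
    by_contra hh
    rw [not_or, mem_Icc, not_and_or, not_le, not_le, not_le] at hh
    apply ht
    rw [e, hκ.z1 t hh.1, hχ.z1 t (Or.inl hh.2)]
    simp

lemma Cls.mono {N : ℕ} {I J : Set ℝ} {Ω : Set (EuclideanSpace ℝ (Fin N))}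
    {u : ℝ → EuclideanSpace ℝ (Fin N) → ℝ} {M : ℝ} (h : Cls I Ω u M) (hJ : J ⊆ I) : Cls J Ω u M :=
  ⟨fun t ht => h.cx t (hJ ht), fun x => (h.ct x).mono hJ, fun t ht => h.bd t (hJ ht), fun t ht => h.off t (hJ ht)⟩

lemma Cls.int {N : ℕ} {I : Set ℝ} {Ω : Set (EuclideanSpace ℝ (Fin N))} (hΩ : IsOpen Ω)
    {u : ℝ → EuclideanSpace ℝ (Fin N) → ℝ} {M : ℝ} (h : Cls I Ω u M) {t : ℝ} (ht : t ∈ I)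
    {φ : EuclideanSpace ℝ (Fin N) → ℝ} (hφ : Continuous φ) (hc : HasCompactSupport φ) :
    Integrable fun x => u t x * φ x := by
  have h1 : Integrable φ := hφ.integrable_of_hasCompactSupport hc
  exact h1.bdd_mul (h.aesm hΩ ht) (Eventually.of_forall fun x => h.bd t ht x)

lemma Cls.cut {N : ℕ} {I : Set ℝ} {Ω : Set (EuclideanSpace ℝ (Fin N))}
    {u : ℝ → EuclideanSpace ℝ (Fin N) → ℝ} {M B : ℝ} (h : Cls I Ω u M) {η : ℝ → ℝ}
    (hη : Continuous η) (hb : ∀ t, |η t| ≤ B) : Cls I Ω (fun t x => η t * u t x) (B * M) :=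
  ⟨fun t ht => continuousOn_const.mul (h.cx t ht), fun x => hη.continuousOn.mul (h.ct x),
    fun t ht x => mul_bd (hb t) (h.bd t ht x), fun t ht x hx => by simp [h.off t ht x hx]⟩

lemma Cls.add {N : ℕ} {I : Set ℝ} {Ω : Set (EuclideanSpace ℝ (Fin N))}
    {u v : ℝ → EuclideanSpace ℝ (Fin N) → ℝ} {M M' : ℝ} (h : Cls I Ω u M) (h' : Cls I Ω v M') :
    Cls I Ω (fun t x => u t x + v t x) (M + M') :=
  ⟨fun t ht => (h.cx t ht).add (h'.cx t ht), fun x => (h.ct x).add (h'.ct x),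
    fun t ht x => add_bd (h.bd t ht x) (h'.bd t ht x), fun t ht x hx => by simp [h.off t ht x hx, h'.off t ht x hx]⟩

lemma weak_cut {N : ℕ} {I : Set ℝ} {Ω : Set (EuclideanSpace ℝ (Fin N))} (hΩ : IsOpen Ω)
    {u f : ℝ → EuclideanSpace ℝ (Fin N) → ℝ} {M M' : ℝ} (hu : Cls I Ω u M) (hf : Cls I Ω f M')
    (hw : WeakB I Ω u f) {η : ℝ → ℝ} (hη : Differentiable ℝ η) :
    WeakB I Ω (fun t x => η t * u t x) (fun t x => η t * f t x + deriv η t * u t x) := by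
  intro φ hφ t ht
  have h := (hη t).hasDerivAt.mul (hw φ hφ t ht)
  have i1 := hu.int hΩ ht hφ.smooth.continuous hφ.cpt
  have i2 := hf.int hΩ ht hφ.smooth.continuous hφ.cpt
  have e : (fun t => ∫ x, η t * u t x * φ x) = fun t => η t * ∫ x, u t x * φ x := by
    ext t; rw [← integral_const_mul]; simp only [mul_assoc]
  simp only [add_mul, mul_assoc] at e ⊢
  rw [e]
  refine h.congr_deriv ?_
  rw [integral_add (i2.const_mul _) (i1.const_mul _), integral_const_mul, integral_const_mul, integral_const_mul]
  ring

lemma cont_int_gs {N : ℕ} (x0 : EuclideanSpace ℝ (Fin N)) {a b : ℝ} (ha : 0 < a)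
    {Ω : Set (EuclideanSpace ℝ (Fin N))}
    (hΩ : IsOpen Ω) {h : ℝ → EuclideanSpace ℝ (Fin N) → ℝ} {M : ℝ}
    (hh : Cls (Ioo a b) Ω h M)
    {θ : EuclideanSpace ℝ (Fin N) → ℝ} 
    (hθ : Continuous θ) (hθc : HasCompactSupport θ) :
    ContinuousOn (fun τ => ∫ x, gs x0 τ x * (θ x * h τ x) ^ 2) (Ioo a b) ∧
    ∀ τ ∈ Ioo a b, Integrable (fun x => gs x0 τ x * (θ x * h τ x) ^ 2) := by
  have hSm : MeasurableSet (tsupport θ) := (isClosed_tsupport θ).measurableSet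
  have hSf : volume (tsupport θ) < ⊤ := hθc.measure_lt_top
  have z : ∀ x, x ∉ tsupport θ → θ x = 0 := fun x h => image_eq_zero_of_notMem_tsupport h
  obtain ⟨Ct, hCt0, hCt⟩ := test_bd hθ hθc
  have hm : ∀ t ∈ Ioo a b, AEStronglyMeasurable (fun x => gs x0 t x * (θ x * h t x) ^ 2) volume := by
    intro t ht
    have k1 := (contDiff_gs x0 t).continuous
    exact k1.aestronglyMeasurable.mul ((hθ.aestronglyMeasurable.mul (hh.aesm hΩ ht)).pow 2)
  have hz : ∀ t ∈ Ioo a b, ∀ x, x ∉ tsupport θ → gs x0 t x * (θ x * h t x) ^ 2 = 0 := by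
    intro t ht x hx; simp [z x hx]
  have hb : ∀ t ∈ Ioo a b, ∀ x ∈ tsupport θ, |gs x0 t x * (θ x * h t x) ^ 2| ≤ 1 * (Ct * M) ^ 2 := by
    intro t ht x hx
    refine mul_bd ?_ ?_
    · rw [abs_of_pos (gs_pos _ _ _)]; exact gs_le_one x0 (ha.trans ht.1) x
    · rw [abs_pow]; exact pow_le_pow_left₀ (abs_nonneg _) (mul_bd (hCt x) (hh.bd t ht x)) 2
  refine ⟨contInt hSm hSf (C := 1 * (Ct * M) ^ 2) hm hz hb ?_, fun t ht => integrable_bdd hSm hSf (hm t ht) (hz t ht) (hb t ht)⟩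
  intro x hx
  have := hh.ct x
  have := contAtCont_gs (b := b) x0 x ha
  fun_prop

end Aux12

section Aux13
open scoped ContDiff

lemma bu_upper {N : ℕ} (x0 : EuclideanSpace ℝ (Fin N)) {a b τ1 τ2 : ℝ} (ha : 0 < a)
    (h1 : a < τ1) (h12 : τ1 ≤ τ2) (h2 : τ2 < b)
    {Ω S : Set (EuclideanSpace ℝ (Fin N))}
    (hΩ : IsOpen Ω) {u f : ℝ → EuclideanSpace ℝ (Fin N) → ℝ} {M M' C C1 C2 Cθ Kc Bη ts r : ℝ}
    (hts : 0 < ts)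
    (hu : Cls (Ioo a b) Ω u M)
    (hf : Cls (Ioo a b) Ω f M') (hw : WeakB (Ioo a b) Ω u f)
    (hfu : ∀ t ∈ Ioo a b, ∀ x, |f t x| ≤ C * |u t x|)
    {η : ℝ → ℝ} (hη : ContDiff ℝ ∞ η) (hη1 : ∀ t, |η t| ≤ 1) (hη' : ∀ t, |deriv η t| ≤ Bη)
    (hu1 : η τ1 = 0) (hu2 : η τ2 = 0)
    {β θ : EuclideanSpace ℝ (Fin N) → ℝ}
    (hSc : IsCompact S) (hSΩ : S ⊆ Ω)
    (hβ : ContDiff ℝ ∞ β) (hβc : HasCompactSupport β) (hβS : tsupport β ⊆ S)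
    (hβ0 : ∀ x, 0 ≤ β x) (hβ1 : ∀ x, β x ≤ 1) (hC2 : ∀ x, |lap β x| ≤ C2)
    (hθ : ContDiff ℝ ∞ θ) (hθc : HasCompactSupport θ) (hθS : tsupport θ ⊆ S)
    (hθ1 : ∀ x, |θ x| ≤ 1)
    (hCθ0 : 0 ≤ Cθ) (hCθ : ∀ x, gsq θ x ≤ Cθ * β x) (hC1 : ∀ x, |lap θ x| ≤ C1)
    (hK0 : 0 ≤ Kc)
    (hK : ∀ τ ∈ Icc τ1 τ2, ∀ x, (gsq θ x ≠ 0 ∨ lap θ x ≠ 0) →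
      Real.exp (2 * mw ts (C ^ 2 + 1 / 4) r τ) * gs x0 τ x ≤ Kc)
    (hK' : ∀ τ ∈ Icc τ1 τ2, ∀ x, deriv η τ ≠ 0 → u τ x ≠ 0 →
      Real.exp (2 * mw ts (C ^ 2 + 1 / 4) r τ) * gs x0 τ x ≤ Kc) :
    ∫ τ in τ1..τ2, Real.exp (2 * mw ts (C ^ 2 + 1 / 4) r τ) *
        ∫ x, gs x0 τ x * (θ x * (η τ * u τ x)) ^ 2
      ≤ Kc * ((τ2 - τ1) * volume.real S * (4 * (Bη * M) ^ 2 + 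
        (8 * Cθ * ((1 * M) ^ 2 * C2 + 2 * (1 * M) * (1 * M' + Bη * M)) + 4 * (1 * M) ^ 2 * C1 ^ 2))) := by
  set Bc := C ^ 2 + 1 / 4 with hBc
  have hpos : ∀ τ ∈ Ioo a b, 0 < τ := fun τ h => by linarith [h.1]
  have hsub : Icc τ1 τ2 ⊆ Ioo a b := fun τ h => ⟨by linarith [h.1], by linarith [h.2]⟩
  have cu := hu.cut hη.continuous hη1
  have hd : Continuous (deriv η) := hη.continuous_deriv (by simp)
  have cF := (hf.cut hη.continuous hη1).add (hu.cut hd hη')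
  have W := weak_cut hΩ hu hf hw (hη.differentiable (by simp))
  have hm2 : ContinuousOn (mw2 ts Bc r) (Ioo a b) := by
    unfold mw2
    refine ContinuousOn.add (ContinuousOn.div continuousOn_const (by fun_prop) ?_) continuousOn_const
    intro τ h; have := hpos τ h; positivity
  have mas := master x0 ha h1 h12 h2 hΩ cu cF W (by simp [hu1]) (by simp [hu2]) hSc hSΩ hβ hβc hβS hβ0 hβ1 hC2
    hθ hθc hθS hCθ0 hCθ hC1 (m := mw ts Bc r) (fun τ h => mw_deriv hts (hpos τ h))
    (fun τ h => mw1_deriv (hpos τ h)) hm2 hK0 hK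
  obtain ⟨k1, i1⟩ := cont_int_gs x0 ha hΩ cu hθ.continuous hθc
  obtain ⟨k2, i2⟩ := cont_int_gs x0 ha hΩ cF hθ.continuous hθc
  have hmc : ContinuousOn (fun τ => Real.exp (2 * mw ts Bc r τ)) (Ioo a b) := by
    refine Real.continuous_exp.comp_continuousOn (continuousOn_const.mul ?_)
    exact fun τ h => (mw_deriv hts (hpos τ h)).continuousAt.continuousWithinAt
  set A : ℝ → ℝ := fun τ => Real.exp (2 * mw ts Bc r τ) * ∫ x, gs x0 τ x * (θ x * (η τ * u τ x)) ^ 2 with hA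
  set Q : ℝ → ℝ := fun τ => Real.exp (2 * mw ts Bc r τ) * 
    ∫ x, gs x0 τ x * (θ x * (η τ * f τ x + deriv η τ * u τ x)) ^ 2 with hQ
  have cA : ContinuousOn A (uIcc τ1 τ2) := by
    rw [uIcc_of_le h12]; exact (hmc.mul k1).mono hsub
  have cQ : ContinuousOn Q (uIcc τ1 τ2) := by
    rw [uIcc_of_le h12]; exact (hmc.mul k2).mono hsub
  have iA : IntervalIntegrable A volume τ1 τ2 := cA.intervalIntegrable
  have iQ : IntervalIntegrable Q volume τ1 τ2 := cQ.intervalIntegrable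
  have e1 : ∫ τ in τ1..τ2, (Real.exp (2 * mw ts Bc r τ) * (mw2 ts Bc r τ + mw1 ts Bc r τ / τ)) *
        ∫ x, gs x0 τ x * (θ x * (η τ * u τ x)) ^ 2 = 4 * Bc * ∫ τ in τ1..τ2, A τ := by
    rw [← intervalIntegral.integral_const_mul]
    apply intervalIntegral.integral_congr
    intro τ h
    rw [uIcc_of_le h12] at h
    simp only [hA]
    rw [mw_comb (hpos τ (hsub h))]; ring
  have e2 : ∫ τ in τ1..τ2, Q τ ≤ ∫ τ in τ1..τ2, (2 * C ^ 2 * A τ + 2 * Kc * (Bη * M) ^ 2 * volume.real S) := by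
    refine intervalIntegral.integral_mono_on h12 iQ ((iA.const_mul _).add intervalIntegrable_const) ?_
    intro τ hτ
    have hτ' := hsub hτ
    simp only [hA, hQ]
    have hSf : volume S < ⊤ := hSc.measure_lt_top
    have iS : Integrable (S.indicator (fun _ : EuclideanSpace ℝ (Fin N) => 2 * Kc * (Bη * M) ^ 2)) := by
      rw [integrable_indicator_iff hSc.measurableSet]
      exact integrableOn_const (hs := hSf.ne)
    have hE := (Real.exp_pos (2 * mw ts Bc r τ)).le
    have : 2 * C ^ 2 * (Real.exp (2 * mw ts Bc r τ) * ∫ x, gs x0 τ x * (θ x * (η τ * u τ x)) ^ 2) + 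
       2 * Kc * (Bη * M) ^ 2 * volume.real S = ∫ x, (2 * C ^ 2 * Real.exp (2 * mw ts Bc r τ) * (gs x0 τ x * (θ x * (η τ * u τ x)) ^ 2) + S.indicator (fun _ : EuclideanSpace ℝ (Fin N) => 2 * Kc * (Bη * M) ^ 2) x) := by
      rw [integral_add ((i1 τ hτ').const_mul _) iS, integral_const_mul, integral_indicator_const _ hSc.measurableSet, smul_eq_mul]
      ring
    rw [this, ← integral_const_mul]
    refine integral_mono ((i2 τ hτ').const_mul _) (((i1 τ hτ').const_mul _).add iS) ?_
    intro x
    simp only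
    have g0 := (gs_pos x0 τ x).le
    by_cases hx : x ∈ S
    · rw [indicator_of_mem hx]
      have p1 : (θ x * (η τ * f τ x + deriv η τ * u τ x)) ^ 2 ≤ 2 * C ^ 2 * (θ x * (η τ * u τ x)) ^ 2 
         + 2 * (θ x * (deriv η τ * u τ x)) ^ 2 := by
        have q1 : (f τ x) ^ 2 ≤ C ^ 2 * (u τ x) ^ 2 := by
          rw [← sq_abs, ← sq_abs (u τ x), ← mul_pow]
          exact pow_le_pow_left₀ (abs_nonneg _) (hfu τ hτ' x) 2
        have q2 : (θ x * η τ * f τ x) ^ 2 ≤ (θ x * η τ) ^ 2 * (C ^ 2 * (u τ x) ^ 2) := by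
          rw [mul_pow]; gcongr
        nlinarith [sq_nonneg (θ x * η τ * f τ x - θ x * (deriv η τ * u τ x))]
      have p2 : Real.exp (2 * mw ts Bc r τ) * gs x0 τ x * (θ x * (deriv η τ * u τ x)) ^ 2 ≤ Kc * (Bη * M) ^ 2 := by
        have q3 : (θ x * (deriv η τ * u τ x)) ^ 2 ≤ (Bη * M) ^ 2 := by
          have := mul_bd (hθ1 x) (mul_bd (hη' τ) (hu.bd τ hτ' x))
          rw [one_mul] at this
          exact sq_le_sq' (neg_le_of_abs_le this) (le_of_abs_le this)
        by_cases hz : deriv η τ ≠ 0 ∧ u τ x ≠ 0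
        · exact mul_le_mul (hK' τ hτ x hz.1 hz.2) q3 (sq_nonneg _) hK0
        · have : deriv η τ * u τ x = 0 := by
            rw [mul_eq_zero]; tauto
          rw [this]; simp; positivity
      calc _ ≤ Real.exp (2 * mw ts Bc r τ) * (gs x0 τ x * (2 * C ^ 2 * (θ x * (η τ * u τ x)) ^ 2 
         + 2 * (θ x * (deriv η τ * u τ x)) ^ 2)) := by gcongr
        _ ≤ _ := by linarith
    · have : θ x = 0 := image_eq_zero_of_notMem_tsupport (fun h => hx (hθS h))
      simp [this, hx]
  have e3 : ∫ τ in τ1..τ2, (2 * C ^ 2 * A τ + 2 * Kc * (Bη * M) ^ 2 * volume.real S) =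
      2 * C ^ 2 * (∫ τ in τ1..τ2, A τ) + (τ2 - τ1) * (2 * Kc * (Bη * M) ^ 2 * volume.real S) := by
    rw [intervalIntegral.integral_add (iA.const_mul _) intervalIntegrable_const, 
      intervalIntegral.integral_const_mul, intervalIntegral.integral_const, smul_eq_mul]
  rw [e1] at mas
  rw [e3] at e2
  have : (∫ τ in τ1..τ2, A τ) = 4 * Bc * (∫ τ in τ1..τ2, A τ) - 4 * C ^ 2 * ∫ τ in τ1..τ2, A τ := by
    rw [hBc]; ring
  rw [this]
  linarith
end Aux13

section Aux14
open scoped ContDiff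

lemma growth_contra {c0 K a1 a2 rs : ℝ} (n : ℕ) (hc : 0 < c0) (ha : a1 < a2)
    (h : ∀ r, rs ≤ r → c0 * Real.exp (-(a1 * r)) ≤ K * r ^ n * Real.exp (-(a2 * r))) : False := by
  have h1 : ∀ r, rs ≤ r → c0 ≤ K * (r ^ n * Real.exp (-(a2 - a1) * r)) := by
    intro r hr
    have := mul_le_mul_of_nonneg_right (h r hr) (Real.exp_pos (a1 * r)).le
    rw [mul_assoc, ← Real.exp_add, neg_add_cancel, Real.exp_zero, mul_one, mul_assoc, ← Real.exp_add] at this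
    rw [← mul_assoc]
    rw [show -(a2 - a1) * r = -(a2 * r) + a1 * r by ring]
    exact this
  have h2 : Tendsto (fun r : ℝ => r ^ n * Real.exp (-(a2 - a1) * r)) atTop (𝓝 0) := by
    have := tendsto_rpow_mul_exp_neg_mul_atTop_nhds_zero (n : ℝ) (a2 - a1) (by linarith)
    simpa using this
  have h3 := h2.const_mul K
  rw [mul_zero] at h3
  have := ge_of_tendsto h3 (eventually_atTop.mpr ⟨rs, h1⟩)
  linarith

lemma bu_lower {N : ℕ} {a b ts r0 : ℝ} (hts : ts ∈ Ioo a b)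
    {Ω : Set (EuclideanSpace ℝ (Fin N))} (hΩ : IsOpen Ω) {u : ℝ → EuclideanSpace ℝ (Fin N) → ℝ} {M : ℝ}
    (hu : Cls (Ioo a b) Ω u M) {y0 : EuclideanSpace ℝ (Fin N)} (hy0 : y0 ∈ Ω) (hne : u ts y0 ≠ 0) (hr0 : 0 < r0) :
    ∃ r, 0 < r ∧ r ≤ r0 ∧ ∃ q κ, 0 < q ∧ 0 < κ ∧ ∀ τ ∈ Icc ts (ts + κ), τ ∈ Ioo a b ∧
      q ≤ ∫ x in closedBall y0 r, (u τ x) ^ 2 := by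
  have hc : ContinuousAt (u ts) y0 := (hu.cx ts hts).continuousAt (hΩ.mem_nhds hy0)
  have hev : ∀ᶠ x in 𝓝 y0, (u ts y0) ^ 2 / 2 < (u ts x) ^ 2 := by
    have : 0 < (u ts y0) ^ 2 := by positivity
    exact (hc.pow 2).eventually (lt_mem_nhds (show (u ts y0) ^ 2 / 2 < (u ts y0) ^ 2 by linarith))
  obtain ⟨r', hr', hb⟩ := Metric.eventually_nhds_iff_ball.mp hev
  set r := min r0 (r' / 2) with hr
  have hrp : 0 < r := lt_min hr0 (by linarith)
  have hm : ∀ t ∈ Ioo a b, AEStronglyMeasurable ((closedBall y0 r).indicator (fun x => (u t x) ^ 2)) volume :=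
    fun t ht => ((hu.aesm hΩ ht).pow 2).indicator measurableSet_closedBall
  have hbd : ∀ t ∈ Ioo a b, ∀ x ∈ closedBall y0 r, |(closedBall y0 r).indicator (fun x => (u t x) ^ 2) x| ≤ M ^ 2 := by
    intro t ht x hx
    rw [indicator_of_mem hx, abs_pow]
    exact pow_le_pow_left₀ (abs_nonneg _) (hu.bd t ht x) 2
  have hcq : ContinuousOn (fun τ => ∫ x, (closedBall y0 r).indicator (fun x => (u τ x) ^ 2) x) (Ioo a b) := by
    refine contInt (S := closedBall y0 r) measurableSet_closedBall measure_closedBall_lt_top hm 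
      (fun t ht x hx => by simp [hx]) hbd ?_
    intro x hx
    simp only [indicator_of_mem hx]
    exact (hu.ct x).pow 2
  have hq : 0 < ∫ x, (closedBall y0 r).indicator (fun x => (u ts x) ^ 2) x := by
    have h1 : ∫ x, (closedBall y0 r).indicator (fun _ => (u ts y0) ^ 2 / 2) x ≤ 
        ∫ x, (closedBall y0 r).indicator (fun x => (u ts x) ^ 2) x := by
      refine integral_mono ?_ (integrable_bdd (S := closedBall y0 r) measurableSet_closedBall measure_closedBall_lt_top (hm ts hts) 
        (fun x hx => by simp [hx]) (hbd ts hts)) ?_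
      · rw [integrable_indicator_iff measurableSet_closedBall]
        exact integrableOn_const (hs := measure_closedBall_lt_top.ne)
      · intro x
        by_cases hx : x ∈ closedBall y0 r
        · rw [indicator_of_mem hx, indicator_of_mem hx]
          refine (hb x ?_).le
          rw [mem_closedBall] at hx; rw [mem_ball]
          have := min_le_right r0 (r' / 2)
          linarith
        · rw [indicator_of_notMem hx, indicator_of_notMem hx]
    rw [integral_indicator_const _ measurableSet_closedBall] at h1
    refine lt_of_lt_of_le ?_ h1
    rw [smul_eq_mul]
    have : 0 < volume.real (closedBall y0 r) := by
      rw [measureReal_def, ENNReal.toReal_pos_iff]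
      exact ⟨measure_closedBall_pos volume y0 hrp, measure_closedBall_lt_top⟩
    positivity
  set q0 := ∫ x, (closedBall y0 r).indicator (fun x => (u ts x) ^ 2) x with hq0
  have hev2 : ∀ᶠ τ in 𝓝 ts, τ ∈ Ioo a b ∧ q0 / 2 < ∫ x, (closedBall y0 r).indicator (fun x => (u τ x) ^ 2) x := by
    have o : Ioo a b ∈ 𝓝 ts := isOpen_Ioo.mem_nhds hts
    have := (hcq.continuousAt o).eventually (lt_mem_nhds (show q0 / 2 < q0 by linarith))
    filter_upwards [o, this] with τ h1 h2 using ⟨h1, h2⟩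
  obtain ⟨κ, hκ, hb2⟩ := Metric.eventually_nhds_iff_ball.mp hev2
  refine ⟨r, hrp, min_le_left _ _, q0 / 2, κ / 2, by linarith, by linarith, ?_⟩
  intro τ hτ
  have := hb2 τ (by rw [mem_ball, Real.dist_eq, abs_of_nonneg (by linarith [hτ.1])]; linarith [hτ.2])
  refine ⟨this.1, ?_⟩
  rw [← integral_indicator measurableSet_closedBall]
  exact this.2.le

end Aux14

section Aux15
open scoped ContDiff

lemma halfspace_geo {N : ℕ} {e y0 : EuclideanSpace ℝ (Fin N)} (he : ‖e‖ = 1) (r : ℝ) (x : EuclideanSpace ℝ (Fin N)) :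
    ⟪e, y0⟫ + r - ⟪e, x⟫ ≤ ‖x - (y0 + r • e)‖ := by
  have h1 := real_inner_le_norm e (y0 + r • e - x)
  rw [he, one_mul, norm_sub_rev] at h1
  rw [inner_sub_right, inner_add_right, inner_smul_right, real_inner_self_eq_norm_sq, he] at h1
  linarith

set_option maxHeartbeats 1000000 in
theorem bu {N : ℕ} {e : EuclideanSpace ℝ (Fin N)} (he : ‖e‖ = 1) {c T M M' C δ X ts : ℝ}
    {u f : ℝ → EuclideanSpace ℝ (Fin N) → ℝ}
    (hu : Cls (Ioo 0 T) {x | c < ⟪e, x⟫} u M) (hf : Cls (Ioo 0 T) {x | c < ⟪e, x⟫} f M')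
    (hfu : ∀ t ∈ Ioo 0 T, ∀ x, |f t x| ≤ C * |u t x|)
    (hw : WeakB (Ioo 0 T) {x | c < ⟪e, x⟫} u f) (hδ : 0 < δ)
    (h0 : ∀ t ∈ Ioo 0 T, t ≤ δ → ∀ x, X < ⟪e, x⟫ → u t x = 0) (hts : 0 < ts) (htT : Real.exp 1 * ts < T)
    {y0 : EuclideanSpace ℝ (Fin N)} (hy0 : c < ⟪e, y0⟫) : u ts y0 = 0 := by
  by_contra hne
  have hexp : 2 < Real.exp 1 := by linarith [Real.exp_one_gt_d9]
  have htsT : ts < T := by nlinarith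
  have hT : 0 < T := by linarith
  set Ω := {x : EuclideanSpace ℝ (Fin N) | c < ⟪e, x⟫} with hΩd
  have hΩ : IsOpen Ω := isOpen_lt continuous_const (by fun_prop)
  obtain ⟨T1, hT1, hT1'⟩ := exists_between htT
  obtain ⟨T2, hT2, hT2'⟩ := exists_between hT1'
  have htsT1 : ts < T1 := by nlinarith
  set δ2 := min δ ts / 2 with hδ2
  have hδ2_p : 0 < δ2 := by have := lt_min hδ hts; linarith
  have hδ2_ts : δ2 < ts := by have := min_le_right δ ts; linarith
  have hδ2δ : δ2 ≤ δ := by have := min_le_left δ ts; linarith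
  set δ1 := δ2 / 2 with hδ1
  have hδ1_p : 0 < δ1 := by linarith
  set X' := max 0 (X - ⟪e, y0⟫) with hX'
  have hX0 : 0 ≤ X' := le_max_left _ _
  have hX1 : X - ⟪e, y0⟫ ≤ X' := le_max_right _ _
  set d := min 1 ((⟪e, y0⟫ - c) / 4) with hd
  have hdp : 0 < d := lt_min one_pos (by linarith)
  have hd1 : d ≤ 1 := min_le_left _ _
  have hd2 : d ≤ (⟪e, y0⟫ - c) / 4 := min_le_right _ _
  set a := δ1 / 2 with ha
  have hap : 0 < a := by linarith
  have hIs : Ioo a T ⊆ Ioo 0 T := Ioo_subset_Ioo hap.le le_rfl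
  obtain ⟨r0, hr0, hr0', q, κ, hq, hκ, hlow⟩ := bu_lower (show ts ∈ Ioo a T from ⟨by linarith, htsT⟩) hΩ
    (hu.mono hIs) hy0 hne (r0 := d * ts / (2 * T)) (by positivity)
  have hr0d : r0 ≤ d / 2 := hr0'.trans (by
    rw [div_le_div_iff₀ (by positivity) (by positivity)]; nlinarith)
  obtain ⟨η, Bη, hBη, hη, hη1, hηa, hηb, hηo, hη', hηs⟩ := exists_tcut (show δ1 < δ2 by linarith) 
    (show δ2 < T1 by linarith) hT2
  obtain ⟨χ0, B0, hχ0⟩ := exists_cut (show 2 * d < 3 * d by linarith)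
  obtain ⟨χ1, B1, hχ1⟩ := exists_cut (show 3 * d < 4 * d by linarith)
  have hBc : 0 ≤ C ^ 2 + 1 / 4 := by positivity
  obtain ⟨c2, hc2⟩ := wt_small (N := N) (T := T) hts hBc hdp hδ1_p (show δ1 ≤ δ2 by linarith) hδ2_ts hT1 hX0
  set P := (4 * (Bη * M) ^ 2 + 
        (8 * (36 * B0 ^ 2) * ((1 * M) ^ 2 * ((36 + 2 * N) * B1) + 2 * (1 * M) * (1 * M' + Bη * M)) + 4 * (1 * M) ^ 2 * ((36 + 2 * N) * B0) ^ 2)) with hP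
  set c1 := 1 / (4 * ts ^ 3) + r0 ^ 2 / (4 * ts) with hc1
  have hT2δ : δ1 ≤ T2 := by linarith
  have key : ∀ r, max 1 (max X' (max (1 / κ) (1 / (T1 - ts)))) ≤ r → 
      (1 / r) * (Real.exp (-c1 - r0 * r / (2 * ts)) * q) ≤ 
      Real.exp (c2 - d * r / (2 * T)) * ((T2 - δ1) * volume.real (closedBall (y0 + r • e) (r + 2 * d)) * P) := by
    intro r hr
    simp only [max_le_iff] at hr
    obtain ⟨hr1, hrX, hrκ, hrT⟩ := hr
    have hrp : 0 < r := by linarith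
    set x0 := y0 + r • e with hx0
    have hSΩ : closedBall x0 (r + 2 * d) ⊆ Ω := by
      intro x hx
      rw [mem_closedBall, dist_eq_norm] at hx
      have := halfspace_geo (y0 := y0) he r x
      show c < ⟪e, x⟫
      linarith
    have hcpt : ∀ {χ : ℝ → ℝ} {α γ B : ℝ}, IsCut χ α γ B → γ ≤ 4 * d → 
        HasCompactSupport (fun x => χ (sf x0 r x)) := fun h hγ =>
      (isCompact_closedBall x0 (r + 2 * d)).of_isClosed_subset (isClosed_tsupport _) (rad_tsupport x0 hr1 hdp h hγ)
    have h3 : 3 * d ≤ 4 * d := by linarith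
    have up := bu_upper x0 hap (show a < δ1 by linarith) hT2δ hT2' hΩ hts (hu.mono hIs) (hf.mono hIs) 
      (fun φ hφ t ht => hw φ hφ t (hIs ht)) (fun t ht => hfu t (hIs ht)) hη hη1 hη' (hηa δ1 le_rfl) (hηb T2 le_rfl)
      (β := fun x => χ1 (sf x0 r x)) (θ := fun x => χ0 (sf x0 r x))
      (isCompact_closedBall x0 (r + 2 * d)) hSΩ (hχ1.smooth.comp (contDiff_sf x0 r)) (hcpt hχ1 le_rfl)
      (rad_tsupport x0 hr1 hdp hχ1 le_rfl) (fun x => hχ1.nonneg _) (fun x => hχ1.le_one _) 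
      (fun x => (rad_bounds x0 hr1 hdp hd1 hχ1 le_rfl x).2.1)
      (hχ0.smooth.comp (contDiff_sf x0 r)) (hcpt hχ0 h3)
      (rad_tsupport x0 hr1 hdp hχ0 h3) 
      (fun x => by rw [abs_of_nonneg (hχ0.nonneg _)]; exact hχ0.le_one _) 
      (show 0 ≤ 36 * B0 ^ 2 by positivity) ?_ 
      (fun x => (rad_bounds x0 hr1 hdp hd1 hχ0 h3 x).2.1) (Real.exp_pos (c2 - d * r / (2 * T))).le
      (r := r) ?_ ?_
    · refine le_trans ?_ up
      clear up
      set θ := fun x => χ0 (sf x0 r x) with hθ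
      have hθs : ContDiff ℝ ∞ θ := hχ0.smooth.comp (contDiff_sf x0 r)
      obtain ⟨k1, i1⟩ := cont_int_gs x0 hap hΩ ((hu.mono hIs).cut hη.continuous hη1) hθs.continuous (hcpt hχ0 h3)
      have hmc : ContinuousOn (fun τ => Real.exp (2 * mw ts (C ^ 2 + 1 / 4) r τ)) (Ioo a T) := by
        refine Real.continuous_exp.comp_continuousOn (continuousOn_const.mul ?_)
        exact fun τ h => (mw_deriv hts (by linarith [h.1])).continuousAt.continuousWithinAt
      set A : ℝ → ℝ := fun τ => Real.exp (2 * mw ts (C ^ 2 + 1 / 4) r τ) * ∫ x, gs x0 τ x * (θ x * (η τ * u τ x)) ^ 2 with hA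
      have cA : ContinuousOn A (Ioo a T) := hmc.mul k1
      have hA0 : ∀ τ, 0 ≤ A τ := fun τ => mul_nonneg (Real.exp_pos _).le 
        (integral_nonneg fun x => mul_nonneg (gs_pos x0 τ x).le (sq_nonneg _))
      have hr1' : 0 < 1 / r := by positivity
      have hrκ' : 1 / r ≤ κ := by rw [one_div_le hrp hκ]; exact hrκ
      have hrT' : 1 / r ≤ T1 - ts := by rw [one_div_le hrp (by linarith)]; exact hrT
      have iA : IntervalIntegrable A volume δ1 T2 := by
        apply ContinuousOn.intervalIntegrable
        rw [uIcc_of_le hT2δ]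
        exact cA.mono fun τ h => ⟨by linarith [h.1], by linarith [h.2]⟩
      have iA2 : IntervalIntegrable A volume ts (ts + 1 / r) := by
        apply ContinuousOn.intervalIntegrable
        rw [uIcc_of_le (by linarith)]
        exact cA.mono fun τ h => ⟨by linarith [h.1], by linarith [h.2]⟩
      have s1 : ∫ τ in ts..(ts + 1 / r), A τ ≤ ∫ τ in δ1..T2, A τ := by
        refine intervalIntegral.integral_mono_interval (by linarith) (by linarith) (by linarith) 
          (Eventually.of_forall hA0) iA
      refine le_trans ?_ s1
      have s2 : ∫ τ in ts..(ts + 1 / r), (Real.exp (-c1 - r0 * r / (2 * ts)) * q) = 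
          (1 / r) * (Real.exp (-c1 - r0 * r / (2 * ts)) * q) := by
        rw [intervalIntegral.integral_const, smul_eq_mul]; ring
      rw [← s2]
      refine intervalIntegral.integral_mono_on (by linarith) intervalIntegrable_const iA2 ?_
      intro τ hτ
      obtain ⟨hτI, hτq⟩ := hlow τ ⟨hτ.1, by linarith [hτ.2]⟩
      set Lc := Real.exp (-c1 - r0 * r / (2 * ts)) with hLc
      refine (mul_le_mul_of_nonneg_left hτq (Real.exp_pos _).le).trans ?_
      simp only [hA]
      rw [← integral_const_mul, ← integral_const_mul, ← integral_indicator measurableSet_closedBall]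
      refine integral_mono ?_ ((i1 τ hτI).const_mul _) ?_
      · refine integrable_bdd (S := closedBall y0 r0) (C := |Lc| * M ^ 2) measurableSet_closedBall measure_closedBall_lt_top 
          ((((hu.mono hIs).aesm hΩ hτI).pow 2).const_mul _ |>.indicator measurableSet_closedBall) (fun x hx => by simp [hx]) ?_
        intro x hx
        rw [indicator_of_mem hx, abs_mul]
        refine mul_le_mul_of_nonneg_left ?_ (abs_nonneg _)
        rw [abs_pow]
        exact pow_le_pow_left₀ (abs_nonneg _) (hu.bd τ (hIs hτI) x) 2
      · intro x
        simp only
        by_cases hx : x ∈ closedBall y0 r0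
        · rw [indicator_of_mem hx]
          rw [mem_closedBall, dist_eq_norm] at hx
          have hxx : ‖x - x0‖ ≤ r + r0 := by
            have : x - x0 = (x - y0) - r • e := by rw [hx0]; abel
            rw [this]
            refine (norm_sub_le _ _).trans ?_
            rw [norm_smul, he, Real.norm_of_nonneg hrp.le]
            linarith
          have hsf : sf x0 r x ≤ 2 * d := by
            unfold sf
            rw [mul_one_div, div_le_iff₀ hrp]
            have : ‖x - x0‖ ^ 2 ≤ (r + r0) ^ 2 := pow_le_pow_left₀ (norm_nonneg _) hxx 2
            have z1 : r0 * r0 ≤ r0 * r := mul_le_mul_of_nonneg_left (by linarith) hr0.le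
            have z2 : r0 * r ≤ d / 2 * r := mul_le_mul_of_nonneg_right hr0d hrp.le
            have z3 : 0 < d * r := by positivity
            linarith [show (r + r0) ^ 2 = r ^ 2 + 2 * (r0 * r) + r0 * r0 by ring]
          have t1 : θ x = 1 := hχ0.one _ hsf
          have t2 : η τ = 1 := hηo τ ⟨by linarith [hτ.1], by linarith [hτ.2]⟩
          rw [t1, t2, one_mul, one_mul, ← mul_assoc]
          exact mul_le_mul_of_nonneg_right (wt_target hts hBc hr1 hr0.le hτ.1 hτ.2 hxx) (sq_nonneg _)
        · rw [indicator_of_notMem hx]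
          exact mul_nonneg (Real.exp_pos _).le (mul_nonneg (gs_pos x0 τ x).le (sq_nonneg _))
    · intro x
      obtain ⟨g1, g2, g3⟩ := rad_bounds x0 hr1 hdp hd1 hχ0 h3 x
      by_cases hg : gsq (fun x => χ0 (sf x0 r x)) x = 0
      · rw [hg]; exact mul_nonneg (by positivity) (hχ1.nonneg _)
      · rw [hχ1.one _ (g3 (Or.inl hg)).2, mul_one]; exact g1
    · intro τ hτ x hx
      refine hc2 r hr1 hrX x0 x τ (by linarith [hτ.1]) (by linarith [hτ.2]) (Or.inl ?_)
      exact ((rad_bounds x0 hr1 hdp hd1 hχ0 h3 x).2.2 hx).1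
    · intro τ hτ x hx hux
      refine hc2 r hr1 hrX x0 x τ (by linarith [hτ.1]) (by linarith [hτ.2]) (Or.inr ?_)
      rcases hηs τ hx with h | h
      · left
        refine ⟨h, ?_⟩
        by_contra hh
        apply hux
        refine h0 τ ⟨by linarith [h.1], by linarith [hτ.2]⟩ (by linarith [h.2]) x ?_
        have := halfspace_geo (y0 := y0) he r x
        linarith
      · exact Or.inr h
  set vB := volume.real (ball (0 : EuclideanSpace ℝ (Fin N)) 1) with hvB
  refine growth_contra (c0 := Real.exp (-c1) * q) (K := Real.exp c2 * ((T2 - δ1) * (3 ^ N * vB) * |P|)) 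
    (a1 := r0 / (2 * ts)) (a2 := d / (2 * T)) (rs := max 1 (max X' (max (1 / κ) (1 / (T1 - ts))))) (N + 1)
    (by positivity) ?_ ?_
  · calc r0 / (2 * ts) ≤ (d * ts / (2 * T)) / (2 * ts) := by gcongr
      _ = d / (4 * T) := by field_simp; ring
      _ < d / (2 * T) := by apply div_lt_div_of_pos_left hdp (by positivity); linarith
  · intro r hr
    have k := key r hr
    have hr1 : 1 ≤ r := (le_max_left _ _).trans hr
    have hrp : 0 < r := by linarith
    rw [measureReal_def, Measure.addHaar_closedBall _ _ (by positivity), ENNReal.toReal_mul, 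
      ENNReal.toReal_ofReal (by positivity), ← measureReal_def, finrank_euclideanSpace_fin, ← hvB] at k
    have hvB0 : 0 ≤ vB := measureReal_nonneg
    have hTd : 0 ≤ T2 - δ1 := by linarith
    have k2 : Real.exp (c2 - d * r / (2 * T)) * ((T2 - δ1) * ((r + 2 * d) ^ N * vB) * P) ≤ 
       Real.exp (c2 - d * r / (2 * T)) * ((T2 - δ1) * ((3 * r) ^ N * vB) * |P|) := by
      have z1 : (r + 2 * d) ^ N ≤ (3 * r) ^ N := pow_le_pow_left₀ (by positivity) (by linarith) N
      refine mul_le_mul_of_nonneg_left ?_ (Real.exp_pos _).le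
      refine (mul_le_mul_of_nonneg_left (le_abs_self P) (by positivity)).trans ?_
      gcongr
    have k3 := k.trans k2
    rw [one_div, inv_mul_le_iff₀ hrp] at k3
    rw [sub_eq_add_neg (-c1), Real.exp_add, sub_eq_add_neg c2, Real.exp_add, mul_pow] at k3
    calc _ = Real.exp (-c1) * Real.exp (-(r0 * r / (2 * ts))) * q := by
          rw [show r0 / (2 * ts) * r = r0 * r / (2 * ts) by ring]; ring
      _ ≤ _ := k3
      _ = _ := by
          rw [show d / (2 * T) * r = d * r / (2 * T) by ring]; ring
end Aux15

section Aux16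
open scoped ContDiff

lemma second_nonpos {g : ℝ → ℝ} (hg : ContDiff ℝ ∞ g) (h : IsLocalMax g 0) : deriv (deriv g) 0 ≤ 0 := by
  by_contra hh
  push Not at hh
  have h1 := isLocalMin_of_deriv_deriv_pos hh h.deriv_eq_zero hg.continuous.continuousAt
  have h2 : g =ᶠ[𝓝 0] fun _ => g 0 := by
    filter_upwards [h, h1] with s a b using le_antisymm a b
  have h3 : deriv g =ᶠ[𝓝 0] fun _ => 0 := by
    filter_upwards [h2.eventuallyEq_nhds] with s hs
    rw [hs.deriv_eq]; simp
  rw [h3.deriv_eq] at hh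
  simp at hh

lemma lap_nonpos {N : ℕ} {z : EuclideanSpace ℝ (Fin N) → ℝ} (hz : ContDiff ℝ ∞ z) 
    {x : EuclideanSpace ℝ (Fin N)} (h : IsLocalMax z x) : lap z x ≤ 0 := by
  rw [lap_eq]
  refine Finset.sum_nonpos fun i _ => ?_
  set e : EuclideanSpace ℝ (Fin N) := EuclideanSpace.single i 1 with he
  have hl : ∀ s : ℝ, HasDerivAt (fun s : ℝ => x + s • e) e s := fun s => by
    simpa using ((hasDerivAt_id s).smul_const e).const_add x
  have hd : ∀ {w : EuclideanSpace ℝ (Fin N) → ℝ}, ContDiff ℝ ∞ w → ∀ s : ℝ, 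
      deriv (fun s : ℝ => w (x + s • e)) s = pd i w (x + s • e) := by
    intro w hw s
    have := ((hw.differentiable (by simp)) (x + s • e)).hasFDerivAt.comp_hasDerivAt s (hl s)
    exact this.deriv
  have hg : ContDiff ℝ ∞ (fun s : ℝ => z (x + s • e)) := by
    apply hz.comp; fun_prop
  have h0 : IsLocalMax (fun s : ℝ => z (x + s • e)) 0 := by
    have hc : Tendsto (fun s : ℝ => x + s • e) (𝓝 0) (𝓝 x) := by
      have : ContinuousAt (fun s : ℝ => x + s • e) 0 := by fun_prop
      simpa [ContinuousAt] using this
    have := hc.eventually h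
    filter_upwards [this] with s hs
    simpa using hs
  have := second_nonpos hg h0
  rw [funext (hd hz), hd (contDiff_pd_top i hz)] at this
  simpa using this

lemma lap_normsq {N : ℕ} (x1 x : EuclideanSpace ℝ (Fin N)) : lap (fun x => ‖x - x1‖ ^ 2) x = 2 * N := by
  rw [lap_eq]
  have : ∀ i : Fin N, pd i (pd i (fun x : EuclideanSpace ℝ (Fin N) => ‖x - x1‖ ^ 2)) x = 2 := by
    intro i
    rw [funext (pd_normsq i x1), pd_const_mul i 2 (diffable (contDiff_coord i x1) x), pd_coord]
    simp
  simp only [this]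
  simp [mul_comm]

lemma maxp {N : ℕ} {w : ℝ → EuclideanSpace ℝ (Fin N) → ℝ} {σ τ R B L : ℝ} {x1 : EuclideanSpace ℝ (Fin N)}
    (hστ : σ < τ) (hR : 0 < R) (hB : 0 ≤ B) (hL : 0 ≤ L)
    (hcont : ContinuousOn (fun q : ℝ × EuclideanSpace ℝ (Fin N) => w q.1 q.2) (Icc σ τ ×ˢ closedBall x1 R))
    (hsm : ∀ t ∈ Ioc σ τ, ContDiff ℝ ∞ (w t))
    (hder : ∀ t ∈ Ioc σ τ, ∀ x ∈ ball x1 R, ∃ d, HasDerivAt (fun t => w t x) d t ∧ d - lap (w t) x ≤ L)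
    (hinit : ∀ x, w σ x ≤ 0) (hbd : ∀ t ∈ Icc σ τ, ∀ x, w t x ≤ B) :
    w τ x1 ≤ (L + 1 + 2 * N * (B / R ^ 2)) * (τ - σ) := by
  set A := B / R ^ 2 with hA
  have hA0 : 0 ≤ A := by positivity
  set b : ℝ × EuclideanSpace ℝ (Fin N) → ℝ := fun q => (L + 1 + 2 * N * A) * (q.1 - σ) + A * ‖q.2 - x1‖ ^ 2 with hb
  have hbc : Continuous b := by rw [hb]; fun_prop
  have hK : IsCompact (Icc σ τ ×ˢ closedBall x1 R) := isCompact_Icc.prod (isCompact_closedBall x1 R)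
  obtain ⟨⟨t, x⟩, ⟨ht, hx⟩, hmax⟩ := hK.exists_isMaxOn 
    ⟨(τ, x1), ⟨⟨hστ.le, le_rfl⟩, mem_closedBall_self hR.le⟩⟩ (hcont.sub hbc.continuousOn)
  have hm : ∀ s ∈ Icc σ τ, ∀ y ∈ closedBall x1 R, w s y - b (s, y) ≤ w t x - b (t, x) := 
    fun s hs y hy => hmax (show (s, y) ∈ Icc σ τ ×ˢ closedBall x1 R from ⟨hs, hy⟩)
  simp only at ht hx
  suffices h : w t x - b (t, x) ≤ 0 by
    have := hm τ ⟨hστ.le, le_rfl⟩ x1 (mem_closedBall_self hR.le)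
    simp only [hb, sub_self, norm_zero] at this h
    have h3 := this.trans h
    rw [zero_pow two_ne_zero, mul_zero, add_zero] at h3
    linarith
  by_contra hh
  push Not at hh
  have hN : (0:ℝ) ≤ N := N.cast_nonneg
  have hb0 : 0 ≤ (L + 1 + 2 * N * A) * (t - σ) := by have := ht.1; apply mul_nonneg (by positivity); linarith
  have htσ : σ < t := by
    rcases ht.1.lt_or_eq with h | h
    · exact h
    · exfalso
      subst h
      have := hinit x
      simp only [hb] at hh
      have : 0 ≤ A * ‖x - x1‖ ^ 2 := by positivity
      linarith
  have hxb : x ∈ ball x1 R := by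
    rw [mem_closedBall, dist_eq_norm] at hx
    rw [mem_ball, dist_eq_norm]
    rcases hx.lt_or_eq with h | h
    · exact h
    · exfalso
      have := hbd t ht x
      simp only [hb, h] at hh
      have : A * R ^ 2 = B := by rw [hA]; field_simp
      linarith
  obtain ⟨d, hd, hdL⟩ := hder t ⟨htσ, ht.2⟩ x hxb
  have hz : HasDerivAt (fun s => w s x - b (s, x)) (d - (L + 1 + 2 * N * A)) t := by
    refine hd.sub ?_
    simp only [hb]
    refine ((((hasDerivAt_id' t).sub_const σ).const_mul (L + 1 + 2 * N * A)).add_const _).congr_deriv ?_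
    ring
  have hd0 : 0 ≤ d - (L + 1 + 2 * N * A) := by
    by_contra hneg
    push Not at hneg
    have := (hasDerivAt_iff_tendsto_slope_left_right.mp hz).1
    have e1 := this.eventually (gt_mem_nhds hneg)
    have e2 : ∀ᶠ s in 𝓝[<] t, s ∈ Ioo σ t := Ioo_mem_nhdsLT htσ
    obtain ⟨s, hs1, hs2⟩ := (e1.and e2).exists
    rw [slope_def_field, div_lt_iff_of_neg (by linarith [hs2.2]), zero_mul] at hs1
    have := hm s ⟨hs2.1.le, by linarith [hs2.2, ht.2]⟩ x hx
    linarith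
  have hcd : ContDiff ℝ ∞ (fun y : EuclideanSpace ℝ (Fin N) => ‖y - x1‖ ^ 2) := 
    (contDiff_id.sub contDiff_const).norm_sq ℝ
  have hsmb : ContDiff ℝ ∞ (fun y => w t y - b (t, y)) := by
    refine (hsm t ⟨htσ, ht.2⟩).sub ?_
    simp only [hb]
    exact contDiff_const.add (contDiff_const.mul hcd)
  have hlm : IsLocalMax (fun y => w t y - b (t, y)) x := by
    filter_upwards [isOpen_ball.mem_nhds hxb] with y hy using hm t ht y (ball_subset_closedBall hy)
  have hl0 := lap_nonpos hsmb hlm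
  have el : lap (fun y => w t y - b (t, y)) x = lap (w t) x - 2 * N * A := by
    have p1 : ∀ i : Fin N, pd i (fun y => w t y - b (t, y)) = fun y => pd i (w t) y - A * pd i (fun y : EuclideanSpace ℝ (Fin N) => ‖y - x1‖ ^ 2) y := by
      intro i; ext y
      have d1 := diffable (hsm t ⟨htσ, ht.2⟩) y
      have d2 := diffable hcd y
      rw [pd_sub i d1 (by simp only [hb]; exact (d2.const_mul A).const_add _)]
      simp only [hb]
      rw [pd_add i (differentiableAt_const _) (d2.const_mul A), pd_const, pd_const_mul i A d2, zero_add]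
    have p2 := lap_normsq x1 x
    rw [lap_eq] at p2 ⊢
    rw [lap_eq, show 2 * (N:ℝ) * A = A * (2 * N) by ring, ← p2, Finset.mul_sum, ← Finset.sum_sub_distrib]
    refine Finset.sum_congr rfl fun i _ => ?_
    have d1 := diffable (contDiff_pd_top i (hsm t ⟨htσ, ht.2⟩)) x
    have d2 := diffable (contDiff_pd_top i hcd) x
    rw [p1, pd_sub i d1 (d2.const_mul A), pd_const_mul i A d2]
  rw [el] at hl0
  linarith
end Aux16

section Aux17
open scoped ContDiff

lemma mol_joint {N : ℕ} {I : Set ℝ} {Ω : Set (EuclideanSpace ℝ (Fin N))} (hΩ : IsOpen Ω)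
    {u : ℝ → EuclideanSpace ℝ (Fin N) → ℝ} {M : ℝ} (hu : Cls I Ω u M)
    {ψ : EuclideanSpace ℝ (Fin N) → ℝ} (hψ : Continuous ψ)
    (hc : HasCompactSupport ψ) {ε : ℝ} (hs : tsupport ψ ⊆ closedBall 0 ε) (x1 : EuclideanSpace ℝ (Fin N)) (R : ℝ) :
    ContinuousOn (fun q : ℝ × EuclideanSpace ℝ (Fin N) => mol ψ (u q.1) q.2) (I ×ˢ closedBall x1 R) := by
  obtain ⟨C, hC⟩ := hc.exists_bound_of_continuous hψ
  have hM : ∀ t ∈ I, 0 ≤ M := fun t ht => (abs_nonneg _).trans (hu.bd t ht 0)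
  unfold mol
  refine continuousOn_of_dominated (bound := (closedBall x1 (R + ε)).indicator (fun _ => M * C)) ?_ ?_ ?_ ?_
  · rintro ⟨t, x⟩ ⟨ht, hx⟩
    have hcψ : Continuous fun y => ψ (x - y) := by fun_prop
    exact (hu.aesm hΩ ht).mul hcψ.aestronglyMeasurable
  · rintro ⟨t, x⟩ ⟨ht, hx⟩
    refine Eventually.of_forall fun y => ?_
    simp only
    by_cases hy : y ∈ closedBall x1 (R + ε)
    · rw [indicator_of_mem hy, Real.norm_eq_abs]
      exact mul_bd (hu.bd t ht y) (hC (x - y))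
    · rw [indicator_of_notMem hy]
      have : ψ (x - y) = 0 := by
        by_contra hne
        apply hy
        have h1 : x - y ∈ closedBall (0 : EuclideanSpace ℝ (Fin N)) ε := hs (subset_tsupport _ hne)
        rw [mem_closedBall, dist_zero_right, ← dist_eq_norm] at h1
        simp only [mem_closedBall] at hx ⊢
        have := dist_triangle y x x1
        rw [dist_comm y x] at this
        linarith
      simp [this]
  · rw [integrable_indicator_iff measurableSet_closedBall]
    exact integrableOn_const (hs := measure_closedBall_lt_top.ne)
  · refine Eventually.of_forall fun y => ?_
    refine ContinuousOn.mul ?_ ?_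
    · exact (hu.ct y).comp continuousOn_fst (fun q hq => hq.1)
    · exact (Continuous.continuousOn (by fun_prop))

lemma gap_upper {N : ℕ} {I : Set ℝ} {Ω Ω' : Set (EuclideanSpace ℝ (Fin N))} (hΩ : IsOpen Ω)
    {v f : ℝ → EuclideanSpace ℝ (Fin N) → ℝ} {M M' n σ τ ρ : ℝ} (hv : Cls I Ω v M) (hf : Cls I Ω f M')
    (hστ : σ < τ) (hI : Icc σ τ ⊆ I) (hn0 : 0 ≤ n)
    (hw : ∀ t ∈ Ioc σ τ, ∀ φ, TestOn Ω' φ → HasDerivAt (fun t => ∫ x, v t x * φ x)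
      ((∫ x, f t x * φ x) + ∫ x, v t x * lap φ x) t)
    (hn : ∀ φ, TestOn Ω' φ → |∫ x, v σ x * lap φ x| ≤ n * ∫ x, |φ x|)
    {x1 : EuclideanSpace ℝ (Fin N)} (hρ : 0 < ρ) (hx1 : closedBall x1 ρ ⊆ Ω') (hx1' : x1 ∈ Ω) :
    v τ x1 - v σ x1 ≤ ((n + M') + 1 + 2 * N * ((2 * M) / (ρ / 2) ^ 2)) * (τ - σ) := by
  have hσI : σ ∈ I := hI ⟨le_rfl, hστ.le⟩
  have hτI : τ ∈ I := hI ⟨hστ.le, le_rfl⟩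
  have hM : 0 ≤ M := (abs_nonneg _).trans (hv.bd σ hσI 0)
  have hM' : 0 ≤ M' := (abs_nonneg _).trans (hf.bd σ hσI 0)
  set ε : ℕ → ℝ := fun k => ρ / 2 * (1 / ((k:ℝ) + 1)) with hεd
  have hεp : ∀ k, 0 < ε k := fun k => by positivity
  have hεle : ∀ k, ε k ≤ ρ / 2 := fun k => by
    rw [hεd]; simp only
    have : 1 / ((k:ℝ) + 1) ≤ 1 := by
      rw [div_le_one (by positivity)]; have : (0:ℝ) ≤ k := k.cast_nonneg
      linarith
    nlinarith
  have hε : Tendsto ε atTop (𝓝 0) := by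
    have := (tendsto_one_div_add_atTop_nhds_zero_nat (𝕜 := ℝ)).const_mul (ρ / 2)
    rw [mul_zero] at this
    exact this
  choose ψ hψ hψc hψs hψ0 hψ1 using fun k => exists_moll (N := N) (ε k) (hεp k)
  have lim1 := tendsto_mol hΩ (hv.cx τ hτI) (hv.aesm hΩ hτI) (hv.bd τ hτI) hε hψ hψc hψs hψ0 hψ1 hx1'
  have lim2 := tendsto_mol hΩ (hv.cx σ hσI) (hv.aesm hΩ hσI) (hv.bd σ hσI) hε hψ hψc hψs hψ0 hψ1 hx1'
  refine le_of_tendsto (lim1.sub lim2) (Eventually.of_forall fun k => ?_)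
  have sm : ∀ t ∈ I, ContDiff ℝ ∞ (mol (ψ k) (v t)) := fun t ht => contDiff_mol (hψ k) (hψc k) (hv.aesm hΩ ht) (hv.bd t ht)
  have lm : ∀ t ∈ I, ∀ x, lap (mol (ψ k) (v t)) x = mol (lap (ψ k)) (v t) x := fun t ht x => 
    lap_mol (hψ k) (hψc k) (hv.aesm hΩ ht) (hv.bd t ht) x
  refine maxp (w := fun t x => mol (ψ k) (v t) x - mol (ψ k) (v σ) x) hστ (R := ρ / 2) (by linarith) (by positivity) (by positivity) ?_ ?_ ?_ ?_ ?_
  · refine ContinuousOn.sub ((mol_joint hΩ hv (hψ k).continuous (hψc k) (hψs k) x1 (ρ / 2)).mono (prod_mono hI le_rfl)) ?_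
    exact ((sm σ hσI).continuous.comp continuous_snd).continuousOn
  · intro t ht
    exact (sm t (hI ⟨ht.1.le, ht.2⟩)).sub (sm σ hσI)
  · intro t ht x hx
    have htI := hI ⟨ht.1.le, ht.2⟩
    have hxs : closedBall x (ε k) ⊆ Ω' := by
      refine (closedBall_subset_closedBall' ?_).trans hx1
      rw [mem_ball] at hx
      linarith [hεle k]
    have hT := testOn_refl (hψ k) (hψs k) hxs
    have h1 := hw t ht _ hT
    have h2 := hn _ hT
    simp only [lap_refl (hψ k)] at h1 h2
    refine ⟨_, HasDerivAt.sub_const _ h1, ?_⟩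
    have e1 : ∫ y, |ψ k (x - y)| = 1 := by
      simp only [abs_of_nonneg (hψ0 k _)]
      rw [integral_sub_left_eq_self (ψ k), hψ1]
    rw [e1, mul_one] at h2
    have e2 := mol_bd_one (hψ k).continuous (hψc k) (hψ0 k) (hψ1 k) (hf.bd t htI) x
    have e3 : lap (fun x => mol (ψ k) (v t) x - mol (ψ k) (v σ) x) x = mol (lap (ψ k)) (v t) x - mol (lap (ψ k)) (v σ) x := by
      rw [← lm t htI, ← lm σ hσI, lap_eq, lap_eq, lap_eq, ← Finset.sum_sub_distrib]
      refine Finset.sum_congr rfl fun i _ => ?_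
      have e0 : pd i (fun x => mol (ψ k) (v t) x - mol (ψ k) (v σ) x) = fun x => pd i (mol (ψ k) (v t)) x - pd i (mol (ψ k) (v σ)) x :=
        funext fun y => pd_sub i (diffable (sm t htI) y) (diffable (sm σ hσI) y)
      rw [e0, pd_sub i (diffable (contDiff_pd_top i (sm t htI)) x) (diffable (contDiff_pd_top i (sm σ hσI)) x)]
    rw [e3]
    have e4 := le_of_abs_le h2
    have e5 := le_of_abs_le e2
    unfold mol at e5 ⊢
    linarith
  · intro x; simp
  · intro t ht x
    have h1 := le_of_abs_le (mol_bd_one (hψ k).continuous (hψc k) (hψ0 k) (hψ1 k) (hv.bd t (hI ht)) x)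
    have h2 := neg_le_of_abs_le (mol_bd_one (hψ k).continuous (hψc k) (hψ0 k) (hψ1 k) (hv.bd σ hσI) x)
    linarith

lemma Cls.neg {N : ℕ} {I : Set ℝ} {Ω : Set (EuclideanSpace ℝ (Fin N))}
    {u : ℝ → EuclideanSpace ℝ (Fin N) → ℝ} {M : ℝ} (h : Cls I Ω u M) : Cls I Ω (fun t x => - u t x) M :=
  ⟨fun t ht => (h.cx t ht).neg, fun x => (h.ct x).neg, fun t ht x => by rw [abs_neg]; exact h.bd t ht x, 
    fun t ht x hx => by simp [h.off t ht x hx]⟩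

lemma gap {N : ℕ} {I : Set ℝ} {Ω Ω' : Set (EuclideanSpace ℝ (Fin N))} (hΩ : IsOpen Ω)
    {v f : ℝ → EuclideanSpace ℝ (Fin N) → ℝ} {M M' n σ τ ρ : ℝ} (hv : Cls I Ω v M) (hf : Cls I Ω f M')
    (hστ : σ < τ) (hI : Icc σ τ ⊆ I) (hn0 : 0 ≤ n)
    (hw : ∀ t ∈ Ioc σ τ, ∀ φ, TestOn Ω' φ → HasDerivAt (fun t => ∫ x, v t x * φ x)
      ((∫ x, f t x * φ x) + ∫ x, v t x * lap φ x) t)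
    (hn : ∀ φ, TestOn Ω' φ → |∫ x, v σ x * lap φ x| ≤ n * ∫ x, |φ x|)
    {x1 : EuclideanSpace ℝ (Fin N)} (hρ : 0 < ρ) (hx1 : closedBall x1 ρ ⊆ Ω') (hx1' : x1 ∈ Ω) :
    |v τ x1 - v σ x1| ≤ ((n + M') + 1 + 2 * N * ((2 * M) / (ρ / 2) ^ 2)) * (τ - σ) := by
  have h1 := gap_upper hΩ hv hf hστ hI hn0 hw hn hρ hx1 hx1'
  have h2 := gap_upper hΩ hv.neg hf.neg hστ hI hn0 (Ω' := Ω') ?_ ?_ hρ hx1 hx1'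
  · rw [abs_le]; constructor <;> linarith
  · intro t ht φ hφ
    have := (hw t ht φ hφ).neg
    simp only [neg_mul, integral_neg]
    refine this.congr_deriv ?_
    ring
  · intro φ hφ
    simp only [neg_mul, integral_neg, abs_neg]
    exact hn φ hφ

lemma lip_of_gap {s t C C' : ℝ} {Z : Set ℝ} (hZ : IsClosed Z) {g : ℝ → ℝ} (hg : ContinuousOn g (Icc s t)) 
    (hs : s ∈ Z) (hst : s ≤ t) (hC : C < C')
    (hd : ∀ σ ∈ Z, s ≤ σ → σ < t → ∃ d, |d| ≤ C ∧ HasDerivAt g d σ) 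
    (hgap : ∀ σ ∈ Z, ∀ τ, s ≤ σ → σ < τ → τ ≤ t → (∀ r ∈ Ioc σ τ, r ∉ Z) → |g τ - g σ| ≤ C * (τ - σ)) :
    |g t - g s| ≤ C' * (t - s) := by
  by_contra hbad
  push Not at hbad
  set h : ℝ → ℝ := fun τ => |g τ - g s| - C' * (τ - s) with hh
  have hhc : ContinuousOn h (Icc s t) := by
    apply ContinuousOn.sub
    · exact (hg.sub continuousOn_const).abs
    · exact Continuous.continuousOn (by fun_prop)
  set B := {τ | τ ∈ Icc s t ∧ 0 < h τ} with hB
  have htB : t ∈ B := ⟨⟨hst, le_rfl⟩, by simp only [hh]; linarith⟩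
  have hBb : BddBelow B := ⟨s, fun τ hτ => hτ.1.1⟩
  set τ0 := sInf B with hτ0
  have hsτ0 : s ≤ τ0 := le_csInf ⟨t, htB⟩ fun τ hτ => hτ.1.1
  have hτ0_t : τ0 ≤ t := csInf_le hBb htB
  have hlt : ∀ σ, s ≤ σ → σ < τ0 → h σ ≤ 0 := by
    intro σ h1 h2
    by_contra h3
    push Not at h3
    exact absurd (csInf_le hBb (show σ ∈ B from ⟨⟨h1, by linarith⟩, h3⟩)) (not_le.mpr h2)
  have hτ0_h : h τ0 ≤ 0 := by
    rcases hsτ0.eq_or_lt with h1 | h1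
    · rw [← h1]; simp [hh]
    · have hc : ContinuousWithinAt h (Ioo s τ0) τ0 := (hhc τ0 ⟨hsτ0, hτ0_t⟩).mono fun r hr => 
        ⟨hr.1.le, by linarith [hr.2]⟩
      have hne : (𝓝[Ioo s τ0] τ0).NeBot := by
        rw [← mem_closure_iff_nhdsWithin_neBot, closure_Ioo h1.ne]; exact ⟨h1.le, le_rfl⟩
      exact le_of_tendsto hc (eventually_mem_nhdsWithin.mono fun r hr => hlt r hr.1.le hr.2)
  have hτ0_lt : τ0 < t := by
    rcases hτ0_t.eq_or_lt with h1 | h1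
    · rw [h1] at hτ0_h; exact absurd htB.2 (not_lt.mpr hτ0_h)
    · exact h1
  have hnear : ∀ τ' > τ0, ∃ τ ∈ B, τ0 < τ ∧ τ < τ' := by
    intro τ' hτ'
    obtain ⟨τ, hτ, hτ2⟩ := exists_lt_of_csInf_lt ⟨t, htB⟩ hτ'
    refine ⟨τ, hτ, lt_of_le_of_ne (csInf_le hBb hτ) ?_, hτ2⟩
    intro he
    rw [he] at hτ0_h
    exact absurd hτ.2 (not_lt.mpr hτ0_h)
  have fin : ∀ σ τ, h σ ≤ 0 → σ ≤ τ → |g τ - g σ| ≤ C' * (τ - σ) → h τ ≤ 0 := by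
    intro σ τ h1 h2 h3
    simp only [hh] at h1 ⊢
    have := abs_sub_le (g τ) (g σ) (g s)
    linarith
  by_cases hz : τ0 ∈ Z
  · obtain ⟨d, hd1, hd2⟩ := hd τ0 hz hsτ0 hτ0_lt
    have h1 := (hasDerivAt_iff_tendsto_slope_left_right.mp hd2).2
    have h2 := h1.abs.eventually (gt_mem_nhds (show |d| < C' by linarith))
    obtain ⟨τ', hτ', hsub⟩ := (mem_nhdsGT_iff_exists_Ioo_subset).mp h2
    obtain ⟨τ, hτB, h3, h4⟩ := hnear τ' hτ'
    have h5 : |slope g τ0 τ| < C' := hsub ⟨h3, h4⟩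
    rw [slope_def_field, abs_div, div_lt_iff₀ (by rw [abs_pos]; linarith), abs_of_pos (show 0 < τ - τ0 by linarith)] at h5
    exact absurd hτB.2 (not_lt.mpr (fin τ0 τ hτ0_h h3.le h5.le))
  · have hcp : IsCompact (Z ∩ Icc s τ0) := isCompact_Icc.inter_left hZ
    have hmem := hcp.sSup_mem ⟨s, hs, le_rfl, hsτ0⟩
    set σ := sSup (Z ∩ Icc s τ0) with hσ
    have hσlt : σ < τ0 := lt_of_le_of_ne hmem.2.2 (fun he => hz (he ▸ hmem.1))
    have hZc : Zᶜ ∈ 𝓝 τ0 := hZ.isOpen_compl.mem_nhds hz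
    obtain ⟨l, u, hlu, hsub⟩ := mem_nhds_iff_exists_Ioo_subset.mp hZc
    obtain ⟨τ, hτB, h3, h4⟩ := hnear u hlu.2
    have := hgap σ hmem.1 τ hmem.2.1 (by linarith) hτB.1.2 ?_
    · refine absurd hτB.2 (not_lt.mpr (fin σ τ (hlt σ hmem.2.1 hσlt) (by linarith) (this.trans ?_)))
      have : 0 < τ - σ := by linarith
      nlinarith
    · intro r hr hrZ
      rcases le_or_gt r τ0 with h5 | h5
      · have : r ≤ σ := le_csSup hcp.bddAbove ⟨hrZ, by linarith [hr.1, hmem.2.1], h5⟩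
        linarith [hr.1]
      · exact hsub ⟨by linarith [hlu.1], by linarith [hr.2]⟩ hrZ
end Aux17

section Aux18
open scoped ContDiff

lemma Cls.cint {N : ℕ} {I : Set ℝ} {Ω : Set (EuclideanSpace ℝ (Fin N))} (hΩ : IsOpen Ω)
    {u : ℝ → EuclideanSpace ℝ (Fin N) → ℝ} {M : ℝ} (hu : Cls I Ω u M)
    {φ : EuclideanSpace ℝ (Fin N) → ℝ} (hφ : Continuous φ) (hc : HasCompactSupport φ) :
    ContinuousOn (fun t => ∫ x, u t x * φ x) I := by
  refine continuousOn_of_dominated (bound := fun x => M * |φ x|) ?_ ?_ ?_ ?_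
  · intro t ht
    exact (hu.aesm hΩ ht).mul hφ.aestronglyMeasurable
  · intro t ht
    refine Eventually.of_forall fun x => ?_
    rw [Real.norm_eq_abs, abs_mul]
    exact mul_le_mul_of_nonneg_right (hu.bd t ht x) (abs_nonneg _)
  · exact ((hφ.integrable_of_hasCompactSupport hc).abs).const_mul M
  · exact Eventually.of_forall fun x => (hu.ct x).mul continuousOn_const

lemma lap_bd_of_weak {N : ℕ} {Ω : Set (EuclideanSpace ℝ (Fin N))} (hΩ : IsOpen Ω)
    {w : EuclideanSpace ℝ (Fin N) → ℝ} {n B : ℝ} (hw : ContDiffOn ℝ 2 w Ω)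
    (hB : ∀ x ∈ Ω, |lap w x| ≤ B)
    (hn : ∀ φ, TestOn Ω φ → |∫ x, w x * lap φ x| ≤ n * ∫ x, |φ x|) :
    ∀ x ∈ Ω, |lap w x| ≤ n := by
  intro x hx
  set h : EuclideanSpace ℝ (Fin N) → ℝ := Ω.indicator (lap w) with hh
  have hcl : ContinuousOn (lap w) Ω := continuousOn_lap hΩ hw
  have hc : ContinuousOn h Ω := hcl.congr fun y hy => by simp [hh, hy]
  have hm : AEStronglyMeasurable h volume :=
    (aestronglyMeasurable_indicator_iff hΩ.measurableSet).2 (hcl.aestronglyMeasurable hΩ.measurableSet)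
  have hB0 : 0 ≤ B := (abs_nonneg _).trans (hB x hx)
  have hb : ∀ y, |h y| ≤ B := by
    intro y
    by_cases hy : y ∈ Ω
    · simpa [hh, hy] using hB y hy
    · simpa [hh, hy] using hB0
  obtain ⟨r, hr, hrx⟩ := Metric.isOpen_iff.1 hΩ x hx
  have hε : Tendsto (fun k : ℕ => r / 2 * (1 / ((k : ℝ) + 1))) atTop (𝓝 0) := by
    simpa using (tendsto_one_div_add_atTop_nhds_zero_nat (𝕜 := ℝ)).const_mul (r / 2)
  have hεp : ∀ k : ℕ, 0 < r / 2 * (1 / ((k : ℝ) + 1)) := fun k => by positivity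
  have hεr : ∀ k : ℕ, r / 2 * (1 / ((k : ℝ) + 1)) < r := fun k => by
    have : 1 / ((k : ℝ) + 1) ≤ 1 := by
      rw [div_le_one (by positivity)]; linarith [(Nat.cast_nonneg k : (0:ℝ) ≤ k)]
    nlinarith
  choose ρ hρ hρc hρs hρ0 hρ1 using fun k : ℕ => exists_moll (N := N) _ (hεp k)
  have ht := (tendsto_mol hΩ hc hm hb hε hρ hρc hρs hρ0 hρ1 hx).abs
  have e : h x = lap w x := by simp [hh, hx]
  rw [e] at ht
  refine le_of_tendsto' ht fun k => ?_
  have hT : TestOn Ω (fun y => ρ k (x - y)) :=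
    testOn_refl (hρ k) (hρs k) ((closedBall_subset_ball (hεr k)).trans hrx)
  have h1 := hn _ hT
  rw [green_test hΩ hT hw] at h1
  have h2 : mol (ρ k) h x = ∫ y, lap w y * ρ k (x - y) := by
    unfold mol
    refine integral_congr_ae (Eventually.of_forall fun y => ?_)
    by_cases hy : y ∈ Ω
    · simp [hh, hy]
    · have : ρ k (x - y) = 0 := by
        have := image_eq_zero_of_notMem_tsupport (fun hy' => hy (hT.supp hy'))
        exact this
      simp [this]
  have h3 : ∫ y, |ρ k (x - y)| = 1 := by
    simp only [abs_of_nonneg (hρ0 k _)]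
    rw [integral_sub_left_eq_self (fun y => ρ k y) volume x, hρ1 k]
  rw [h2]
  rw [h3, mul_one] at h1
  exact h1

lemma weak_of_lap_bd {N : ℕ} {Ω : Set (EuclideanSpace ℝ (Fin N))} (hΩ : IsOpen Ω)
    {w : EuclideanSpace ℝ (Fin N) → ℝ} {n : ℝ} (hw : ContDiffOn ℝ 2 w Ω)
    (hB : ∀ x ∈ Ω, |lap w x| ≤ n) (φ) (hφ : TestOn Ω φ) :
    |∫ x, w x * lap φ x| ≤ n * ∫ x, |φ x| := by
  rw [green_test hΩ hφ hw, ← integral_const_mul, ← Real.norm_eq_abs]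
  refine norm_integral_le_of_norm_le ?_ (Eventually.of_forall fun x => ?_)
  · exact ((hφ.smooth.continuous.integrable_of_hasCompactSupport hφ.cpt).abs).const_mul n
  · rw [Real.norm_eq_abs, abs_mul]
    by_cases hx : x ∈ Ω
    · exact mul_le_mul_of_nonneg_right (hB x hx) (abs_nonneg _)
    · have : φ x = 0 := image_eq_zero_of_notMem_tsupport (fun hy' => hx (hφ.supp hy'))
      simp [this]

/-- one dimensional upgrade: right derivatives to two-sided derivatives -/
lemma upgrade {a b : ℝ} {U G : ℝ → ℝ} (hU : ContinuousOn U (Ioo a b)) (hG : ContinuousOn G (Ioo a b))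
    (hd : ∀ s ∈ Ioo a b, HasDerivWithinAt U (G s) (Ioi s) s) : ∀ s ∈ Ioo a b, HasDerivAt U (G s) s := by
  intro s hs
  obtain ⟨c, hc1, hc2⟩ := exists_between hs.1
  obtain ⟨d, hd1, hd2⟩ := exists_between hs.2
  have hsub : Icc c d ⊆ Ioo a b := fun r hr => ⟨hc1.trans_le hr.1, hr.2.trans_lt hd2⟩
  have hintG : ∀ r ∈ Icc c d, IntervalIntegrable G volume c r := fun r hr =>
    ContinuousOn.intervalIntegrable (by
      rw [uIcc_of_le hr.1]
      exact hG.mono ((Icc_subset_Icc_right hr.2).trans hsub))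
  have hF : ∀ r ∈ Icc c d, ∫ y in c..r, G y = U r - U c := fun r hr =>
    intervalIntegral.integral_eq_sub_of_hasDeriv_right_of_le hr.1
      (hU.mono ((Icc_subset_Icc_right hr.2).trans hsub))
      (fun y hy => hd y (hsub ⟨hy.1.le, hy.2.le.trans hr.2⟩)) (hintG r hr)
  have hsI : s ∈ Icc c d := ⟨hc2.le, hd1.le⟩
  have h1 : HasDerivAt (fun r => ∫ y in c..r, G y) (G s) s := by
    refine intervalIntegral.integral_hasDerivAt_right (hintG s hsI) ?_ ?_
    · exact (hG.stronglyMeasurableAtFilter isOpen_Ioo s hs)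
    · exact hG.continuousAt (isOpen_Ioo.mem_nhds hs)
  have h2 : (fun r => U r) =ᶠ[𝓝 s] fun r => (∫ y in c..r, G y) + U c := by
    filter_upwards [Icc_mem_nhds hc2 hd1] with r hr
    rw [hF r hr]; ring
  exact (h1.add_const (U c)).congr_of_eventuallyEq h2

end Aux18

section Aux19
open scoped ContDiff

lemma rderiv {N : ℕ} {I : Set ℝ} {Ω : Set (EuclideanSpace ℝ (Fin N))} (hΩ : IsOpen Ω)
    {v : ℝ → EuclideanSpace ℝ (Fin N) → ℝ} {M C s : ℝ} (hv : Cls I Ω v M) (hs : s ∈ I)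
    {φ g : EuclideanSpace ℝ (Fin N) → ℝ} (hφ : Continuous φ) (hc : HasCompactSupport φ)
    (hL : ∀ᶠ t in 𝓝[>] s, t ∈ I ∧ ∀ x ∈ tsupport φ, |v t x - v s x| ≤ C * (t - s))
    (hg : ∀ x ∈ tsupport φ, HasDerivAt (fun t => v t x) (g x) s) :
    HasDerivWithinAt (fun t => ∫ x, v t x * φ x) (∫ x, g x * φ x) (Ioi s) s := by
  rw [hasDerivWithinAt_iff_tendsto_slope' (by simp)]
  have h1 : ∀ᶠ t in 𝓝[>] s, (∫ x, (slope (fun t => v t x) s t) * φ x)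
      = slope (fun t => ∫ x, v t x * φ x) s t := by
    filter_upwards [hL] with t ht
    simp only [slope_def_field]
    rw [← integral_sub (hv.int hΩ ht.1 hφ hc) (hv.int hΩ hs hφ hc), ← integral_div]
    congr 1; ext x; ring
  refine Tendsto.congr' h1 ?_
  refine tendsto_integral_filter_of_dominated_convergence (fun x => C * |φ x|) ?_ ?_ ?_ ?_
  · filter_upwards [hL] with t ht
    simp only [slope_def_field]
    exact ((((hv.aesm hΩ ht.1).sub (hv.aesm hΩ hs)).mul
      (aestronglyMeasurable_const (b := (t - s)⁻¹))).mul hφ.aestronglyMeasurable)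
  · filter_upwards [hL, self_mem_nhdsWithin] with t ht hts
    refine Eventually.of_forall fun x => ?_
    rw [Real.norm_eq_abs, abs_mul]
    by_cases hx : x ∈ tsupport φ
    · refine mul_le_mul_of_nonneg_right ?_ (abs_nonneg _)
      have hp : 0 < t - s := sub_pos.2 hts
      rw [slope_def_field, abs_div, abs_of_pos hp, div_le_iff₀ hp]
      exact ht.2 x hx
    · simp [image_eq_zero_of_notMem_tsupport hx]
  · exact ((hφ.integrable_of_hasCompactSupport hc).abs).const_mul C
  · refine Eventually.of_forall fun x => ?_
    by_cases hx : x ∈ tsupport φ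
    · have := (hg x hx).hasDerivWithinAt (s := Ioi s)
      rw [hasDerivWithinAt_iff_tendsto_slope' (by simp)] at this
      exact this.mul_const _
    · simp [image_eq_zero_of_notMem_tsupport hx]

/-- weak derivative property at time s -/
def Dset {N : ℕ} (Ω' : Set (EuclideanSpace ℝ (Fin N))) (v f : ℝ → EuclideanSpace ℝ (Fin N) → ℝ) :
    Set ℝ :=
  {s | ∀ φ, TestOn Ω' φ → HasDerivAt (fun t => ∫ x, v t x * φ x)
      ((∫ x, f s x * φ x) + ∫ x, v s x * lap φ x) s}

lemma baire_step {N : ℕ} {c d : ℝ} {I : Set ℝ} {Ω Ω' : Set (EuclideanSpace ℝ (Fin N))}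
    (hΩ : IsOpen Ω) (hΩ' : IsOpen Ω') (hsub : Ω' ⊆ Ω)
    {v f : ℝ → EuclideanSpace ℝ (Fin N) → ℝ} {M M' n : ℝ} (hv : Cls I Ω v M) (hf : Cls I Ω f M')
    (hJ : Ioo c d ⊆ I)
    (hx : ∀ t ∈ I, ContDiffOn ℝ 2 (v t) Ω)
    (ht : ∀ t ∈ I, ∀ x ∈ Ω, HasDerivAt (fun t => v t x) (lap (v t) x + f t x) t)
    (hbdd : ∀ t ∈ I, ∃ n : ℕ, ∀ x ∈ Ω', |lap (v t) x| ≤ n) (hn0 : 0 ≤ n)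
    (hn : ∀ s ∈ Ioo c d, s ∉ interior (Dset Ω' v f) → ∀ φ, TestOn Ω' φ →
      |∫ x, v s x * lap φ x| ≤ n * ∫ x, |φ x|) : Ioo c d ⊆ Dset Ω' v f := by
  intro s0 hs0 φ hφ
  have hlc : Continuous (lap φ) := (hφ.lap).smooth.continuous
  have hlcc : HasCompactSupport (lap φ) := hφ.lap.cpt
  have hφc := hφ.smooth.continuous
  have hU : ContinuousOn (fun t => ∫ x, v t x * φ x) (Ioo c d) := (hv.cint hΩ hφc hφ.cpt).mono hJ
  have hG : ContinuousOn (fun s => (∫ x, f s x * φ x) + ∫ x, v s x * lap φ x) (Ioo c d) :=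
    ((hf.cint hΩ hφc hφ.cpt).add (hv.cint hΩ hlc hlcc)).mono hJ
  refine upgrade hU hG ?_ s0 hs0
  intro s hs
  by_cases hsD : s ∈ interior (Dset Ω' v f)
  · exact (interior_subset hsD φ hφ).hasDerivWithinAt
  have hZ : IsClosed ((interior (Dset Ω' v f))ᶜ) := isOpen_interior.isClosed_compl
  obtain ⟨ρ, hρ, hρs⟩ := (hφ.cpt : IsCompact (tsupport φ)).exists_cthickening_subset_open hΩ' hφ.supp
  have hball : ∀ x ∈ tsupport φ, closedBall x ρ ⊆ Ω' := fun x hx =>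
    (closedBall_subset_cthickening hx ρ).trans hρs
  have hM : 0 ≤ M := (abs_nonneg _).trans (hv.bd s (hJ hs) 0)
  have hM' : 0 ≤ M' := (abs_nonneg _).trans (hf.bd s (hJ hs) 0)
  set C := (n + M') + 1 + 2 * N * ((2 * M) / (ρ / 2) ^ 2) with hC
  have hCn : n + M' ≤ C := by
    have : 0 ≤ 2 * (N : ℝ) * ((2 * M) / (ρ / 2) ^ 2) := by positivity
    rw [hC]; linarith
  have e : (∫ x, f s x * φ x) + ∫ x, v s x * lap φ x = ∫ x, (lap (v s) x + f s x) * φ x := by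
    have hi : Integrable fun x => lap (v s) x * φ x := by
      obtain ⟨k, hk⟩ := hbdd s (hJ hs)
      have hcd : Continuous fun x => lap (v s) x * φ x := by
        rw [continuous_iff_continuousAt]
        intro x
        by_cases hxx : x ∈ tsupport φ
        · exact ((continuousOn_lap hΩ (hx s (hJ hs))).continuousAt
            (hΩ.mem_nhds (hsub (hφ.supp hxx)))).mul hφc.continuousAt
        · have : (fun x => lap (v s) x * φ x) =ᶠ[𝓝 x] fun _ => 0 := by
            filter_upwards [(isClosed_tsupport φ).isOpen_compl.mem_nhds hxx] with y hy
            rw [image_eq_zero_of_notMem_tsupport hy, mul_zero]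
          exact (continuousAt_const).congr this.symm
      exact hcd.integrable_of_hasCompactSupport hφ.cpt.mul_left
    rw [green_test hΩ (hφ.mono hsub) (hx s (hJ hs)), ← integral_add (hf.int hΩ (hJ hs) hφc hφ.cpt) hi]
    congr 1; ext x; ring
  rw [e]
  refine rderiv hΩ hv (hJ hs) (C := C + 1) hφc hφ.cpt ?_ (fun x hxx => ht s (hJ hs) x (hsub (hφ.supp hxx)))
  filter_upwards [Ioo_mem_nhdsGT hs.2] with t htt
  have htJ : ∀ r, s ≤ r → r ≤ t → r ∈ Ioo c d := fun r h1 h2 => ⟨hs.1.trans_le h1, h2.trans_lt htt.2⟩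
  refine ⟨hJ (htJ t htt.1.le le_rfl), fun x hxx => ?_⟩
  have hxΩ' := hφ.supp hxx
  refine lip_of_gap hZ (g := fun t => v t x) ((hv.ct x).mono fun r hr => hJ (htJ r hr.1 hr.2)) hsD htt.1.le
    (lt_add_one C) ?_ ?_
  · intro σ hσ h1 h2
    have hσJ := htJ σ h1 h2.le
    refine ⟨_, ?_, ht σ (hJ hσJ) x (hsub hxΩ')⟩
    obtain ⟨k, hk⟩ := hbdd σ (hJ hσJ)
    have := lap_bd_of_weak hΩ' ((hx σ (hJ hσJ)).mono hsub) hk (hn σ hσJ hσ) x hxΩ'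
    exact (abs_add_le _ _).trans ((add_le_add this (hf.bd σ (hJ hσJ) x)).trans hCn)
  · intro σ hσ τ h1 h2 h3 h4
    have hσJ := htJ σ h1 (h2.le.trans h3)
    refine gap hΩ hv hf h2 (fun r hr => hJ (htJ r (h1.trans hr.1) (hr.2.trans h3))) hn0 (Ω' := Ω') ?_
      (hn σ hσJ hσ) hρ (hball x hxx) (hsub hxΩ')
    intro r hr ψ hψ
    have : r ∈ interior (Dset Ω' v f) := by
      have := h4 r hr
      simpa using this
    exact interior_subset this ψ hψ

lemma weakF_loc {N : ℕ} {I : Set ℝ} (hI : IsOpen I) {Ω Ω' : Set (EuclideanSpace ℝ (Fin N))}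
    (hΩ : IsOpen Ω) (hΩ' : IsOpen Ω') (hsub : Ω' ⊆ Ω)
    {v f : ℝ → EuclideanSpace ℝ (Fin N) → ℝ} {M M' : ℝ} (hv : Cls I Ω v M) (hf : Cls I Ω f M')
    (hx : ∀ t ∈ I, ContDiffOn ℝ 2 (v t) Ω)
    (ht : ∀ t ∈ I, ∀ x ∈ Ω, HasDerivAt (fun t => v t x) (lap (v t) x + f t x) t)
    (hbdd : ∀ t ∈ I, ∃ n : ℕ, ∀ x ∈ Ω', |lap (v t) x| ≤ n) : I ⊆ Dset Ω' v f := by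
  set P : Set ℝ := (interior (Dset Ω' v f))ᶜ ∩ I with hP
  by_cases hPe : P = ∅
  · intro s hs
    by_contra h
    have : s ∈ P := ⟨fun h' => h (interior_subset h'), hs⟩
    rw [hPe] at this; exact this
  exfalso
  have hPl : IsLocallyClosed P :=
    (isOpen_interior.isClosed_compl.isLocallyClosed).inter hI.isLocallyClosed
  haveI : LocallyCompactSpace P := hPl.locallyCompactSpace
  haveI : Nonempty P := (Set.nonempty_iff_ne_empty.2 hPe).to_subtype
  set F : ℕ → Set P := fun n => {p : P | ∀ φ, TestOn Ω' φ →
      |∫ x, v p x * lap φ x| ≤ n * ∫ x, |φ x|} with hF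
  have hFc : ∀ n, IsClosed (F n) := by
    intro n
    simp only [hF, setOf_forall]
    refine isClosed_iInter fun φ => isClosed_iInter fun hφ => ?_
    refine isClosed_le ?_ continuous_const
    have h1 := (hv.cint hΩ hφ.lap.smooth.continuous hφ.lap.cpt)
    have h2 : ContinuousOn (fun t => ∫ x, v t x * lap φ x) P := h1.mono inter_subset_right
    exact (continuousOn_iff_continuous_restrict.1 h2).abs
  have hFU : ⋃ n, F n = univ := by
    rw [eq_univ_iff_forall]
    rintro ⟨p, hp⟩
    obtain ⟨n, hn⟩ := hbdd p hp.2
    rw [mem_iUnion]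
    exact ⟨n, fun φ hφ => weak_of_lap_bd hΩ' ((hx p hp.2).mono hsub) hn φ hφ⟩
  obtain ⟨n, ⟨p0, hp0⟩⟩ := nonempty_interior_of_iUnion_of_closed hFc hFU
  rw [mem_interior_iff_mem_nhds, nhds_subtype_eq_comap, mem_comap] at hp0
  obtain ⟨W, hW, hWF⟩ := hp0
  obtain ⟨ε, hε, hεW⟩ := Metric.mem_nhds_iff.1 (inter_mem hW (hI.mem_nhds p0.2.2))
  have key : Ioo ((p0 : ℝ) - ε) (p0 + ε) ⊆ Dset Ω' v f := by
    refine baire_step hΩ hΩ' hsub hv hf ?_ hx ht hbdd (n := n) (Nat.cast_nonneg n) ?_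
    · intro r hr
      rw [← Real.ball_eq_Ioo] at hr
      exact (hεW hr).2
    · intro s hs hsD
      rw [← Real.ball_eq_Ioo] at hs
      have h1 := hεW hs
      exact hWF (show (⟨s, hsD, h1.2⟩ : P) ∈ Subtype.val ⁻¹' W from h1.1)
  refine p0.2.1 ?_
  exact interior_maximal key isOpen_Ioo ⟨by linarith, by linarith⟩

theorem weakF {N : ℕ} {I : Set ℝ} (hI : IsOpen I) {Ω : Set (EuclideanSpace ℝ (Fin N))}
    (hΩ : IsOpen Ω)
    {v f : ℝ → EuclideanSpace ℝ (Fin N) → ℝ} {M M' : ℝ} (hv : Cls I Ω v M) (hf : Cls I Ω f M')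
    (hx : ∀ t ∈ I, ContDiffOn ℝ 2 (v t) Ω)
    (ht : ∀ t ∈ I, ∀ x ∈ Ω, HasDerivAt (fun t => v t x) (lap (v t) x + f t x) t) :
    I ⊆ Dset Ω v f := by
  intro s hs φ hφ
  obtain ⟨ρ, hρ, hρs⟩ := (hφ.cpt : IsCompact (tsupport φ)).exists_cthickening_subset_open hΩ hφ.supp
  have hcc : IsCompact (cthickening ρ (tsupport φ)) := (hφ.cpt : IsCompact (tsupport φ)).cthickening
  have hT : TestOn (thickening ρ (tsupport φ)) φ := ⟨hφ.smooth, hφ.cpt, self_subset_thickening hρ _⟩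
  have hsub : thickening ρ (tsupport φ) ⊆ cthickening ρ (tsupport φ) := thickening_subset_cthickening _ _
  refine weakF_loc hI hΩ isOpen_thickening (hsub.trans hρs) hv hf hx ht ?_ hs φ hT
  intro t htI
  obtain ⟨B, hB⟩ := hcc.exists_bound_of_continuousOn ((continuousOn_lap hΩ (hx t htI)).mono hρs)
  obtain ⟨k, hk⟩ := exists_nat_ge B
  exact ⟨k, fun x hx => (hB x (hsub hx)).trans hk⟩

end Aux19

section Aux20
open scoped ContDiff

/-- the nonlinearity -/
def nl (p r : ℝ) : ℝ := -(|r| ^ (p - 1) * r)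

lemma nl_cont {p : ℝ} (hp : 1 < p) : Continuous (nl p) := by
  unfold nl
  exact ((continuous_abs.rpow_const (fun x => Or.inr (by linarith))).mul continuous_id).neg

lemma nl_zero (p : ℝ) : nl p 0 = 0 := by simp [nl]

lemma nl_bd {p : ℝ} (hp : 1 < p) {B r : ℝ} (hr : |r| ≤ B) : |nl p r| ≤ B ^ (p - 1) * |r| := by
  unfold nl
  rw [abs_neg, abs_mul, abs_of_nonneg (Real.rpow_nonneg (abs_nonneg r) _)]
  exact mul_le_mul_of_nonneg_right (Real.rpow_le_rpow (abs_nonneg _) hr (by linarith)) (abs_nonneg _)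

lemma Cls.nl {N : ℕ} {I : Set ℝ} {Ω : Set (EuclideanSpace ℝ (Fin N))}
    {u : ℝ → EuclideanSpace ℝ (Fin N) → ℝ} {B p : ℝ} (hp : 1 < p) (h : Cls I Ω u B) :
    Cls I Ω (fun t x => nl p (u t x)) (B ^ (p - 1) * B) := by
  refine ⟨fun t ht => (nl_cont hp).comp_continuousOn (h.cx t ht),
    fun x => (nl_cont hp).comp_continuousOn (h.ct x), fun t ht x => ?_, fun t ht x hx => ?_⟩
  · have hB : 0 ≤ B := (abs_nonneg _).trans (h.bd t ht x)
    exact (nl_bd hp (h.bd t ht x)).trans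
      (mul_le_mul_of_nonneg_left (h.bd t ht x) (Real.rpow_nonneg hB _))
  · simp only [h.off t ht x hx, nl_zero]

lemma bu_shift {N : ℕ} {e : EuclideanSpace ℝ (Fin N)} (he : ‖e‖ = 1) {c ta tb B p δ X ts : ℝ}
    (hp : 1 < p) {u : ℝ → EuclideanSpace ℝ (Fin N) → ℝ}
    (hu : Cls (Ioo ta tb) {x | c < ⟪e, x⟫} u B)
    (hw : WeakB (Ioo ta tb) {x | c < ⟪e, x⟫} u (fun t x => nl p (u t x))) (hδ : 0 < δ)
    (h0 : ∀ t ∈ Ioo ta tb, t ≤ ta + δ → ∀ x, X < ⟪e, x⟫ → u t x = 0) (hts : ta < ts)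
    (htT : Real.exp 1 * (ts - ta) < tb - ta)
    {y0 : EuclideanSpace ℝ (Fin N)} (hy0 : c < ⟪e, y0⟫) : u ts y0 = 0 := by
  have hm : ∀ t, t ∈ Ioo 0 (tb - ta) → t + ta ∈ Ioo ta tb := fun t ht =>
    ⟨by linarith [ht.1], by linarith [ht.2]⟩
  have hu2 : Cls (Ioo 0 (tb - ta)) {x | c < ⟪e, x⟫} (fun t => u (t + ta)) B := by
    refine ⟨fun t ht => hu.cx _ (hm t ht), fun x => ?_, fun t ht => hu.bd _ (hm t ht),
      fun t ht => hu.off _ (hm t ht)⟩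
    exact (hu.ct x).comp (f := fun t => t + ta) (Continuous.continuousOn (by fun_prop)) hm
  have := bu he (T := tb - ta) (u := fun t => u (t + ta)) (f := fun t x => nl p (u (t + ta) x))
    (C := B ^ (p - 1)) (δ := δ) (X := X) (ts := ts - ta) hu2 (hu2.nl hp)
    (fun t ht x => nl_bd hp (hu2.bd t ht x)) ?_ hδ ?_ (by linarith) htT hy0
  · simpa using this
  · intro φ hφ t ht
    have h1 := hw φ hφ _ (hm t ht)
    exact h1.comp_add_const t ta
  · intro t ht htd x hx
    exact h0 _ (hm t ht) (by linarith) x hx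

lemma base_weak {N : ℕ} {p : ℝ} (hp : 1 < p) {D Ω : Set (EuclideanSpace ℝ (Fin N))}
    {v : ℝ → EuclideanSpace ℝ (Fin N) → ℝ}
    (hregx : ∀ s ∈ Ioo (-1:ℝ) 0, ContDiffOn ℝ 2 (v s) D)
    (hregt : ∀ y ∈ D, ∀ s ∈ Ioo (-1:ℝ) 0, DifferentiableAt ℝ (fun σ => v σ y) s)
    (hpde : ∀ s ∈ Ioo (-1:ℝ) 0, ∀ y ∈ D,
      deriv (fun σ => v σ y) s = lap (v s) y + |v s y| ^ (p - 1) * v s y)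
    (hΩ : IsOpen Ω) (hΩD : Ω ⊆ D) {ta tb B : ℝ} (hta : 0 ≤ ta) (htb : tb ≤ 1) (hB0 : 0 ≤ B)
    (hB : ∀ t ∈ Ioo ta tb, ∀ x ∈ Ω, |v (-t) x| ≤ B) :
    Cls (Ioo ta tb) Ω (fun t => Ω.indicator (v (-t))) B ∧
    WeakB (Ioo ta tb) Ω (fun t => Ω.indicator (v (-t))) (fun t x => nl p (Ω.indicator (v (-t)) x)) := by
  have hm : ∀ t, t ∈ Ioo (-tb) (-ta) → t ∈ Ioo (-1 : ℝ) 0 := fun t ht =>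
    ⟨by linarith [ht.1], by linarith [ht.2]⟩
  have hm2 : ∀ t, t ∈ Ioo ta tb → -t ∈ Ioo (-tb) (-ta) := fun t ht =>
    ⟨by linarith [ht.2], by linarith [ht.1]⟩
  have hv : Cls (Ioo (-tb) (-ta)) Ω (fun t => Ω.indicator (v t)) B := by
    refine ⟨fun t ht => ?_, fun x => ?_, fun t ht x => ?_, fun t ht x hx => ?_⟩
    · exact ((hregx t (hm t ht)).continuousOn.mono hΩD).congr fun y hy => by simp [hy]
    · by_cases hx : x ∈ Ω
      · simp only [indicator_of_mem hx]
        exact fun t ht => (hregt x (hΩD hx) t (hm t ht)).continuousAt.continuousWithinAt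
      · simp only [indicator_of_notMem hx]
        exact continuousOn_const
    · by_cases hx : x ∈ Ω
      · simp only [indicator_of_mem hx]
        have := hB (-t) ⟨by linarith [ht.2], by linarith [ht.1]⟩ x hx
        rwa [neg_neg] at this
      · simpa only [indicator_of_notMem hx, abs_zero] using hB0
    · simp [hx]
  have hf := (hv.nl hp).neg
  have hD := weakF isOpen_Ioo hΩ hv hf ?_ ?_
  · refine ⟨⟨fun t ht => hv.cx _ (hm2 t ht), fun x => ?_, fun t ht => hv.bd _ (hm2 t ht),
      fun t ht => hv.off _ (hm2 t ht)⟩, ?_⟩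
    · exact (hv.ct x).comp (f := fun t => -t) (Continuous.continuousOn (by fun_prop)) hm2
    · intro φ hφ t ht
      have h1 := hD (hm2 t ht) φ hφ
      have h2 := h1.scomp t (hasDerivAt_neg t)
      refine h2.congr_deriv ?_
      simp only [smul_eq_mul, neg_mul, integral_neg]
      ring
  · intro t ht
    exact ((hregx t (hm t ht)).mono hΩD).congr fun y hy => by simp [hy]
  · intro t ht x hx
    have h1 := (hregt x (hΩD hx) t (hm t ht)).hasDerivAt
    rw [hpde t (hm t ht) x (hΩD hx)] at h1
    have h2 : lap (Ω.indicator (v t)) x = lap (v t) x := lap_congr (by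
      filter_upwards [hΩ.mem_nhds hx] with y hy
      simp [hy])
    simp only [h2, indicator_of_mem hx]
    refine h1.congr_deriv ?_
    simp [nl]

lemma geo {N : ℕ} (hN : 1 ≤ N) {D : Set (EuclideanSpace ℝ (Fin N))}
    (hD : D = univ ∨
      ∃ (e : EuclideanSpace ℝ (Fin N)) (c : ℝ), e ≠ 0 ∧ D = {y | c < ⟪e, y⟫}) :
    ∃ e : EuclideanSpace ℝ (Fin N), ‖e‖ = 1 ∧ ∀ y ∈ D, ∃ c : ℝ, c < ⟪e, y⟫ ∧
      {x | c < ⟪e, x⟫} ⊆ D := by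
  rcases hD with rfl | ⟨e, c, he, rfl⟩
  · refine ⟨EuclideanSpace.single ⟨0, hN⟩ 1, by simp, fun y _ => ⟨_, sub_one_lt _, subset_univ _⟩⟩
  · have hn : 0 < ‖e‖ := norm_pos_iff.2 he
    have key : ∀ y, ⟪‖e‖⁻¹ • e, y⟫ = ⟪e, y⟫ / ‖e‖ := fun y => by
      rw [real_inner_smul_left]; field_simp
    refine ⟨‖e‖⁻¹ • e, ?_, fun y hy => ⟨c / ‖e‖, ?_, fun x hx => ?_⟩⟩
    · rw [norm_smul, norm_inv, norm_norm, inv_mul_cancel₀ hn.ne']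
    · rw [key]; exact div_lt_div_of_pos_right hy hn
    · simp only [mem_setOf_eq, key] at hx ⊢
      exact (div_lt_div_iff_of_pos_right hn).1 hx

lemma far_weak {N : ℕ} {p : ℝ} {H : Set (EuclideanSpace ℝ (Fin N))} (hH : IsOpen H)
    (hp : 1 < p) {v : ℝ → EuclideanSpace ℝ (Fin N) → ℝ} {B : ℝ} (hB0 : 0 ≤ B)
    (hC : ContinuousOn (fun q : ℝ × EuclideanSpace ℝ (Fin N) => v q.1 q.2) (Icc (-1:ℝ) 0 ×ˢ H))
    (hB : ∀ t ∈ Ioo (0:ℝ) 1, ∀ x ∈ H, |v (-t) x| ≤ B)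
    (hz : ∀ x ∈ H, v 0 x = 0)
    (hw : WeakB (Ioo 0 1) H (fun t => H.indicator (v (-t))) (fun t x => nl p (H.indicator (v (-t)) x))) :
    Cls (Ioo (-1) 1) H (fun t => H.indicator (v (-max t 0))) B ∧
    WeakB (Ioo (-1) 1) H (fun t => H.indicator (v (-max t 0)))
      (fun t x => nl p (H.indicator (v (-max t 0)) x)) := by
  have hz2 : ∀ t ≤ 0, ∀ x, H.indicator (v (-max t 0)) x = 0 := by
    intro t ht x
    rw [max_eq_right ht]
    by_cases hx : x ∈ H
    · simp [hx, hz x hx]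
    · simp [hx]
  have hu : Cls (Ioo (-1) 1) H (fun t => H.indicator (v (-max t 0))) B := by
    refine ⟨fun t ht => ?_, fun x => ?_, fun t ht x => ?_, fun t ht x hx => by simp [hx]⟩
    · have : ContinuousOn (v (-max t 0)) H :=
        hC.comp (f := fun x => (-max t 0, x)) (Continuous.continuousOn (by fun_prop)) fun x hx =>
          ⟨⟨by have := ht.2; rw [neg_le_neg_iff]; exact max_le this.le zero_le_one, by simp⟩, hx⟩
      exact this.congr fun y hy => by simp [hy]
    · by_cases hx : x ∈ H
      · simp only [indicator_of_mem hx]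
        exact hC.comp (f := fun t => (-max t 0, x)) (Continuous.continuousOn (by fun_prop)) fun t ht =>
          ⟨⟨by have := ht.2; rw [neg_le_neg_iff]; exact max_le this.le zero_le_one, by simp⟩, hx⟩
      · simp only [indicator_of_notMem hx]
        exact continuousOn_const
    · rcases le_or_gt t 0 with h | h
      · simp only [hz2 t h x, abs_zero]; exact hB0
      · by_cases hx : x ∈ H
        · simp only [indicator_of_mem hx, max_eq_left h.le]
          exact hB t ⟨h, ht.2⟩ x hx
        · simpa only [indicator_of_notMem hx, abs_zero] using hB0
  refine ⟨hu, fun φ hφ => ?_⟩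
  have hlc : Continuous (lap φ) := (hφ.lap).smooth.continuous
  have hlcc : HasCompactSupport (lap φ) := hφ.lap.cpt
  have hφc := hφ.smooth.continuous
  have hU := hu.cint hH hφc hφ.cpt
  have hG := ((hu.nl hp).cint hH hφc hφ.cpt).sub (hu.cint hH hlc hlcc)
  have hpos : ∀ s ∈ Ioo (0:ℝ) 1, HasDerivAt (fun t => ∫ x, H.indicator (v (-max t 0)) x * φ x)
      ((∫ x, nl p (H.indicator (v (-max s 0)) x) * φ x) - ∫ x, H.indicator (v (-max s 0)) x * lap φ x) s := by
    intro s hs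
    have h1 := hw φ hφ s hs
    rw [max_eq_left hs.1.le]
    refine h1.congr_of_eventuallyEq ?_
    filter_upwards [Ioi_mem_nhds hs.1] with t ht
    rw [max_eq_left (le_of_lt ht)]
  refine upgrade hU hG ?_
  intro s hs
  rcases lt_trichotomy s 0 with h | h | h
  · have h1 : (fun t => ∫ x, H.indicator (v (-max t 0)) x * φ x) =ᶠ[𝓝 s] fun _ => 0 := by
      filter_upwards [Iio_mem_nhds h] with t ht
      simp [hz2 t (le_of_lt ht)]
    have h2 : HasDerivAt (fun _ : ℝ => (0:ℝ)) 0 s := hasDerivAt_const s 0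
    refine ((h2.congr_of_eventuallyEq h1).congr_deriv ?_).hasDerivWithinAt
    simp [hz2 s h.le, nl_zero]
  · subst h
    refine (hasDerivWithinAt_Ici_of_tendsto_deriv (s := Ioo 0 1) ?_ ?_ ?_ ?_).mono Ioi_subset_Ici_self
    · exact fun s hs => (hpos s hs).differentiableAt.differentiableWithinAt
    · exact (hU 0 hs).mono (Ioo_subset_Ioo_left (by norm_num))
    · exact Ioo_mem_nhdsGT one_pos
    · have h1 := (hG.continuousAt (isOpen_Ioo.mem_nhds hs)).tendsto.mono_left
        (nhdsWithin_le_nhds (s := Ioi 0))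
      refine h1.congr' ?_
      filter_upwards [Ioo_mem_nhdsGT (zero_lt_one' ℝ)] with t ht
      exact (hpos t ht).deriv.symm
  · exact (hpos s ⟨h, hs.2⟩).hasDerivWithinAt

lemma far_zero {N : ℕ} {p : ℝ} (hp : 1 < p) {e : EuclideanSpace ℝ (Fin N)} (he : ‖e‖ = 1) {X B : ℝ}
    {u : ℝ → EuclideanSpace ℝ (Fin N) → ℝ} (hu : Cls (Ioo (-1) 1) {x | X < ⟪e, x⟫} u B)
    (hw : WeakB (Ioo (-1) 1) {x | X < ⟪e, x⟫} u (fun t x => nl p (u t x)))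
    (hz : ∀ t ≤ 0, ∀ x, u t x = 0) : ∀ t < 1, ∀ x, X < ⟪e, x⟫ → u t x = 0 := by
  have hexp := Real.exp_one_lt_d9
  have hexp2 := Real.exp_one_gt_d9
  have step : ∀ t0, 0 ≤ t0 → t0 < 1 → (∀ t < t0, ∀ x, X < ⟪e, x⟫ → u t x = 0) →
      ∀ t < 1 - (1 - t0) * (3 / 4), ∀ x, X < ⟪e, x⟫ → u t x = 0 := by
    intro t0 h0 h1 hP t ht x hx
    rcases lt_or_ge t t0 with h | h
    · exact hP t h x hx
    have hsub : Ioo (t0 - (1 - t0) / 8) 1 ⊆ Ioo (-1) 1 := Ioo_subset_Ioo_left (by linarith)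
    refine bu_shift he hp (hu.mono hsub) (fun φ hφ s hs => hw φ hφ s (hsub hs))
      (δ := (1 - t0) / 16) (X := X) (by linarith) ?_ (by linarith) ?_ hx
    · intro s hs hs2 y hy
      exact hP s (by linarith) y hy
    · nlinarith
  have hn : ∀ n : ℕ, ∀ t < 1 - (3 / 4 : ℝ) ^ n, ∀ x, X < ⟪e, x⟫ → u t x = 0 := by
    intro n
    induction n with
    | zero => intro t ht x _; exact hz t (by norm_num at ht; exact ht.le) x
    | succ n ih =>
      have h1 : (0:ℝ) < (3 / 4 : ℝ) ^ n := by positivity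
      have h2 : (3 / 4 : ℝ) ^ n ≤ 1 := pow_le_one₀ (by norm_num) (by norm_num)
      have := step (1 - (3 / 4 : ℝ) ^ n) (by linarith) (by linarith) ih
      intro t ht
      refine this t ?_
      rw [pow_succ] at ht
      linarith
  intro t ht x hx
  obtain ⟨n, hn'⟩ := exists_pow_lt_of_lt_one (sub_pos.2 ht) (show (3 / 4 : ℝ) < 1 by norm_num)
  exact hn n t (by linarith) x hx

end Aux20

/-- backward uniqueness and unique continuation for the semilinear heat
equation on `(−1,0) × D`, `D = ℝ^N` or a half-space: a classical solution `v` with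
`|v(s,y)| ≤ M|s|^{−β}`, bounded on the exterior region `{|y| ≥ R}`, extending in a `C^{1,2}`
way up to `s = 0` there, and vanishing at `s = 0` for `|y| ≥ K` (`K ≥ R+1`), must vanish
identically on `(−1,0) × D`. -/
theorem backward_uniqueness_unique_continuation_vanishing
    (N : ℕ) (hN : 1 ≤ N) (p : ℝ) (hp : 1 < p)
    (D : Set (EuclideanSpace ℝ (Fin N)))
    (hD : D = univ ∨
      ∃ (e : EuclideanSpace ℝ (Fin N)) (c : ℝ), e ≠ 0 ∧ D = {y | c < ⟪e, y⟫})
    (v : ℝ → EuclideanSpace ℝ (Fin N) → ℝ)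
    -- classical solution of `v_t = Δv + |v|^{p−1}v` on `(−1,0) × D` with Dirichlet BC
    (hregx : ∀ s ∈ Ioo (-1:ℝ) 0, ContDiffOn ℝ 2 (v s) D)
    (hregt : ∀ y ∈ D, ∀ s ∈ Ioo (-1:ℝ) 0, DifferentiableAt ℝ (fun σ => v σ y) s)
    (hpde : ∀ s ∈ Ioo (-1:ℝ) 0, ∀ y ∈ D,
      deriv (fun σ => v σ y) s = lap (v s) y + |v s y| ^ (p - 1) * v s y)
    (hbc : ∀ s ∈ Ioo (-1:ℝ) 0, ∀ y ∈ frontier D, v s y = 0)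
    -- type I bound
    (M : ℝ) (hM : 0 < M)
    (hbound : ∀ s ∈ Ioo (-1:ℝ) 0, ∀ y ∈ D, |v s y| ≤ M * |s| ^ (-(1 / (p - 1))))
    -- boundedness and `C^{1,2}` extension up to `s = 0` on the exterior region
    (R : ℝ) (hR : 0 < R)
    (hext : ∃ M₀, ∀ s ∈ Ioo (-1:ℝ) 0, ∀ y ∈ closure D, R ≤ ‖y‖ → |v s y| ≤ M₀)
    (hcont : ContinuousOn (fun q : ℝ × EuclideanSpace ℝ (Fin N) => v q.1 q.2)
      (Icc (-1:ℝ) 0 ×ˢ (closure D ∩ {y | R < ‖y‖})))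
    -- vanishing at final time outside a ball
    (K : ℝ) (hK : R + 1 ≤ K)
    (hzero : ∀ y ∈ closure D, K ≤ ‖y‖ → v 0 y = 0) :
    ∀ s ∈ Ioo (-1:ℝ) 0, ∀ y ∈ D, v s y = 0 := by
  obtain ⟨e, he, hgeo⟩ := geo hN hD
  obtain ⟨M₀, hM₀⟩ := hext
  have hopen : ∀ c : ℝ, IsOpen {x : EuclideanSpace ℝ (Fin N) | c < ⟪e, x⟫} := fun c =>
    isOpen_lt continuous_const (by fun_prop)
  have hexp := Real.exp_one_lt_d9
  have hexp2 := Real.exp_one_gt_d9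
  intro s hs y0 hy0
  obtain ⟨c, hcy, hcD⟩ := hgeo y0 hy0
  -- far region
  set X := max c K with hX
  have hnorm : ∀ x, X < ⟪e, x⟫ → K < ‖x‖ := by
    intro x hx
    have h1 := real_inner_le_norm e x
    rw [he, one_mul] at h1
    exact ((le_max_right c K).trans_lt hx).trans_le h1
  have hXD : {x : EuclideanSpace ℝ (Fin N) | X < ⟪e, x⟫} ⊆ D := fun x hx =>
    hcD ((le_max_left c K).trans_lt hx)
  have hBf : ∀ t ∈ Ioo (0:ℝ) 1, ∀ x ∈ {x : EuclideanSpace ℝ (Fin N) | X < ⟪e, x⟫},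
      |v (-t) x| ≤ |M₀| := fun t ht x hx =>
    (hM₀ (-t) ⟨by linarith [ht.2], by linarith [ht.1]⟩ x (subset_closure (hXD hx))
      (by linarith [hnorm x hx])).trans (le_abs_self _)
  have hfar := far_weak (hopen X) hp (abs_nonneg M₀)
    (hcont.mono (prod_mono le_rfl fun x hx =>
      ⟨subset_closure (hXD hx), by have := hnorm x hx; simp only [mem_setOf_eq]; linarith⟩)) hBf
    (fun x hx => hzero x (subset_closure (hXD hx)) (hnorm x hx).le)
    (base_weak hp hregx hregt hpde (hopen X) hXD le_rfl le_rfl (abs_nonneg M₀) hBf).2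
  have hfz : ∀ t ∈ Ioo (0:ℝ) 1, ∀ x, X < ⟪e, x⟫ → v (-t) x = 0 := by
    intro t ht x hx
    have := far_zero hp he hfar.1 hfar.2 (fun t ht x => by
      simp only [max_eq_right ht, neg_zero]
      by_cases hx : x ∈ {x : EuclideanSpace ℝ (Fin N) | X < ⟪e, x⟫}
      · rw [indicator_of_mem hx]
        exact hzero x (subset_closure (hXD hx)) (hnorm x hx).le
      · rw [indicator_of_notMem hx]) t ht.2 x hx
    simp only [max_eq_left ht.1.le] at this
    rwa [indicator_of_mem (show x ∈ {x : EuclideanSpace ℝ (Fin N) | X < ⟪e, x⟫} from hx)] at this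
  -- whole region
  set ts := -s with hts
  have hts0 : 0 < ts := by linarith [hs.2]
  have hts1 : ts < 1 := by linarith [hs.1]
  set η := min (ts / 2) ((1 - ts) / 2) with hη
  have hη0 : 0 < η := lt_min (by linarith) (by linarith)
  have hη1 : η ≤ ts / 2 := min_le_left _ _
  have hη2 : η ≤ (1 - ts) / 2 := min_le_right _ _
  have hta : 0 < ts - η := by linarith
  have hβ : 0 < 1 / (p - 1) := by
    have : 0 < p - 1 := by linarith
    positivity
  have hw := base_weak hp hregx hregt hpde (hopen c) hcD hta.le le_rfl
    (B := M * (ts - η) ^ (-(1 / (p - 1)))) (by positivity) (by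
      intro t ht x hx
      have ht0 : 0 < t := hta.trans ht.1
      refine (hbound (-t) ⟨by linarith [ht.2], by linarith⟩ x (hcD hx)).trans ?_
      rw [abs_neg, abs_of_pos ht0]
      exact mul_le_mul_of_nonneg_left
        (Real.rpow_le_rpow_of_nonpos hta ht.1.le (by linarith)) hM.le)
  have hfin := bu_shift he hp (δ := 1) (X := X) (ts := ts) hw.1 hw.2 one_pos (by
    intro t ht _ x hx
    have hxc : x ∈ {x : EuclideanSpace ℝ (Fin N) | c < ⟪e, x⟫} := (le_max_left c K).trans_lt hx
    simp only [indicator_of_mem hxc]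
    exact hfz t ⟨hta.trans ht.1, ht.2⟩ x hx) (by linarith) (by nlinarith) hcy
  rw [indicator_of_mem (show y0 ∈ {x : EuclideanSpace ℝ (Fin N) | c < ⟪e, x⟫} from hcy)] at hfin
  rwa [hts, neg_neg] at hfin
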